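/- Let C ⊆ [0,1] be a compact set containing 0 and 1, and for t ∈ C let L_t = ℝ × {t} ⊆ ℝ × [0,1]. Let Σ = ∂([−1,1] × [0,1]) = ({−1,1} × [0,1]) ∪ ([−1,1] × {0,1}), and let g : Σ → ℝ × [0,1] be a topological embedding such that for every t ∈ C: g(Σ ∩ L_t) ⊆ L_t and g(Σ) ∩ L_t ⊆ g(Σ ∩ L_t). Then there is a homeomorphism h : ℝ × [0,1] → ℝ × [0,1] such that h(L_t) = L_t for every t ∈ C and h = g on Σ. -/

import Mathlib

/-- The horizontal line `L_t = ℝ × {t}` in the ambient space `ℝ × ℝ`. -/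
def hLine (t : ℝ) : Set (ℝ × ℝ) := Set.univ ×ˢ {t}

/-- The strip `ℝ × [0,1] ⊆ ℝ × ℝ`. -/
def strip2 : Set (ℝ × ℝ) := Set.univ ×ˢ Set.Icc (0 : ℝ) 1

/-- The boundary `Σ = ∂([−1,1] × [0,1]) = ({−1,1} × [0,1]) ∪ ([−1,1] × {0,1})` of the
square. -/
def sqBoundary : Set (ℝ × ℝ) :=
  (({-1, 1} : Set ℝ) ×ˢ Set.Icc (0 : ℝ) 1) ∪
    (Set.Icc (-1 : ℝ) 1 ×ˢ ({0, 1} : Set ℝ))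


set_option linter.unusedVariables false
namespace Schoen
open Set Filter Topology Metric

lemma tietze {α : Type*} [TopologicalSpace α] [NormalSpace α] {X : Set α} (hX : IsClosed X)
    {u : α → ℂ} (hu : ContinuousOn u X) : ∃ v : α → ℂ, Continuous v ∧ EqOn v u X := by
  obtain ⟨g, hg⟩ := ContinuousMap.exists_restrict_eq hX
    (⟨fun x : X => u x, continuousOn_iff_continuous_domRestrict.mp hu⟩ : C(X, ℂ))
  refine ⟨g, g.continuous, fun z hz => ?_⟩
  have := congrArg (fun f : C(X, ℂ) => f ⟨z, hz⟩) hg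
  exact this

lemma tietzeR {α : Type*} [TopologicalSpace α] [NormalSpace α] {X : Set α} (hX : IsClosed X)
    {u : α → ℝ} (hu : ContinuousOn u X) : ∃ v : α → ℝ, Continuous v ∧ EqOn v u X := by
  obtain ⟨g, hg⟩ := ContinuousMap.exists_restrict_eq hX
    (⟨fun x : X => u x, continuousOn_iff_continuous_domRestrict.mp hu⟩ : C(X, ℝ))
  refine ⟨g, g.continuous, fun z hz => ?_⟩
  have := congrArg (fun f : C(X, ℝ) => f ⟨z, hz⟩) hg
  exact this

/-- `f` has a continuous logarithm on `X`. -/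
def HasLog {α : Type*} [TopologicalSpace α] (X : Set α) (f : α → ℂ) : Prop :=
  ∃ u : α → ℂ, ContinuousOn u X ∧ ∀ z ∈ X, f z = Complex.exp (u z)

section
variable {α : Type*} [TopologicalSpace α] {X Y : Set α} {f g : α → ℂ}

lemma HasLog.mono (h : HasLog Y f) (hXY : X ⊆ Y) : HasLog X f := by
  obtain ⟨u, hu, h⟩ := h
  exact ⟨u, hu.mono hXY, fun z hz => h z (hXY hz)⟩

lemma HasLog.congr (h : HasLog X f) (hfg : ∀ z ∈ X, g z = f z) : HasLog X g := by
  obtain ⟨u, hu, h⟩ := h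
  exact ⟨u, hu, fun z hz => (hfg z hz).trans (h z hz)⟩

lemma HasLog.ne_zero (h : HasLog X f) {z : α} (hz : z ∈ X) : f z ≠ 0 := by
  obtain ⟨u, hu, h⟩ := h
  rw [h z hz]; exact Complex.exp_ne_zero _

lemma HasLog.mul (h : HasLog X f) (h' : HasLog X g) : HasLog X (fun z => f z * g z) := by
  obtain ⟨u, hu, h⟩ := h
  obtain ⟨v, hv, h'⟩ := h'
  exact ⟨fun z => u z + v z, hu.add hv, fun z hz => by simp only; rw [h z hz, h' z hz, Complex.exp_add]⟩

lemma HasLog.div (h : HasLog X f) (h' : HasLog X g) : HasLog X (fun z => f z / g z) := by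
  obtain ⟨u, hu, h⟩ := h
  obtain ⟨v, hv, h'⟩ := h'
  exact ⟨fun z => u z - v z, hu.sub hv, fun z hz => by simp only; rw [h z hz, h' z hz, Complex.exp_sub]⟩

lemma HasLog.pow (h : HasLog X f) (n : ℕ) : HasLog X (fun z => f z ^ n) := by
  obtain ⟨u, hu, h⟩ := h
  exact ⟨fun z => n * u z, continuousOn_const.mul hu, fun z hz => by
    simp only; rw [h z hz, Complex.exp_nat_mul]⟩

lemma HasLog.of_near_one (hf : ContinuousOn f X) (h : ∀ z ∈ X, ‖f z - 1‖ < 1) : HasLog X f := by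
  have hs : ∀ z ∈ X, f z ∈ Complex.slitPlane := by
    intro z hz
    have := Complex.mem_slitPlane_of_norm_lt_one (h z hz)
    simpa using this
  refine ⟨fun z => Complex.log (f z), hf.clog hs, fun z hz => ?_⟩
  rw [Complex.exp_log (Complex.slitPlane_ne_zero (hs z hz))]

lemma log_unique {S : Set α} (hS : IsPreconnected S) {u v : α → ℂ} (hu : ContinuousOn u S)
    (hv : ContinuousOn v S) (h : ∀ z ∈ S, Complex.exp (u z) = Complex.exp (v z)) :
    ∃ n : ℤ, ∀ z ∈ S, u z = v z + n * (2 * Real.pi * Complex.I) := by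
  rcases S.eq_empty_or_nonempty with rfl | ⟨z0, hz0⟩
  · exact ⟨0, by simp⟩
  have key : ∀ z ∈ S, ∃ n : ℤ, u z = v z + n * (2 * Real.pi * Complex.I) := fun z hz =>
    Complex.exp_eq_exp_iff_exists_int.mp (h z hz)
  choose! n hn using key
  have hd : ContinuousOn (fun z => ((u z - v z) / (2 * Real.pi * Complex.I)).re) S := by
    apply Complex.continuous_re.comp_continuousOn
    exact (hu.sub hv).div_const _
  have hd' : ∀ z ∈ S, ((u z - v z) / (2 * Real.pi * Complex.I)).re = n z := by
    intro z hz
    rw [hn z hz, add_sub_cancel_left, mul_div_cancel_right₀ _ Complex.two_pi_I_ne_zero]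
    simp
  have hn' : ContinuousOn n S := by
    have := hd.congr (fun z hz => (hd' z hz).symm)
    exact (Int.isClosedEmbedding_coe_real.isEmbedding.continuousOn_iff (f := n)).mpr this
  refine ⟨n z0, fun z hz => ?_⟩
  rw [hn z hz, hS.constant hn' hz hz0]
end

lemma simplyConn_univ {E : Type*} [AddCommGroup E] [Module ℝ E] [TopologicalSpace E]
    [ContinuousAdd E] [ContinuousSMul ℝ E] : IsSimplyConnected (univ : Set E) := by
  have : ContractibleSpace (univ : Set E) :=
    (convex_univ (𝕜 := ℝ)).contractibleSpace ⟨0, mem_univ _⟩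
  exact (inferInstance : SimplyConnectedSpace (univ : Set E))

lemma hasLog_univ_of_ne_zero {f : ℂ → ℂ} (hf : Continuous f) (h : ∀ z, f z ≠ 0) :
    HasLog univ f := by
  obtain ⟨u, hu, h⟩ := Complex.exists_continuousOn_eqOn_exp_comp (X := ℂ) (U := univ)
    simplyConn_univ isOpen_univ hf.continuousOn (by simpa using h)
  exact ⟨u, hu, fun z hz => (h hz).symm⟩

lemma hasLog_real {f : ℝ → ℂ} (hf : ContinuousOn f (Icc 0 1)) (h : ∀ z ∈ Icc (0:ℝ) 1, f z ≠ 0) :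
    HasLog (Icc 0 1) f := by
  have hp : Continuous (IccExtend (zero_le_one : (0:ℝ) ≤ 1) ((Icc 0 1).domRestrict f)) := by
    apply Continuous.Icc_extend'
    exact continuousOn_iff_continuous_domRestrict.mp hf
  obtain ⟨u, hu, h⟩ := Complex.exists_continuousOn_eqOn_exp_comp (X := ℝ) (U := univ)
    simplyConn_univ isOpen_univ hp.continuousOn (by
      rintro ⟨z, -, hz⟩
      exact h _ (projIcc (0:ℝ) 1 zero_le_one z).2 hz)
  refine ⟨u, hu.mono (subset_univ _), fun z hz => ?_⟩
  have := h (mem_univ z)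
  simp only [Function.comp_apply, IccExtend_of_mem _ _ hz] at this
  exact this.symm

lemma no_log_sphere (p : ℂ) {R : ℝ} (hR : 0 < R) {n : ℕ} (hn : n ≠ 0) :
    ¬ HasLog (sphere p R) (fun z => (z - p) ^ n) := by
  rintro ⟨u, hu, h⟩
  set c : ℝ → ℂ := fun t => p + R * Complex.exp (t * (2 * Real.pi * Complex.I)) with hc
  have hcS : ∀ t, c t ∈ sphere p R := by
    intro t
    have : ‖Complex.exp (t * (2 * Real.pi * Complex.I))‖ = 1 := by
      have := Complex.norm_exp_ofReal_mul_I (t * (2 * Real.pi))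
      rw [← this]; congr 2; push_cast; ring
    simp [hc, this, abs_of_pos hR]
  have hcc : Continuous c := by fun_prop
  have hR' : (R : ℂ) ≠ 0 := by exact_mod_cast hR.ne'
  obtain ⟨m, hm⟩ := log_unique (isPreconnected_univ (α := ℝ)) (u := fun t => u (c t))
    (v := fun t => n * (Complex.log R + t * (2 * Real.pi * Complex.I)))
    ((hu.comp_continuous hcc hcS).continuousOn) (by fun_prop) (by
      intro t _
      rw [← h _ (hcS t), Complex.exp_nat_mul, Complex.exp_add, Complex.exp_log hR']
      simp [hc])
  have e : c 0 = c 1 := by simp [hc, Complex.exp_two_pi_mul_I]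
  have h0 := hm 0 (mem_univ _)
  have h1 := hm 1 (mem_univ _)
  rw [e] at h0
  rw [h0] at h1
  have : (n : ℂ) * (2 * Real.pi * Complex.I) = 0 := by
    push_cast at h1
    linear_combination -h1
  rcases mul_eq_zero.mp this with h | h
  · exact hn (by exact_mod_cast h)
  · exact Complex.two_pi_I_ne_zero h

/-- E1 -/
lemma hasLog_ratio {S X : Set ℂ} (hS : IsPreconnected S) (hX : IsCompact X) (hd : Disjoint S X)
    {p q : ℂ} (hp : p ∈ S) (hq : q ∈ S) : HasLog X (fun z => (z - p) / (z - q)) := by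
  have hne : ∀ p ∈ S, ∀ z ∈ X, z - p ≠ 0 := by
    intro p hp z hz h
    rw [sub_eq_zero] at h
    exact hd.ne_of_mem hp hz h.symm
  refine hS.induction₂ (fun p q => HasLog X (fun z => (z - p) / (z - q))) ?_ ?_ ?_ hp hq
  · intro p hp
    rcases X.eq_empty_or_nonempty with rfl | hXn
    · exact Eventually.of_forall fun q => ⟨fun _ => 0, by simp, by simp⟩
    have hpX : p ∉ X := fun h => hd.ne_of_mem hp h rfl
    have hpos : 0 < infDist p X := (hX.isClosed.notMem_iff_infDist_pos hXn).mp hpX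
    have : ∀ᶠ q in 𝓝[S] p, q ∈ ball p (infDist p X / 2) :=
      mem_nhdsWithin_of_mem_nhds (ball_mem_nhds _ (by positivity))
    filter_upwards [this, self_mem_nhdsWithin] with q hq hqS
    apply HasLog.of_near_one
    · exact (continuousOn_id.sub continuousOn_const).div (continuousOn_id.sub continuousOn_const)
        (fun z hz => hne q hqS z hz)
    · intro z hz
      have h1 := hne q hqS z hz
      rw [div_sub_one h1, norm_div, div_lt_one (norm_pos_iff.mpr h1)]
      have e1 : infDist p X ≤ dist p z := infDist_le_dist_of_mem hz
      rw [mem_ball] at hq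
      have e2 : dist p z ≤ dist p q + dist q z := dist_triangle _ _ _
      rw [dist_comm q p] at hq
      have e3 : ‖z - p - (z - q)‖ = dist p q := by
        rw [dist_comm, dist_eq_norm]; congr 1; ring
      rw [e3, ← dist_eq_norm, dist_comm z q]
      linarith
  · intro x y z hx hy hz h1 h2
    refine (h1.mul h2).congr fun w hw => ?_
    have := hne y hy w hw
    have := hne z hz w hw
    field_simp
  · rintro x y hx hy h
    refine ((h.div h).div h).congr fun w hw => ?_
    have := hne y hy w hw
    have := hne x hx w hw
    field_simp

/-- E2 -/
lemma no_ext {U X : Set ℂ} (hb : Bornology.IsBounded U) (hf : frontier U ⊆ X)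
    (hX : IsClosed X) {p : ℂ} (hp : p ∈ U) {g : ℂ → ℂ}
    (hg : ContinuousOn g (closure U))
    (hg0 : ∀ z ∈ closure U, g z ≠ 0) {n : ℕ} (hn : n ≠ 0)
    (h : HasLog X (fun z => (z - p) ^ n / g z)) (hgX : ∀ z ∈ X, g z ≠ 0) : False := by
  classical
  obtain ⟨u, hu, h⟩ := h
  obtain ⟨v, hv, hvu⟩ := tietze hX hu
  set F : ℂ → ℂ := fun z => if z ∈ U then g z * Complex.exp (v z) else (z - p) ^ n with hF
  have hFc : Continuous F := by
    apply continuous_if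
    · intro z hz
      have hzX := hf hz
      rw [hvu hzX, ← h z hzX, mul_div_cancel₀ _ (hgX z hzX)]
    · exact hg.mul (Complex.continuous_exp.comp hv).continuousOn
    · exact ((continuous_id.sub continuous_const).pow n).continuousOn
  have hF0 : ∀ z, F z ≠ 0 := by
    intro z
    simp only [hF]
    split_ifs with hz
    · exact mul_ne_zero (hg0 z (subset_closure hz)) (Complex.exp_ne_zero _)
    · apply pow_ne_zero
      rw [sub_ne_zero]; rintro rfl; exact hz hp
  obtain ⟨R, hR⟩ := hb.subset_ball p
  have hR0 : 0 < R := by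
    have := hR hp
    rw [mem_ball, dist_self] at this; exact this
  refine no_log_sphere p hR0 hn (((hasLog_univ_of_ne_zero hFc hF0).mono (subset_univ _)).congr ?_)
  intro z hz
  have : z ∉ U := fun h => by
    have := hR h
    rw [mem_ball] at this; rw [mem_sphere] at hz; linarith
  simp [hF, this]

lemma ext_preconnected (c : ℂ) (R : ℝ) : IsPreconnected (closedBall c R)ᶜ := by
  rcases lt_or_ge R 0 with h | h
  · rw [closedBall_eq_empty.mpr h, compl_empty]; exact isPreconnected_univ
  · rcases h.eq_or_lt with rfl | h
    · rw [closedBall_zero]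
      exact (isConnected_compl_singleton_of_one_lt_rank (by simp) c).isPreconnected
    have : (closedBall c R)ᶜ = (fun z => c + Complex.exp z) '' {z | Real.log R < z.re} := by
      ext w
      simp only [mem_compl_iff, mem_closedBall, not_le, mem_image, mem_ofPred_eq]
      constructor
      · intro hw
        have h0 : w - c ≠ 0 := by
          intro h0; rw [dist_eq_norm, h0, norm_zero] at hw; linarith
        refine ⟨Complex.log (w - c), ?_, by rw [Complex.exp_log h0]; ring⟩
        rw [Complex.log_re]
        rw [dist_eq_norm] at hw
        exact Real.log_lt_log h hw
      · rintro ⟨z, hz, rfl⟩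
        rw [dist_eq_norm, add_sub_cancel_left, Complex.norm_exp]
        calc R = Real.exp (Real.log R) := (Real.exp_log h).symm
          _ < _ := Real.exp_lt_exp.mpr hz
    rw [this]
    apply IsPreconnected.image
    · exact (convex_halfSpace_re_gt _).isPreconnected
    · fun_prop

lemma frontier_comp_subset {X : Set ℂ} (hX : IsClosed X) (p : ℂ) :
    frontier (connectedComponentIn Xᶜ p) ⊆ X := by
  intro z hz
  by_contra hzX
  have ho := hX.isOpen_compl.connectedComponentIn (x := p)
  have hz2 : z ∉ connectedComponentIn Xᶜ p := by
    intro h; rw [ho.frontier_eq] at hz; exact hz.2 h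
  have hzo := hX.isOpen_compl.connectedComponentIn (x := z)
  obtain ⟨w, hw1, hw2⟩ := mem_closure_iff.mp hz.1 _ hzo (mem_connectedComponentIn hzX)
  have := connectedComponentIn_eq hw1
  rw [← connectedComponentIn_eq hw2] at this
  exact hz2 (this ▸ mem_connectedComponentIn hzX)

/-- points enclosed by `X` -/
def In (X : Set ℂ) : Set ℂ := {p | p ∉ X ∧ ¬ HasLog X (fun z => z - p)}

section
variable {X Y : Set ℂ} {p q : ℂ}

lemma hasLog_const (X : Set ℂ) {c : ℂ} (hc : c ≠ 0) : HasLog X (fun _ => c) :=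
  ⟨fun _ => Complex.log c, continuousOn_const, fun _ _ => (Complex.exp_log hc).symm⟩

lemma hasLog_far {c : ℂ} {R : ℝ} (hX : X ⊆ closedBall c R) (hq : q ∉ closedBall c R) :
    HasLog X (fun z => z - q) := by
  rcases X.eq_empty_or_nonempty with rfl | ⟨x, hx⟩
  · exact ⟨fun _ => 0, by simp, by simp⟩
  have hR : 0 ≤ R := dist_nonneg.trans (hX hx)
  rw [mem_closedBall, not_le] at hq
  have hqc : c - q ≠ 0 := by
    rw [sub_ne_zero]; rintro rfl; rw [dist_self] at hq; linarith
  have h1 : HasLog X (fun z => (z - q) / (c - q)) := by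
    apply HasLog.of_near_one (by fun_prop)
    intro z hz
    rw [div_sub_one hqc, norm_div, div_lt_one (norm_pos_iff.mpr hqc)]
    have := hX hz
    rw [mem_closedBall, dist_eq_norm] at this
    rw [dist_comm, dist_eq_norm] at hq
    calc ‖z - q - (c - q)‖ = ‖z - c‖ := by congr 1; ring
      _ < _ := by linarith
  refine (h1.mul (hasLog_const X hqc)).congr fun z hz => ?_
  field_simp

lemma in_subset_closedBall {c : ℂ} {R : ℝ} (hX : X ⊆ closedBall c R) : In X ⊆ closedBall c R := by
  intro q hq
  by_contra h
  exact hq.2 (hasLog_far hX h)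

lemma in_bounded (hX : IsCompact X) : Bornology.IsBounded (In X) := by
  obtain ⟨R, hR⟩ := hX.isBounded.subset_closedBall 0
  exact isBounded_closedBall.subset (in_subset_closedBall hR)

lemma ratio_mul {z : ℂ} (hqX : q ∉ X) (hz : z ∈ X) : z - q ≠ 0 := by
  rw [sub_ne_zero]; rintro rfl; exact hqX hz

lemma in_of_ratio (hqX : q ∉ X) (hp : p ∈ In X)
    (h : HasLog X (fun z => (z - p) / (z - q))) : q ∈ In X := by
  refine ⟨hqX, fun h' => hp.2 ((h.mul h').congr fun z hz => ?_)⟩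
  have := ratio_mul hqX hz
  field_simp

lemma in_of_conn {S : Set ℂ} (hS : IsPreconnected S) (hX : IsCompact X) (hd : Disjoint S X)
    (hp : p ∈ S) (hpI : p ∈ In X) : S ⊆ In X := fun q hq =>
  in_of_ratio (fun h => hd.ne_of_mem hq h rfl) hpI (hasLog_ratio hS hX hd hp hq)

lemma notIn_of_conn {S : Set ℂ} (hS : IsPreconnected S) (hX : IsCompact X) (hd : Disjoint S X)
    (hp : p ∈ S) (hpI : p ∉ In X) : Disjoint S (In X) :=
  Set.disjoint_left.mpr fun _ hq hqI => hpI (in_of_conn hS hX hd hq hqI hp)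

lemma comp_disjoint (X : Set ℂ) (p : ℂ) : Disjoint (connectedComponentIn Xᶜ p) X :=
  Set.disjoint_left.mpr fun _ hz => connectedComponentIn_subset _ _ hz

lemma comp_subset_in (hX : IsCompact X) (hp : p ∈ In X) : connectedComponentIn Xᶜ p ⊆ In X :=
  in_of_conn isPreconnected_connectedComponentIn hX (comp_disjoint X p)
    (mem_connectedComponentIn hp.1) hp

lemma in_open (hX : IsCompact X) : IsOpen (In X) := by
  rw [isOpen_iff_mem_nhds]
  intro p hp
  exact mem_of_superset ((hX.isClosed.isOpen_compl.connectedComponentIn).mem_nhds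
    (mem_connectedComponentIn hp.1)) (comp_subset_in hX hp)

lemma disjoint_in (X : Set ℂ) : Disjoint (In X) X := Set.disjoint_left.mpr fun _ h => h.1

/-- the exterior -/
def Out (X : Set ℂ) : Set ℂ := (X ∪ In X)ᶜ

lemma closure_in (hX : IsCompact X) : closure (In X) ⊆ X ∪ In X := by
  intro z hz
  by_contra h
  rw [mem_union, not_or] at h
  have hzo := hX.isClosed.isOpen_compl.connectedComponentIn (x := z)
  obtain ⟨w, hw1, hw2⟩ := mem_closure_iff.mp hz _ hzo (mem_connectedComponentIn h.1)
  exact h.2 (in_of_conn isPreconnected_connectedComponentIn hX (comp_disjoint X z) hw1 hw2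
    (mem_connectedComponentIn h.1))

lemma isClosed_union_in (hX : IsCompact X) : IsClosed (X ∪ In X) := by
  apply isClosed_of_closure_subset
  rw [closure_union, hX.isClosed.closure_eq]
  exact union_subset subset_union_left (closure_in hX)

lemma isCompact_union_in (hX : IsCompact X) : IsCompact (X ∪ In X) :=
  isCompact_of_isClosed_isBounded (isClosed_union_in hX) (hX.isBounded.union (in_bounded hX))

lemma out_open (hX : IsCompact X) : IsOpen (Out X) := (isClosed_union_in hX).isOpen_compl

lemma frontier_in (hX : IsCompact X) : frontier (In X) ⊆ X := by
  rw [(in_open hX).frontier_eq]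
  rintro z ⟨h1, h2⟩
  exact (closure_in hX h1).resolve_right h2

lemma closure_out (hX : IsCompact X) : closure (Out X) ⊆ X ∪ Out X := by
  intro z hz
  by_contra h
  rw [mem_union, not_or] at h
  have : z ∈ In X := by
    by_contra h2; exact h.2 (fun h3 => h3.elim h.1 h2)
  obtain ⟨w, hw1, hw2⟩ := mem_closure_iff.mp hz _ (in_open hX) this
  exact hw2 (Or.inr hw1)

lemma frontier_out (hX : IsCompact X) : frontier (Out X) ⊆ X := by
  rw [(out_open hX).frontier_eq]
  rintro z ⟨h1, h2⟩
  exact (closure_out hX h1).resolve_right h2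

lemma subset_in_of_bounded {U : Set ℂ} (hb : Bornology.IsBounded U)
    (hf : frontier U ⊆ X) (hX : IsClosed X) (hd : Disjoint U X) : U ⊆ In X := by
  intro p hp
  refine ⟨fun h => hd.ne_of_mem hp h rfl, fun h => ?_⟩
  exact no_ext hb hf hX hp (g := fun _ => 1) continuousOn_const (by simp) one_ne_zero
    (h.congr (by simp)) (by simp)

lemma joined_of_log (hX : IsCompact X) (hp : p ∉ X) (hq : q ∉ X)
    (h : HasLog X (fun z => (z - p) / (z - q))) :
    connectedComponentIn Xᶜ p = connectedComponentIn Xᶜ q := by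
  have main : ∀ {p q : ℂ}, p ∉ X → q ∉ X → HasLog X (fun z => (z - p) / (z - q)) →
      Bornology.IsBounded (connectedComponentIn Xᶜ p) →
      connectedComponentIn Xᶜ p = connectedComponentIn Xᶜ q := by
    intro p q hp hq h hb
    by_contra hne
    have hqU : q ∉ connectedComponentIn Xᶜ p := fun h => hne (connectedComponentIn_eq h)
    refine no_ext hb (frontier_comp_subset hX.isClosed p) hX.isClosed
      (mem_connectedComponentIn hp) (g := fun z => z - q) (by fun_prop) ?_ one_ne_zero
      (h.congr (by simp)) (fun z hz => ratio_mul hq hz)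
    intro z hz h0
    rw [sub_eq_zero] at h0; subst h0
    refine hq (frontier_comp_subset hX.isClosed p ⟨hz, ?_⟩)
    exact fun h => hqU (interior_subset h)
  by_cases hbp : Bornology.IsBounded (connectedComponentIn Xᶜ p)
  · exact main hp hq h hbp
  by_cases hbq : Bornology.IsBounded (connectedComponentIn Xᶜ q)
  · refine (main hq hp (((h.div h).div h).congr fun z hz => ?_) hbq).symm
    have := ratio_mul hp hz
    have := ratio_mul hq hz
    field_simp
  obtain ⟨R, hR⟩ := hX.isBounded.subset_closedBall 0
  have key : ∀ p, ¬ Bornology.IsBounded (connectedComponentIn Xᶜ p) →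
      ∀ w ∈ (closedBall (0:ℂ) R)ᶜ, connectedComponentIn Xᶜ p = connectedComponentIn Xᶜ w := by
    intro p hb w hw
    have : ¬ connectedComponentIn Xᶜ p ⊆ closedBall 0 R := fun h =>
      hb (isBounded_closedBall.subset h)
    obtain ⟨v, hv1, hv2⟩ := not_subset.mp this
    rw [connectedComponentIn_eq hv1]
    apply connectedComponentIn_eq
    exact (ext_preconnected 0 R).subset_connectedComponentIn hv2 (compl_subset_compl.mpr hR) hw
  have hn : ((closedBall (0:ℂ) R)ᶜ).Nonempty := by
    rw [nonempty_compl]; intro h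
    exact hbp (isBounded_closedBall.subset (h ▸ subset_univ _))
  obtain ⟨w, hw⟩ := hn
  rw [key p hbp w hw, key q hbq w hw]

/-- points of the exterior lie in one component -/
lemma out_joined (hX : IsCompact X) (hp : p ∈ Out X) (hq : q ∈ Out X) :
    connectedComponentIn Xᶜ p = connectedComponentIn Xᶜ q := by
  have h : ∀ p ∈ Out X, p ∉ X ∧ HasLog X (fun z => z - p) := by
    intro p hp
    have h1 : p ∉ X := fun h => hp (Or.inl h)
    refine ⟨h1, ?_⟩
    by_contra h2; exact hp (Or.inr ⟨h1, h2⟩)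
  exact joined_of_log hX (h p hp).1 (h q hq).1 ((h p hp).2.div (h q hq).2)

end

lemma hasLog_union {α : Type*} [TopologicalSpace α] {X Y : Set α} (hX : IsClosed X)
    (hY : IsClosed Y) (hXY : IsPreconnected (X ∩ Y)) {f : α → ℂ} (h1 : HasLog X f)
    (h2 : HasLog Y f) : HasLog (X ∪ Y) f := by
  classical
  obtain ⟨u, hu, h1⟩ := h1
  obtain ⟨v, hv, h2⟩ := h2
  obtain ⟨n, hn⟩ := log_unique hXY (hu.mono inter_subset_left) (hv.mono inter_subset_right)
    (fun z hz => by rw [← h1 z hz.1, ← h2 z hz.2])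
  refine ⟨fun z => if z ∈ X then u z else v z + n * (2 * Real.pi * Complex.I), ?_, ?_⟩
  · apply ContinuousOn.union_of_isClosed _ _ hX hY
    · exact hu.congr fun z hz => by simp [hz]
    · have : ContinuousOn (fun z => v z + n * (2 * Real.pi * Complex.I)) Y :=
        hv.add continuousOn_const
      refine this.congr fun z hz => ?_
      simp only
      split_ifs with h
      · exact hn z ⟨h, hz⟩
      · rfl
  · intro z hz
    simp only
    split_ifs with h
    · exact h1 z h
    · rw [Complex.exp_periodic.int_mul n, h2 z (hz.resolve_left h)]
end Schoen

set_option linter.unusedVariables false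
namespace Schoen
open Set Filter Topology Metric

section arcs
variable {E F : Type*} [MetricSpace E] [MetricSpace F]

/-- `A` is an arc from `a` to `b`. -/
def IsArc (A : Set E) (a b : E) : Prop := ∃ γ : ℝ → E, ContinuousOn γ (Icc 0 1) ∧
  InjOn γ (Icc 0 1) ∧ γ 0 = a ∧ γ 1 = b ∧ γ '' Icc 0 1 = A

lemma isArc_of_param {γ : ℝ → E} {s t : ℝ} (hst : s < t) (hc : ContinuousOn γ (Icc s t))
    (hi : InjOn γ (Icc s t)) : IsArc (γ '' Icc s t) (γ s) (γ t) := by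
  have hm : MapsTo (fun r : ℝ => s + (t - s) * r) (Icc 0 1) (Icc s t) := by
    intro r hr
    constructor <;> simp only <;> nlinarith [hr.1, hr.2]
  refine ⟨fun r => γ (s + (t - s) * r), ?_, ?_, by simp, by simp, ?_⟩
  · exact hc.comp (by fun_prop) hm
  · intro x hx y hy h
    have := hi (hm hx) (hm hy) h
    have h2 : (t - s) * (x - y) = 0 := by simp only at this; linarith
    rcases mul_eq_zero.mp h2 with h | h <;> linarith
  · ext w
    constructor
    · rintro ⟨r, hr, rfl⟩; exact ⟨_, hm hr, rfl⟩
    · rintro ⟨r, hr, rfl⟩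
      have hts : 0 < t - s := by linarith
      refine ⟨(r - s) / (t - s), ⟨div_nonneg (by linarith [hr.1]) hts.le,
        (div_le_one hts).mpr (by linarith [hr.2])⟩, ?_⟩
      simp only
      congr 1; field_simp; ring

lemma isArc_of_param_rev {γ : ℝ → E} {s t : ℝ} (hst : s < t) (hc : ContinuousOn γ (Icc s t))
    (hi : InjOn γ (Icc s t)) : IsArc (γ '' Icc s t) (γ t) (γ s) := by
  have hm : MapsTo (fun r : ℝ => s + t - r) (Icc s t) (Icc s t) := by
    intro r hr
    constructor <;> simp only <;> linarith [hr.1, hr.2]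
  have h := isArc_of_param (γ := fun r => γ (s + t - r)) hst (hc.comp (by fun_prop) hm) (by
    intro x hx y hy h
    have := hi (hm hx) (hm hy) h
    simp only at this; linarith)
  have e : (fun r => γ (s + t - r)) '' Icc s t = γ '' Icc s t := by
    ext w
    constructor
    · rintro ⟨r, hr, rfl⟩; exact ⟨_, hm hr, rfl⟩
    · rintro ⟨r, hr, rfl⟩; exact ⟨_, hm hr, by simp⟩
  rw [e] at h
  simpa using h

variable {A B : Set E} {a b c d x y : E}

lemma IsArc.symm (h : IsArc A a b) : IsArc A b a := by
  obtain ⟨γ, hc, hi, rfl, rfl, rfl⟩ := h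
  exact isArc_of_param_rev one_pos hc hi

lemma IsArc.left_mem (h : IsArc A a b) : a ∈ A := by
  obtain ⟨γ, hc, hi, rfl, rfl, rfl⟩ := h
  exact ⟨0, by simp, rfl⟩

lemma IsArc.right_mem (h : IsArc A a b) : b ∈ A := h.symm.left_mem

lemma IsArc.ne (h : IsArc A a b) : a ≠ b := by
  obtain ⟨γ, hc, hi, rfl, rfl, rfl⟩ := h
  intro h
  have := hi (by simp) (by simp) h
  norm_num at this

lemma IsArc.isCompact (h : IsArc A a b) : IsCompact A := by
  obtain ⟨γ, hc, hi, rfl, rfl, rfl⟩ := h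
  exact isCompact_Icc.image_of_continuousOn hc

lemma IsArc.isClosed (h : IsArc A a b) : IsClosed A := h.isCompact.isClosed

lemma IsArc.isPreconnected (h : IsArc A a b) : IsPreconnected A := by
  obtain ⟨γ, hc, hi, rfl, rfl, rfl⟩ := h
  exact isPreconnected_Icc.image _ hc

lemma IsArc.diff_eq {γ : ℝ → E} (hi : InjOn γ (Icc 0 1)) :
    γ '' Icc 0 1 \ {γ 0, γ 1} = γ '' Ioo 0 1 := by
  ext w
  constructor
  · rintro ⟨⟨s, hs, rfl⟩, h⟩
    simp only [mem_insert_iff, mem_singleton_iff, not_or] at h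
    refine ⟨s, ⟨lt_of_le_of_ne hs.1 ?_, lt_of_le_of_ne hs.2 ?_⟩, rfl⟩
    · rintro rfl; exact h.1 rfl
    · rintro rfl; exact h.2 rfl
  · rintro ⟨s, hs, rfl⟩
    refine ⟨⟨s, Ioo_subset_Icc_self hs, rfl⟩, ?_⟩
    simp only [mem_insert_iff, mem_singleton_iff, not_or]
    exact ⟨fun h => hs.1.ne' (hi (Ioo_subset_Icc_self hs) (by simp) h),
      fun h => hs.2.ne (hi (Ioo_subset_Icc_self hs) (by simp) h)⟩

lemma IsArc.inner_preconnected (h : IsArc A a b) : IsPreconnected (A \ {a, b}) := by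
  obtain ⟨γ, hc, hi, rfl, rfl, rfl⟩ := h
  rw [IsArc.diff_eq hi]
  exact isPreconnected_Ioo.image _ (hc.mono Ioo_subset_Icc_self)

lemma IsArc.inner_nonempty (h : IsArc A a b) : (A \ {a, b}).Nonempty := by
  obtain ⟨γ, hc, hi, rfl, rfl, rfl⟩ := h
  rw [IsArc.diff_eq hi]
  exact ⟨_, 1/2, by norm_num, rfl⟩

lemma IsArc.subset_closure_inner (h : IsArc A a b) : A ⊆ closure (A \ {a, b}) := by
  obtain ⟨γ, hc, hi, rfl, rfl, rfl⟩ := h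
  rw [IsArc.diff_eq hi]
  have := hc
  rw [← closure_Ioo (zero_ne_one (α := ℝ))] at this ⊢
  exact this.image_closure

lemma IsArc.image (h : IsArc A a b) {f : E → F} (hf : ContinuousOn f A) (hi : InjOn f A) :
    IsArc (f '' A) (f a) (f b) := by
  obtain ⟨γ, hc, hi', rfl, rfl, rfl⟩ := h
  refine ⟨f ∘ γ, hf.comp hc (mapsTo_image _ _), hi.comp hi' (mapsTo_image _ _), rfl, rfl,
    by rw [image_comp]⟩

/-- splitting -/
lemma IsArc.split (h : IsArc A a b) (hx : x ∈ A) (hxa : x ≠ a) (hxb : x ≠ b) :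
    ∃ A1 A2, IsArc A1 a x ∧ IsArc A2 x b ∧ A1 ∩ A2 = {x} ∧ A1 ∪ A2 = A := by
  obtain ⟨γ, hc, hi, rfl, rfl, rfl⟩ := h
  obtain ⟨s, hs, rfl⟩ := hx
  have h0 : 0 < s := lt_of_le_of_ne hs.1 (by rintro rfl; exact hxa rfl)
  have h1 : s < 1 := lt_of_le_of_ne hs.2 (by rintro rfl; exact hxb rfl)
  have e1 : Icc 0 s ⊆ Icc (0:ℝ) 1 := Icc_subset_Icc_right h1.le
  have e2 : Icc s 1 ⊆ Icc (0:ℝ) 1 := Icc_subset_Icc_left h0.le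
  refine ⟨γ '' Icc 0 s, γ '' Icc s 1, isArc_of_param h0 (hc.mono e1) (hi.mono e1),
    isArc_of_param h1 (hc.mono e2) (hi.mono e2), ?_, ?_⟩
  · rw [← hi.image_inter e1 e2, Icc_inter_Icc_eq_singleton h0.le h1.le, image_singleton]
  · rw [← image_union, Icc_union_Icc_eq_Icc h0.le h1.le]

lemma IsArc.start (h : IsArc A a b) {r : ℝ} (hr : 0 < r) :
    ∃ x A1 A2, IsArc A1 a x ∧ IsArc A2 x b ∧ A1 ∩ A2 = {x} ∧ A1 ∪ A2 = A ∧ A1 ⊆ ball a r := by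
  obtain ⟨γ, hc, hi, rfl, rfl, rfl⟩ := h
  have h0 := hc 0 (by simp)
  rw [Metric.continuousWithinAt_iff] at h0
  obtain ⟨δ, hδ, h0⟩ := h0 r hr
  set s := min (δ / 2) (1 / 2) with hs
  have h0' : 0 < s := by positivity
  have h1 : s < 1 := (min_le_right _ _).trans_lt (by norm_num)
  have h2 : s < δ := (min_le_left _ _).trans_lt (by linarith)
  have e1 : Icc 0 s ⊆ Icc (0:ℝ) 1 := Icc_subset_Icc_right h1.le
  have e2 : Icc s 1 ⊆ Icc (0:ℝ) 1 := Icc_subset_Icc_left h0'.le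
  refine ⟨γ s, γ '' Icc 0 s, γ '' Icc s 1, isArc_of_param h0' (hc.mono e1) (hi.mono e1),
    isArc_of_param h1 (hc.mono e2) (hi.mono e2), ?_, ?_, ?_⟩
  · rw [← hi.image_inter e1 e2, Icc_inter_Icc_eq_singleton h0'.le h1.le, image_singleton]
  · rw [← image_union, Icc_union_Icc_eq_Icc h0'.le h1.le]
  · rintro _ ⟨t, ht, rfl⟩
    apply h0 (e1 ht)
    rw [Real.dist_eq, sub_zero, abs_of_nonneg ht.1]
    linarith [ht.2]

/-- continuity of glued function -/
lemma IsArc.concat (hA : IsArc A a b) (hB : IsArc B b c) (hAB : A ∩ B = {b}) :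
    IsArc (A ∪ B) a c := by
  classical
  obtain ⟨γ, hc, hi, rfl, rfl, rfl⟩ := hA
  obtain ⟨δ, hc', hi', hb, rfl, rfl⟩ := hB
  set F : ℝ → E := fun t => if t ≤ 1 then γ t else δ (t - 1) with hF
  have eF2 : ∀ t ∈ Icc (1:ℝ) 2, F t = δ (t - 1) := by
    intro t ht
    simp only [hF]
    split_ifs with h
    · have : t = 1 := le_antisymm h ht.1
      subst this; simp [hb]
    · rfl
  have eF1 : ∀ t ∈ Icc (0:ℝ) 1, F t = γ t := fun t ht => by simp [hF, ht.2]
  have hm : MapsTo (fun t : ℝ => t - 1) (Icc 1 2) (Icc 0 1) := by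
    intro t ht; constructor <;> simp only <;> linarith [ht.1, ht.2]
  have i1 : F '' Icc 0 1 = γ '' Icc 0 1 := image_congr eF1
  have i2 : F '' Icc 1 2 = δ '' Icc 0 1 := by
    rw [image_congr eF2]
    ext w; constructor
    · rintro ⟨t, ht, rfl⟩; exact ⟨_, hm ht, rfl⟩
    · rintro ⟨t, ht, rfl⟩
      exact ⟨t + 1, ⟨by linarith [ht.1], by linarith [ht.2]⟩, by simp⟩
  have hu : Icc (0:ℝ) 2 = Icc 0 1 ∪ Icc 1 2 :=
    (Icc_union_Icc_eq_Icc (by norm_num) (by norm_num)).symm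
  have c2 : ContinuousOn F (Icc 1 2) := (hc'.comp (by fun_prop) hm).congr eF2
  have c1 : ContinuousOn F (Icc 0 1) := hc.congr eF1
  have j1 : InjOn F (Icc 0 1) := hi.congr (fun t ht => (eF1 t ht).symm)
  have j2 : InjOn F (Icc 1 2) := by
    intro x hx y hy h
    rw [eF2 x hx, eF2 y hy] at h
    have := hi' (hm hx) (hm hy) h
    simp only at this; linarith
  have cross : ∀ x ∈ Icc (0:ℝ) 1, ∀ y ∈ Icc (1:ℝ) 2, F x = F y → x = y := by
    intro x hx y hy h
    have hx1 : F x ∈ γ '' Icc 0 1 := i1 ▸ mem_image_of_mem F hx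
    have hx2 : F x ∈ δ '' Icc 0 1 := by rw [h]; exact i2 ▸ mem_image_of_mem F hy
    have : F x = γ 1 := by
      have : F x ∈ γ '' Icc 0 1 ∩ δ '' Icc 0 1 := ⟨hx1, hx2⟩
      rwa [hAB] at this
    have f1 : F 1 = γ 1 := eF1 1 (by simp)
    have e1 := j1 hx (by simp) (this.trans f1.symm)
    have e2 := j2 hy (by simp) ((h.symm.trans this).trans f1.symm)
    rw [e1, e2]
  have := isArc_of_param (γ := F) (s := 0) (t := 2) (by norm_num)
    (by rw [hu]; exact c1.union_of_isClosed c2 isClosed_Icc isClosed_Icc) (by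
      rw [hu]
      rintro x (hx | hx) y (hy | hy) h
      · exact j1 hx hy h
      · exact cross x hx y hy h
      · exact (cross y hy x hx h.symm).symm
      · exact j2 hx hy h)
  rw [hu, image_union, i1, i2, eF1 0 (by simp), eF2 2 (by simp)] at this
  convert this using 2
  norm_num

lemma IsArc.sub (h : IsArc A a b) (hx : x ∈ A) (hy : y ∈ A) (hxy : x ≠ y) :
    ∃ B ⊆ A, IsArc B x y := by
  obtain ⟨γ, hc, hi, rfl, rfl, rfl⟩ := h
  obtain ⟨s, hs, rfl⟩ := hx
  obtain ⟨t, ht, rfl⟩ := hy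
  have key : ∀ s ∈ Icc (0:ℝ) 1, ∀ t ∈ Icc (0:ℝ) 1, s < t →
      ∃ B ⊆ γ '' Icc 0 1, IsArc B (γ s) (γ t) := by
    intro s hs t ht hst
    have e : Icc s t ⊆ Icc (0:ℝ) 1 := Icc_subset_Icc hs.1 ht.2
    exact ⟨γ '' Icc s t, image_mono e, isArc_of_param hst (hc.mono e) (hi.mono e)⟩
  rcases lt_trichotomy s t with h | rfl | h
  · exact key s hs t ht h
  · exact absurd rfl hxy
  · obtain ⟨B, h1, h2⟩ := key t ht s hs h
    exact ⟨B, h1, h2.symm⟩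

/-- first hit, keeping the remaining part -/
lemma IsArc.first_hit (h : IsArc A a b) {K : Set E} (hK : IsClosed K) (ha : a ∉ K)
    (hx : (A ∩ K).Nonempty) : ∃ y ∈ K, ∃ A' ⊆ A, IsArc A' a y ∧ A' ∩ K = {y} := by
  obtain ⟨γ, hc, hi, rfl, rfl, rfl⟩ := h
  have hcl : IsCompact (Icc (0:ℝ) 1 ∩ γ ⁻¹' K) :=
    isCompact_Icc.of_isClosed_subset (hc.preimage_isClosed_of_isClosed isClosed_Icc hK)
      inter_subset_left
  have hne : (Icc (0:ℝ) 1 ∩ γ ⁻¹' K).Nonempty := by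
    obtain ⟨_, ⟨s, hs, rfl⟩, h⟩ := hx
    exact ⟨s, hs, h⟩
  obtain ⟨s, ⟨hs, hsK⟩, hmin⟩ := hcl.exists_isLeast hne
  have h0 : 0 < s := lt_of_le_of_ne hs.1 (by rintro rfl; exact ha hsK)
  have e1 : Icc 0 s ⊆ Icc (0:ℝ) 1 := Icc_subset_Icc_right hs.2
  refine ⟨γ s, hsK, γ '' Icc 0 s, image_mono e1, isArc_of_param h0 (hc.mono e1) (hi.mono e1), ?_⟩
  ext w
  simp only [mem_inter_iff, mem_image, mem_singleton_iff]
  constructor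
  · rintro ⟨⟨t, ht, rfl⟩, htK⟩
    have : s ≤ t := hmin ⟨e1 ht, htK⟩
    rw [le_antisymm ht.2 this]
  · rintro rfl
    exact ⟨⟨s, ⟨hs.1, le_rfl⟩, rfl⟩, hsK⟩

lemma IsArc.splice (hA : IsArc A a b) (hB : IsArc B b d) (had : a ≠ d) :
    ∃ C ⊆ A ∪ B, IsArc C a d := by
  by_cases haB : a ∈ B
  · obtain ⟨C, h1, h2⟩ := hB.sub haB hB.right_mem had
    exact ⟨C, h1.trans subset_union_right, h2⟩
  obtain ⟨y, hy, A', hA', h1, h2⟩ := hA.first_hit hB.isClosed haB ⟨b, hA.right_mem, hB.left_mem⟩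
  by_cases hyd : y = d
  · subst hyd; exact ⟨A', hA'.trans subset_union_left, h1⟩
  obtain ⟨B', hB', h3⟩ := hB.sub hy hB.right_mem hyd
  refine ⟨A' ∪ B', union_subset_union hA' hB', h1.concat h3 ?_⟩
  apply Subset.antisymm
  · rw [← h2]; exact inter_subset_inter_right _ hB'
  · exact singleton_subset_iff.mpr ⟨h1.right_mem, h3.left_mem⟩

lemma isArc_segment {p q : ℂ} (hpq : p ≠ q) :
    IsArc (segment ℝ p q) p q := by
  have := isArc_of_param (γ := fun t : ℝ => AffineMap.lineMap (k := ℝ) p q t) (s := 0) (t := 1)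
    one_pos (by
      apply Continuous.continuousOn
      exact AffineMap.lineMap_continuous) (by
      apply Function.Injective.injOn
      exact AffineMap.lineMap_injective ℝ hpq)
  rw [← segment_eq_image_lineMap] at this
  simpa using this

lemma exists_arc_of_open {U : Set ℂ} (hU : IsOpen U) (hc : IsPreconnected U) {p q : ℂ}
    (hp : p ∈ U) (hq : q ∈ U) (hpq : p ≠ q) : ∃ A ⊆ U, IsArc A p q := by
  have := hc.induction₂ (fun p q => p ≠ q → ∃ A ⊆ U, IsArc A p q) ?_ ?_ ?_ hp hq
  · exact this hpq
  · intro x hx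
    obtain ⟨r, hr, hb⟩ := Metric.isOpen_iff.mp hU x hx
    filter_upwards [mem_nhdsWithin_of_mem_nhds (ball_mem_nhds x hr)] with y hy hxy
    exact ⟨segment ℝ x y, ((convex_ball x r).segment_subset (mem_ball_self hr) hy).trans hb,
      isArc_segment hxy⟩
  · intro x y z hx hy hz h1 h2 hxz
    by_cases hxy : x = y
    · subst hxy; exact h2 hxz
    by_cases hyz : y = z
    · subst hyz; exact h1 hxz
    obtain ⟨A, hA, hA'⟩ := h1 hxy
    obtain ⟨B, hB, hB'⟩ := h2 hyz
    obtain ⟨C, hC, hC'⟩ := hA'.splice hB' hxz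
    exact ⟨C, hC.trans (union_subset hA hB), hC'⟩
  · intro x y hx hy h hyx
    obtain ⟨A, hA, hA'⟩ := h hyx.symm
    exact ⟨A, hA, hA'.symm⟩

/-- decomposition of a loop in two arcs -/
structure Dec (J : Set E) (x y : E) (A B : Set E) : Prop where
  arcA : IsArc A x y
  arcB : IsArc B x y
  inter : A ∩ B = {x, y}
  union : J = A ∪ B

def IsLoop (J : Set E) : Prop := ∃ x y A B, Dec J x y A B

variable {J : Set E}

lemma Dec.swap (h : Dec J x y A B) : Dec J x y B A :=
  ⟨h.arcB, h.arcA, by rw [inter_comm, h.inter], by rw [union_comm, h.union]⟩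

lemma Dec.rev (h : Dec J x y A B) : Dec J y x A B :=
  ⟨h.arcA.symm, h.arcB.symm, by rw [h.inter, pair_comm], h.union⟩

lemma Dec.isLoop (h : Dec J x y A B) : IsLoop J := ⟨x, y, A, B, h⟩

lemma Dec.ne (h : Dec J x y A B) : x ≠ y := h.arcA.ne

lemma IsLoop.isCompact (h : IsLoop J) : IsCompact J := by
  obtain ⟨x, y, A, B, h⟩ := h
  rw [h.union]; exact h.arcA.isCompact.union h.arcB.isCompact

lemma Dec.image {f : E → F} (h : Dec J x y A B) (hf : ContinuousOn f J) (hi : InjOn f J) :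
    Dec (f '' J) (f x) (f y) (f '' A) (f '' B) := by
  have hA : A ⊆ J := h.union ▸ subset_union_left
  have hB : B ⊆ J := h.union ▸ subset_union_right
  refine ⟨h.arcA.image (hf.mono hA) (hi.mono hA), h.arcB.image (hf.mono hB) (hi.mono hB), ?_, ?_⟩
  · rw [← hi.image_inter hA hB, h.inter, image_pair]
  · rw [← image_union, ← h.union]

lemma IsLoop.image {f : E → F} (h : IsLoop J) (hf : ContinuousOn f J) (hi : InjOn f J) :
    IsLoop (f '' J) := by
  obtain ⟨x, y, A, B, h⟩ := h
  exact (h.image hf hi).isLoop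

/-- move the second point along `A` -/
lemma Dec.move (h : Dec J x y A B) {z : E} (hz : z ∈ A) (hzx : z ≠ x) (hzy : z ≠ y) :
    ∃ A1 A2, IsArc A1 x z ∧ IsArc A2 z y ∧ A1 ∩ A2 = {z} ∧ A1 ∪ A2 = A ∧
      Dec J x z A1 (A2 ∪ B) ∧ Dec J z y A2 (A1 ∪ B) := by
  obtain ⟨A1, A2, h1, h2, h3, h4⟩ := h.arcA.split hz hzx hzy
  have sub1 : A1 ⊆ A := h4 ▸ subset_union_left
  have sub2 : A2 ⊆ A := h4 ▸ subset_union_right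
  have nx : x ∉ A2 := fun hx => hzx (by
    have : x ∈ A1 ∩ A2 := ⟨h1.left_mem, hx⟩
    rw [h3] at this; exact this.symm)
  have ny : y ∉ A1 := fun hx => hzy (by
    have : y ∈ A1 ∩ A2 := ⟨hx, h2.right_mem⟩
    rw [h3] at this; exact this.symm)
  have i2 : A2 ∩ B = {y} := by
    apply Subset.antisymm
    · rintro w ⟨hw1, hw2⟩
      have : w ∈ A ∩ B := ⟨sub2 hw1, hw2⟩
      rw [h.inter] at this
      rcases this with rfl | h
      · exact absurd hw1 nx
      · exact h
    · exact singleton_subset_iff.mpr ⟨h2.right_mem, h.arcB.right_mem⟩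
  have i1 : A1 ∩ B = {x} := by
    apply Subset.antisymm
    · rintro w ⟨hw1, hw2⟩
      have : w ∈ A ∩ B := ⟨sub1 hw1, hw2⟩
      rw [h.inter] at this
      rcases this with h | rfl
      · exact h
      · exact absurd hw1 ny
    · exact singleton_subset_iff.mpr ⟨h1.left_mem, h.arcB.left_mem⟩
  refine ⟨A1, A2, h1, h2, h3, h4, ⟨h1, (h2.concat h.arcB.symm i2).symm, ?_, ?_⟩,
    ⟨h2, h1.symm.concat h.arcB i1, ?_, ?_⟩⟩
  · rw [inter_union_distrib_left, h3, i1]; exact (union_comm _ _).trans rfl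
  · rw [← union_assoc, h4, h.union]
  · rw [inter_union_distrib_left, inter_comm, h3, i2]; rfl
  · rw [← union_assoc, union_comm A2, h4, h.union]

lemma IsLoop.dec_at (h : IsLoop J) (hx : x ∈ J) : ∃ y A B, Dec J x y A B := by
  obtain ⟨a, b, A, B, h⟩ := h
  by_cases hxa : x = a
  · subst hxa; exact ⟨_, _, _, h⟩
  by_cases hxb : x = b
  · subst hxb; exact ⟨_, _, _, h.rev⟩
  have key : ∀ A B, Dec J a b A B → x ∈ A → ∃ y A B, Dec J x y A B := by
    intro A B h hx
    obtain ⟨A1, A2, -, -, -, -, h', -⟩ := h.move hx hxa hxb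
    exact ⟨_, _, _, h'.rev⟩
  rw [h.union] at hx
  rcases hx with hx | hx
  · exact key A B h hx
  · exact key B A h.swap hx

lemma IsLoop.dec (h : IsLoop J) (hx : x ∈ J) (hy : y ∈ J) (hxy : x ≠ y) :
    ∃ A B, Dec J x y A B := by
  obtain ⟨z, A, B, h⟩ := h.dec_at hx
  by_cases hyz : y = z
  · subst hyz; exact ⟨_, _, h⟩
  have key : ∀ A B, Dec J x z A B → y ∈ A → ∃ A B, Dec J x y A B := by
    intro A B h hx
    obtain ⟨A1, A2, -, -, -, -, h', -⟩ := h.move hx hxy.symm hyz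
    exact ⟨_, _, h'⟩
  rw [h.union] at hy
  rcases hy with hy | hy
  · exact key A B h hy
  · exact key B A h.swap hy

lemma IsLoop.local_arc (h : IsLoop J) (ha : a ∈ J) {r : ℝ} (hr : 0 < r) :
    ∃ x y A B, Dec J x y A B ∧ A ⊆ ball a r ∧ a ∈ A ∧ a ∉ B := by
  obtain ⟨b, A, B, h⟩ := h.dec_at ha
  obtain ⟨x, A1, A2, h1, h2, h3, h4, h5⟩ := h.arcA.start hr
  obtain ⟨y, B1, B2, k1, k2, k3, k4, k5⟩ := h.arcB.start hr
  have sA1 : A1 ⊆ A := h4 ▸ subset_union_left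
  have sA2 : A2 ⊆ A := h4 ▸ subset_union_right
  have sB1 : B1 ⊆ B := k4 ▸ subset_union_left
  have sB2 : B2 ⊆ B := k4 ▸ subset_union_right
  have aA2 : a ∉ A2 := fun hx => h1.ne (by
    have : a ∈ A1 ∩ A2 := ⟨h1.left_mem, hx⟩
    rw [h3] at this; exact this)
  have bA1 : b ∉ A1 := fun hx => h2.ne (by
    have : b ∈ A1 ∩ A2 := ⟨hx, h2.right_mem⟩
    rw [h3] at this; exact this.symm)
  have aB2 : a ∉ B2 := fun hx => k1.ne (by
    have : a ∈ B1 ∩ B2 := ⟨k1.left_mem, hx⟩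
    rw [k3] at this; exact this)
  have bB1 : b ∉ B1 := fun hx => k2.ne (by
    have : b ∈ B1 ∩ B2 := ⟨hx, k2.right_mem⟩
    rw [k3] at this; exact this.symm)
  have hI : ∀ w, w ∈ A → w ∈ B → w = a ∨ w = b := by
    intro w h1 h2
    have : w ∈ A ∩ B := ⟨h1, h2⟩
    rw [h.inter] at this; exact this
  have h3' : ∀ w, w ∈ A1 → w ∈ A2 → w = x := by
    intro w h1 h2
    have : w ∈ A1 ∩ A2 := ⟨h1, h2⟩
    rw [h3] at this; exact this
  have k3' : ∀ w, w ∈ B1 → w ∈ B2 → w = y := by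
    intro w h1 h2
    have : w ∈ B1 ∩ B2 := ⟨h1, h2⟩
    rw [k3] at this; exact this
  have mx := h1.right_mem
  have mx2 := h2.left_mem
  have my := k1.right_mem
  have my2 := k2.left_mem
  have ma := h1.left_mem
  have ma' := k1.left_mem
  have mb := h2.right_mem
  have mb' := k2.right_mem
  refine ⟨x, y, A1 ∪ B1, A2 ∪ B2, ⟨h1.symm.concat k1 ?_, h2.concat k2.symm ?_, ?_, ?_⟩,
    union_subset h5 k5, Or.inl ma, fun h => h.elim aA2 aB2⟩
  · ext w; constructor
    · rintro ⟨w1, w2⟩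
      rcases hI w (sA1 w1) (sB1 w2) with rfl | rfl
      · rfl
      · exact absurd w1 bA1
    · rintro rfl; exact ⟨ma, ma'⟩
  · ext w; constructor
    · rintro ⟨w1, w2⟩
      rcases hI w (sA2 w1) (sB2 w2) with rfl | rfl
      · exact absurd w1 aA2
      · rfl
    · rintro rfl; exact ⟨mb, mb'⟩
  · ext w; constructor
    · rintro ⟨w1 | w1, w2 | w2⟩
      · left; exact h3' w w1 w2
      · rcases hI w (sA1 w1) (sB2 w2) with rfl | rfl
        · exact absurd w2 aB2
        · exact absurd w1 bA1
      · rcases hI w (sA2 w2) (sB1 w1) with rfl | rfl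
        · exact absurd w2 aA2
        · exact absurd w1 bB1
      · right; exact k3' w w1 w2
    · rintro (rfl | rfl)
      · exact ⟨Or.inl mx, Or.inl mx2⟩
      · exact ⟨Or.inr my, Or.inr my2⟩
  · rw [h.union, ← h4, ← k4]
    ext w; simp only [mem_union]; tauto

lemma Dec.subA (h : Dec J x y A B) : A ⊆ J := h.union ▸ subset_union_left
lemma Dec.subB (h : Dec J x y A B) : B ⊆ J := h.union ▸ subset_union_right

lemma IsLoop.small_arc (h : IsLoop J) {ε : ℝ} (hε : 0 < ε) : ∃ δ > 0, ∀ x ∈ J, ∀ y ∈ J, x ≠ y →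
    dist x y < δ → ∃ A B, Dec J x y A B ∧ A ⊆ closedBall x ε := by
  have hl : ∀ a : J, ∃ x y A B, Dec J x y A B ∧ A ⊆ ball (a : E) (ε / 2) ∧ (a : E) ∈ A ∧
    (a : E) ∉ B := fun a => h.local_arc a.2 (by positivity)
  choose u v A B hD hA haA haB using hl
  obtain ⟨δ, hδ, H⟩ := lebesgue_number_lemma_of_metric h.isCompact (c := fun a : J => (B a)ᶜ)
    (fun a => (hD a).arcB.isClosed.isOpen_compl)
    (fun a ha => mem_iUnion.mpr ⟨⟨a, ha⟩, haB ⟨a, ha⟩⟩)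
  refine ⟨δ, hδ, fun x hx y hy hxy hd => ?_⟩
  obtain ⟨a, ha⟩ := H x hx
  have hxB : x ∉ B a := ha (mem_ball_self hδ)
  have hyB : y ∉ B a := ha (by rw [mem_ball, dist_comm]; exact hd)
  have D := hD a
  have hxA : x ∈ A a := by rw [D.union] at hx; exact hx.resolve_right hxB
  have hyA : y ∈ A a := by rw [D.union] at hy; exact hy.resolve_right hyB
  have nB : ∀ z, z ∉ B a → z ≠ u a ∧ z ≠ v a := fun z hz =>
    ⟨by rintro rfl; exact hz D.arcB.left_mem, by rintro rfl; exact hz D.arcB.right_mem⟩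
  have hsub : A a ⊆ closedBall x ε := by
    intro z hz
    have h1 := hA a hz
    have h2 := hA a hxA
    rw [mem_ball] at h1 h2
    rw [mem_closedBall]
    have := dist_triangle_right z x a
    linarith
  obtain ⟨A1, A2, -, -, -, h4, D1, D2⟩ := D.move hxA (nB x hxB).1 (nB x hxB).2
  rw [← h4] at hyA
  rcases hyA with hyA | hyA
  · obtain ⟨P, Q, -, -, -, h5, D3, -⟩ := D1.rev.move hyA hxy.symm (nB y hyB).1
    refine ⟨P, _, D3, ?_⟩
    refine Subset.trans ?_ hsub
    rw [← h4, ← h5]; exact subset_union_left.trans subset_union_left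
  · obtain ⟨P, Q, -, -, -, h5, D3, -⟩ := D2.move hyA hxy.symm (nB y hyB).2
    refine ⟨P, _, D3, ?_⟩
    refine Subset.trans ?_ hsub
    rw [← h4, ← h5]; exact subset_union_left.trans subset_union_right

lemma continuousOn_invFunOn {α : Type*} [TopologicalSpace α] [Nonempty α] {γ : α → E} {K : Set α}
    (hK : IsCompact K) (hc : ContinuousOn γ K) (hi : InjOn γ K) :
    ContinuousOn (Function.invFunOn γ K) (γ '' K) := by
  rw [continuousOn_iff_isClosed]
  intro t ht
  refine ⟨γ '' (K ∩ t), ((hK.inter_right ht).image_of_continuousOn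
    (hc.mono inter_subset_left)).isClosed, ?_⟩
  ext w
  constructor
  · rintro ⟨h1, h2⟩
    refine ⟨⟨_, ⟨Function.invFunOn_mem h2, h1⟩, Function.invFunOn_eq h2⟩, h2⟩
  · rintro ⟨⟨s, hs, rfl⟩, h2⟩
    refine ⟨?_, h2⟩
    rw [mem_preimage, hi.leftInvOn_invFunOn hs.1]; exact hs.2

lemma IsArc.hasLog (h : IsArc A a b) {f : E → ℂ} (hf : ContinuousOn f A) (h0 : ∀ z ∈ A, f z ≠ 0) :
    HasLog A f := by
  obtain ⟨γ, hc, hi, rfl, rfl, rfl⟩ := h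
  obtain ⟨u, hu, h⟩ := hasLog_real (f := f ∘ γ) (hf.comp hc (mapsTo_image _ _))
    (fun t ht => h0 _ (mem_image_of_mem _ ht))
  have hm : MapsTo (Function.invFunOn γ (Icc 0 1)) (γ '' Icc 0 1) (Icc 0 1) := fun w hw =>
    Function.invFunOn_mem hw
  refine ⟨u ∘ Function.invFunOn γ (Icc 0 1),
    hu.comp (continuousOn_invFunOn isCompact_Icc hc hi) hm, fun z hz => ?_⟩
  rw [Function.comp_apply, ← h _ (hm hz), Function.comp_apply, Function.invFunOn_eq hz]

end arcs
end Schoen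

set_option linter.unusedVariables false
namespace Schoen
open Set Filter Topology Metric

/-- increment of a logarithm of `f` along `A` -/
def Inc (A : Set ℂ) (x y : ℂ) (f : ℂ → ℂ) (c : ℂ) : Prop :=
  ∃ u : ℂ → ℂ, ContinuousOn u A ∧ (∀ z ∈ A, f z = Complex.exp (u z)) ∧ u y - u x = c

section
variable {A B c J : Set ℂ} {x y p q : ℂ} {f g : ℂ → ℂ} {α β κ : ℂ}

lemma Inc.unique (hA : IsArc A x y) (h1 : Inc A x y f α) (h2 : Inc A x y f β) : α = β := by
  obtain ⟨u, hu, h1, rfl⟩ := h1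
  obtain ⟨v, hv, h2, rfl⟩ := h2
  obtain ⟨n, hn⟩ := log_unique hA.isPreconnected hu hv (fun z hz => by rw [← h1 z hz, ← h2 z hz])
  rw [hn y hA.right_mem, hn x hA.left_mem]; ring

lemma Inc.exists (hA : IsArc A x y) (hf : ContinuousOn f A) (h0 : ∀ z ∈ A, f z ≠ 0) :
    ∃ α, Inc A x y f α := by
  obtain ⟨u, hu, h⟩ := hA.hasLog hf h0
  exact ⟨_, u, hu, h, rfl⟩

lemma Inc.diff (hA : IsArc A x y) (hB : IsArc B x y) (h1 : Inc A x y f α) (h2 : Inc B x y f β) :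
    ∃ n : ℤ, α - β = n * (2 * Real.pi * Complex.I) := by
  obtain ⟨u, hu, h1, rfl⟩ := h1
  obtain ⟨v, hv, h2, rfl⟩ := h2
  obtain ⟨n, hn⟩ := Complex.exp_eq_exp_iff_exists_int.mp
    ((h1 x hA.left_mem).symm.trans (h2 x hB.left_mem))
  obtain ⟨m, hm⟩ := Complex.exp_eq_exp_iff_exists_int.mp
    ((h1 y hA.right_mem).symm.trans (h2 y hB.right_mem))
  refine ⟨m - n, ?_⟩
  rw [hn, hm]; push_cast; ring

lemma Inc.div (h1 : Inc A x y f α) (h2 : Inc A x y g β) :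
    Inc A x y (fun z => f z / g z) (α - β) := by
  obtain ⟨u, hu, h1, rfl⟩ := h1
  obtain ⟨v, hv, h2, rfl⟩ := h2
  exact ⟨fun z => u z - v z, hu.sub hv, fun z hz => by
    simp only; rw [h1 z hz, h2 z hz, Complex.exp_sub], by ring⟩

lemma Inc.zpow (h1 : Inc A x y f α) (n : ℤ) : Inc A x y (fun z => f z ^ n) (n * α) := by
  obtain ⟨u, hu, h1, rfl⟩ := h1
  exact ⟨fun z => n * u z, continuousOn_const.mul hu, fun z hz => by
    simp only; rw [h1 z hz, Complex.exp_int_mul], by ring⟩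

lemma Inc.hasLog (hA : IsClosed A) (hB : IsClosed B) (hAB : A ∩ B = {x, y})
    (h1 : Inc A x y f α) (h2 : Inc B x y f α) : HasLog (A ∪ B) f := by
  classical
  obtain ⟨u, hu, h1, e1⟩ := h1
  obtain ⟨v, hv, h2, e2⟩ := h2
  have mx : x ∈ A ∩ B := by rw [hAB]; simp
  obtain ⟨n, hn⟩ := Complex.exp_eq_exp_iff_exists_int.mp
    ((h1 x mx.1).symm.trans (h2 x mx.2))
  refine ⟨fun z => if z ∈ A then u z else v z + n * (2 * Real.pi * Complex.I), ?_, ?_⟩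
  · apply ContinuousOn.union_of_isClosed _ _ hA hB
    · exact hu.congr fun z hz => by simp [hz]
    · have : ContinuousOn (fun z => v z + n * (2 * Real.pi * Complex.I)) B :=
        hv.add continuousOn_const
      refine this.congr fun z hz => ?_
      simp only
      split_ifs with h
      · have : z ∈ A ∩ B := ⟨h, hz⟩
        rw [hAB] at this
        rcases this with rfl | h
        · exact hn
        · rw [mem_singleton_iff] at h; subst h
          linear_combination e1 - e2 + hn
      · rfl
  · intro z hz
    simp only
    split_ifs with h
    · exact h1 z h
    · rw [Complex.exp_periodic.int_mul n, h2 z (hz.resolve_left h)]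

lemma HasLog.inc_eq (hA : IsArc A x y) (hB : IsArc B x y) (h : HasLog (A ∪ B) f)
    (h1 : Inc A x y f α) (h2 : Inc B x y f β) : α = β := by
  obtain ⟨u, hu, h⟩ := h
  have e1 : Inc A x y f (u y - u x) := ⟨u, hu.mono subset_union_left, fun z hz => h z (Or.inl hz), rfl⟩
  have e2 : Inc B x y f (u y - u x) := ⟨u, hu.mono subset_union_right, fun z hz => h z (Or.inr hz), rfl⟩
  rw [Inc.unique hA h1 e1, Inc.unique hB h2 e2]

lemma contOn_sub (X : Set ℂ) (p : ℂ) : ContinuousOn (fun z => z - p) X := by fun_prop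

lemma Inc.exists_sub (hA : IsArc A x y) (hp : p ∉ A) : ∃ α, Inc A x y (fun z => z - p) α :=
  Inc.exists hA (contOn_sub _ _) (fun z hz => ratio_mul hp hz)

lemma Dec.in_iff (h : Dec J x y A B) (hp : p ∉ J) (h1 : Inc A x y (fun z => z - p) α)
    (h2 : Inc B x y (fun z => z - p) β) : p ∈ In J ↔ α ≠ β := by
  constructor
  · rintro ⟨-, h3⟩ rfl
    apply h3
    rw [h.union]
    exact Inc.hasLog h.arcA.isClosed h.arcB.isClosed h.inter h1 h2
  · intro hne
    refine ⟨hp, fun hl => hne ?_⟩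
    rw [h.union] at hl
    exact hl.inc_eq h.arcA h.arcB h1 h2

/-- all enclosed points of a loop are in one component -/
lemma in_joined (hJ : IsLoop J) (hp : p ∈ In J) (hq : q ∈ In J) :
    connectedComponentIn Jᶜ p = connectedComponentIn Jᶜ q := by
  have hJc := hJ.isCompact
  obtain ⟨x, y, A, B, D⟩ := hJ
  have nA : ∀ p ∈ In J, p ∉ A := fun p hp h => hp.1 (D.subA h)
  have nB : ∀ p ∈ In J, p ∉ B := fun p hp h => hp.1 (D.subB h)
  obtain ⟨α, hα⟩ := Inc.exists_sub D.arcA (nA p hp)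
  obtain ⟨β, hβ⟩ := Inc.exists_sub D.arcB (nB p hp)
  obtain ⟨α', hα'⟩ := Inc.exists_sub D.arcA (nA q hq)
  obtain ⟨β', hβ'⟩ := Inc.exists_sub D.arcB (nB q hq)
  have h1 := (D.in_iff hp.1 hα hβ).mp hp
  have h2 := (D.in_iff hq.1 hα' hβ').mp hq
  obtain ⟨m, hm⟩ := Inc.diff D.arcA D.arcB hα hβ
  obtain ⟨n, hn⟩ := Inc.diff D.arcA D.arcB hα' hβ'
  have hn0 : n ≠ 0 := by
    rintro rfl
    simp only [Int.cast_zero, zero_mul, sub_eq_zero] at hn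
    exact h2 hn
  by_contra hne
  have hqU : q ∉ connectedComponentIn Jᶜ p := fun h => hne (connectedComponentIn_eq h)
  have hqc : ∀ z ∈ closure (connectedComponentIn Jᶜ p), z - q ≠ 0 := by
    intro z hz h0
    rw [sub_eq_zero] at h0; subst h0
    refine hq.1 (frontier_comp_subset hJc.isClosed p ⟨hz, ?_⟩)
    exact fun h => hqU (interior_subset h)
  set k : ℤ := n.sign * m with hk
  refine no_ext (n := n.natAbs) ((in_bounded hJc).subset (comp_subset_in hJc hp))
    (frontier_comp_subset hJc.isClosed p) hJc.isClosed
    (mem_connectedComponentIn hp.1) (g := fun z => (z - q) ^ k)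
    ((contOn_sub _ _).zpow₀ _ (fun z hz => Or.inl (hqc z hz)))
    (fun z hz => zpow_ne_zero _ (hqc z hz)) (Int.natAbs_ne_zero.mpr hn0) ?_
    (fun z hz => zpow_ne_zero _ (ratio_mul hq.1 hz))
  have i1 := (hα.zpow n.natAbs).div (hα'.zpow k)
  have i2 := (hβ.zpow n.natAbs).div (hβ'.zpow k)
  have e : ((n.natAbs : ℤ) : ℂ) * α - k * α' = ((n.natAbs : ℤ) : ℂ) * β - k * β' := by
    have h3 : ((n.natAbs : ℤ) : ℂ) * m = k * n := by
      have : (n.natAbs : ℤ) * m = k * n := by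
        rw [hk, ← Int.sign_mul_self_eq_natAbs]; ring
      exact_mod_cast this
    have h4 : ((n.natAbs : ℤ) : ℂ) * (α - β) = k * (α' - β') := by
      rw [hm, hn, ← mul_assoc, h3, mul_assoc]
    linear_combination h4
  rw [← e] at i2
  have := Inc.hasLog D.arcA.isClosed D.arcB.isClosed D.inter i1 i2
  rw [← D.union] at this
  exact this.congr fun z hz => by rw [zpow_natCast]

lemma in_preconnected (hJ : IsLoop J) : IsPreconnected (In J) := by
  rcases (In J).eq_empty_or_nonempty with h | ⟨p, hp⟩
  · rw [h]; exact isPreconnected_empty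
  have : In J = connectedComponentIn Jᶜ p := by
    apply Subset.antisymm
    · intro q hq
      rw [in_joined hJ hp hq]; exact mem_connectedComponentIn hq.1
    · exact comp_subset_in hJ.isCompact hp
  rw [this]; exact isPreconnected_connectedComponentIn

lemma arc_joined (hB : IsArc B x y) (hp : p ∉ B) (hq : q ∉ B) :
    connectedComponentIn Bᶜ p = connectedComponentIn Bᶜ q := by
  apply joined_of_log hB.isCompact hp hq
  apply hB.hasLog
  · exact (contOn_sub _ _).div (contOn_sub _ _) (fun z hz => ratio_mul hq hz)
  · exact fun z hz => div_ne_zero (ratio_mul hp hz) (ratio_mul hq hz)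

lemma subset_closure_of_frontier (hJ : IsLoop J) {W : Set ℂ} (hW : IsOpen W)
    (hf : frontier W ⊆ J) (hd : Disjoint W J) (hp : p ∈ W) (hqW : q ∉ W) (hqJ : q ∉ J) :
    J ⊆ closure W := by
  intro a ha
  by_contra hac
  obtain ⟨r, hr, hb⟩ := Metric.isOpen_iff.mp isClosed_closure.isOpen_compl a hac
  obtain ⟨x, y, A, B, D, hA, -, -⟩ := hJ.local_arc ha hr
  have hpJ : p ∉ J := fun h => hd.ne_of_mem hp h rfl
  have hpB : p ∉ B := fun h => hpJ (D.subB h)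
  have hqB : q ∉ B := fun h => hqJ (D.subB h)
  have hj := arc_joined D.arcB hpB hqB
  have key : connectedComponentIn Bᶜ p ⊆ W := by
    apply isPreconnected_connectedComponentIn.subset_of_closure_inter_subset hW
      ⟨p, mem_connectedComponentIn hpB, hp⟩
    rintro z ⟨hz1, hz2⟩
    by_contra hzW
    have hzf : z ∈ frontier W := by rw [hW.frontier_eq]; exact ⟨hz1, hzW⟩
    have hzJ := hf hzf
    rw [D.union] at hzJ
    rcases hzJ with h | h
    · exact hb (hA h) hz1
    · exact connectedComponentIn_subset _ _ hz2 h
  exact hqW (key (hj ▸ mem_connectedComponentIn hqB))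

lemma exists_far (hJ : IsCompact J) : ∃ q, q ∉ J ∧ q ∉ In J := by
  have hb := hJ.isBounded.union (in_bounded hJ)
  by_contra! h
  apply NormedSpace.unbounded_univ ℝ ℂ
  refine hb.subset fun q _ => ?_
  by_cases hq : q ∈ J
  · exact Or.inl hq
  · exact Or.inr (h q hq)

lemma subset_closure_in (hJ : IsLoop J) (hn : (In J).Nonempty) : J ⊆ closure (In J) := by
  obtain ⟨p, hp⟩ := hn
  obtain ⟨q, h1, h2⟩ := exists_far hJ.isCompact
  exact subset_closure_of_frontier hJ (in_open hJ.isCompact) (frontier_in hJ.isCompact)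
    (disjoint_in J) hp h2 h1

lemma subset_closure_out (hJ : IsLoop J) (hn : (In J).Nonempty) : J ⊆ closure (Out J) := by
  obtain ⟨p, hp⟩ := hn
  obtain ⟨q, h1, h2⟩ := exists_far hJ.isCompact
  refine subset_closure_of_frontier hJ (out_open hJ.isCompact) (frontier_out hJ.isCompact)
    (Set.disjoint_left.mpr fun z hz h => hz (Or.inl h)) (p := q) (q := p)
    (fun h => h.elim h1 h2) (fun h => h (Or.inr hp)) hp.1

lemma closure_in_eq (hJ : IsLoop J) (hn : (In J).Nonempty) : closure (In J) = J ∪ In J :=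
  Subset.antisymm (closure_in hJ.isCompact) (union_subset (subset_closure_in hJ hn) subset_closure)

lemma in_fill {X : Set ℂ} (hJ : IsCompact J) (hX : IsCompact X) (hXJ : X ⊆ J ∪ In J) :
    In X ⊆ J ∪ In J := by
  intro p hp
  by_contra hpo
  have hpo : p ∈ Out J := hpo
  have hcomp : connectedComponentIn Jᶜ p ⊆ Out J := by
    intro z hz
    have := notIn_of_conn isPreconnected_connectedComponentIn hJ (comp_disjoint J p)
      (mem_connectedComponentIn (fun h => hpo (Or.inl h))) (fun h => hpo (Or.inr h))
    rintro (h | h)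
    · exact connectedComponentIn_subset _ _ hz h
    · exact this.ne_of_mem hz h rfl
  have hsub : connectedComponentIn Jᶜ p ⊆ In X :=
    in_of_conn isPreconnected_connectedComponentIn hX
      (Set.disjoint_left.mpr fun z hz h => hcomp hz (hXJ h))
      (mem_connectedComponentIn (fun h => hpo (Or.inl h))) hp
  have hout : Out J ⊆ In X := by
    intro q hq
    apply hsub
    rw [out_joined hJ hpo hq]
    exact mem_connectedComponentIn (fun h => hq (Or.inl h))
  apply NormedSpace.unbounded_univ ℝ ℂ
  refine ((hJ.isBounded.union (in_bounded hJ)).union (in_bounded hX)).subset fun q _ => ?_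
  by_cases h : q ∈ J ∪ In J
  · exact Or.inl h
  · exact Or.inr (hout h)

/-- for closed sub-configurations: enclosed points of a subset of a closed cell are enclosed -/
lemma in_sub {X : Set ℂ} (hJ : IsLoop J) (hn : (In J).Nonempty) (hX : IsCompact X)
    (hXJ : X ⊆ J ∪ In J) : In X ⊆ In J := by
  have h1 := in_fill hJ.isCompact hX hXJ
  intro p hp
  rcases h1 hp with h | h
  · exfalso
    obtain ⟨w, hw1, hw2⟩ := mem_closure_iff.mp (subset_closure_out hJ hn h) _ (in_open hX) hp
    exact hw2 (h1 hw1)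
  · exact h

/-- theta curve data -/
structure Theta (J : Set ℂ) (x y : ℂ) (A B c : Set ℂ) : Prop where
  dec : Dec J x y A B
  ne : (In J).Nonempty
  arc : IsArc c x y
  sub : c \ {x, y} ⊆ In J

lemma Theta.swap (h : Theta J x y A B c) : Theta J x y B A c := ⟨h.dec.swap, h.ne, h.arc, h.sub⟩

lemma Theta.decA (h : Theta J x y A B c) : Dec (A ∪ c) x y A c := by
  refine ⟨h.dec.arcA, h.arc, ?_, rfl⟩
  apply Subset.antisymm
  · rintro z ⟨h1, h2⟩
    by_contra h3
    exact (h.sub ⟨h2, h3⟩).1 (h.dec.subA h1)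
  · rintro z (rfl | rfl)
    · exact ⟨h.dec.arcA.left_mem, h.arc.left_mem⟩
    · exact ⟨h.dec.arcA.right_mem, h.arc.right_mem⟩

lemma Theta.decB (h : Theta J x y A B c) : Dec (B ∪ c) x y B c := h.swap.decA

lemma Theta.c_sub (h : Theta J x y A B c) : c ⊆ J ∪ In J := by
  intro z hz
  by_cases h1 : z ∈ ({x, y} : Set ℂ)
  · left
    rcases h1 with rfl | rfl
    · exact h.dec.subA h.dec.arcA.left_mem
    · exact h.dec.subA h.dec.arcA.right_mem
  · exact Or.inr (h.sub ⟨hz, h1⟩)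

lemma Theta.inA_sub (h : Theta J x y A B c) : In (A ∪ c) ⊆ In J :=
  in_sub h.dec.isLoop h.ne h.decA.isLoop.isCompact
    (union_subset (h.dec.subA.trans subset_union_left) h.c_sub)

lemma Theta.inB_sub (h : Theta J x y A B c) : In (B ∪ c) ⊆ In J := h.swap.inA_sub

lemma Theta.cover (h : Theta J x y A B c) (hp : p ∈ In J) (hpc : p ∉ c) :
    p ∈ In (A ∪ c) ∨ p ∈ In (B ∪ c) := by
  have hA : p ∉ A := fun h' => hp.1 (h.dec.subA h')
  have hB : p ∉ B := fun h' => hp.1 (h.dec.subB h')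
  obtain ⟨α, hα⟩ := Inc.exists_sub h.dec.arcA hA
  obtain ⟨β, hβ⟩ := Inc.exists_sub h.dec.arcB hB
  obtain ⟨κ, hκ⟩ := Inc.exists_sub h.arc hpc
  rw [h.decA.in_iff (fun h => h.elim hA hpc) hα hκ, h.decB.in_iff (fun h => h.elim hB hpc) hβ hκ]
  have := (h.dec.in_iff hp.1 hα hβ).mp hp
  by_contra! h'
  exact this (h'.1.trans h'.2.symm)

/-- not everything is on the `B` side -/
lemma Theta.not_all (h : Theta J x y A B c) (hs : In J \ c ⊆ In (B ∪ c)) : False := by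
  obtain ⟨w, hwA, hw⟩ := h.dec.arcA.inner_nonempty
  have hwJ : w ∈ J := h.dec.subA hwA
  have hwB : w ∉ B := fun hB => hw (h.dec.inter ▸ ⟨hwA, hB⟩)
  have hwc : w ∉ c := fun hc => hw (h.decA.inter ▸ ⟨hwA, hc⟩)
  have : w ∈ closure (In (B ∪ c)) := by
    rw [_root_.mem_closure_iff]
    intro o ho hwo
    obtain ⟨v, hv1, hv2⟩ := mem_closure_iff.mp (subset_closure_in h.dec.isLoop h.ne hwJ)
      (o ∩ cᶜ) (ho.inter h.arc.isClosed.isOpen_compl) ⟨hwo, hwc⟩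
    exact ⟨v, hv1.1, hs ⟨hv2, hv1.2⟩⟩
  rcases closure_in h.decB.isLoop.isCompact this with (h1 | h1) | h1
  · exact hwB h1
  · exact hwc h1
  · exact (h.inB_sub h1).1 hwJ

lemma Theta.neA (h : Theta J x y A B c) : (In (A ∪ c)).Nonempty := by
  by_contra hne
  rw [not_nonempty_iff_eq_empty] at hne
  refine h.not_all fun p hp => ?_
  rcases h.cover hp.1 hp.2 with h1 | h1
  · rw [hne] at h1; exact absurd h1 (notMem_empty _)
  · exact h1

lemma Theta.neB (h : Theta J x y A B c) : (In (B ∪ c)).Nonempty := h.swap.neA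

lemma Theta.disj (h : Theta J x y A B c) : Disjoint (In (A ∪ c)) (In (B ∪ c)) := by
  rw [Set.disjoint_left]
  intro q hq1 hq2
  refine h.not_all fun p hp => ?_
  rcases h.cover hp.1 hp.2 with h1 | h1
  · refine in_of_conn (in_preconnected h.decA.isLoop) h.decB.isLoop.isCompact ?_ hq1 hq2 h1
    rw [Set.disjoint_left]
    rintro z hz (hB | hc)
    · exact (h.inA_sub hz).1 (h.dec.subB hB)
    · exact hz.1 (Or.inr hc)
  · exact h1

lemma Theta.in_eq (h : Theta J x y A B c) :
    In J = In (A ∪ c) ∪ In (B ∪ c) ∪ (c \ {x, y}) := by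
  apply Subset.antisymm
  · intro p hp
    by_cases hpc : p ∈ c
    · right
      refine ⟨hpc, ?_⟩
      rintro (rfl | rfl)
      · exact hp.1 (h.dec.subA h.dec.arcA.left_mem)
      · exact hp.1 (h.dec.subA h.dec.arcA.right_mem)
    · left; exact h.cover hp hpc
  · exact union_subset (union_subset h.inA_sub h.inB_sub) h.sub

lemma Theta.side (h : Theta J x y A B c) {S : Set ℂ} (hS : IsPreconnected S) (hSJ : S ⊆ In J)
    (hSc : Disjoint S c) {w : ℂ} (hw : w ∈ closure S) (hwA : w ∈ A) (hw2 : w ∉ ({x, y} : Set ℂ)) :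
    S ⊆ In (A ∪ c) := by
  have hwB : w ∉ B := fun hB => hw2 (h.dec.inter ▸ ⟨hwA, hB⟩)
  have hwc : w ∉ c := fun hc => hw2 (h.decA.inter ▸ ⟨hwA, hc⟩)
  have hcov : S ⊆ In (A ∪ c) ∪ In (B ∪ c) := fun z hz =>
    h.cover (hSJ hz) (fun hc => hSc.ne_of_mem hz hc rfl)
  rcases hS.subset_or_subset (in_open h.decA.isLoop.isCompact) (in_open h.decB.isLoop.isCompact)
    h.disj hcov with h1 | h1
  · exact h1
  · exfalso
    rcases closure_in h.decB.isLoop.isCompact (closure_mono h1 hw) with (h1 | h1) | h1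
    · exact hwB h1
    · exact hwc h1
    · exact (h.inB_sub h1).1 (h.dec.subA hwA)

/-- uniform local connectivity -/
lemma ulc (hJ : IsLoop J) {a : ℂ} (ha : a ∈ J) {r : ℝ} (hr : 0 < r) : ∃ δ > 0, δ ≤ r ∧
    ∀ p ∈ In J ∩ ball a δ, ∀ q ∈ In J ∩ ball a δ, ∃ U, IsOpen U ∧ IsPreconnected U ∧
      U ⊆ In J ∩ ball a r ∧ p ∈ U ∧ q ∈ U := by
  obtain ⟨x, y, A, B, D, hA, haA, haB⟩ := hJ.local_arc ha hr
  have hBn : B.Nonempty := ⟨x, D.arcB.left_mem⟩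
  have hpos : 0 < infDist a B := (D.arcB.isClosed.notMem_iff_infDist_pos hBn).mp haB
  refine ⟨min r (infDist a B), lt_min hr hpos, min_le_left _ _, ?_⟩
  rintro p ⟨hp, hpb⟩ q ⟨hq, hqb⟩
  have hY : IsCompact (B ∪ sphere a r) := D.arcB.isCompact.union (isCompact_sphere a r)
  have hdis : Disjoint (ball a (min r (infDist a B))) (B ∪ sphere a r) := by
    rw [Set.disjoint_left]
    rintro z hz (h | h)
    · have := infDist_le_dist_of_mem (x := a) h
      rw [mem_ball, dist_comm] at hz
      have := hz.trans_le (min_le_right _ _)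
      linarith
    · rw [mem_ball] at hz; rw [mem_sphere] at h
      have := hz.trans_le (min_le_left _ _)
      linarith
  have l1 : HasLog J (fun z => (z - p) / (z - q)) :=
    hasLog_ratio (in_preconnected hJ) hJ.isCompact (disjoint_in J) hp hq
  have l2 : HasLog (B ∪ sphere a r) (fun z => (z - p) / (z - q)) :=
    hasLog_ratio (convex_ball _ _).isPreconnected hY hdis hpb hqb
  have hI : J ∩ (B ∪ sphere a r) = B := by
    apply Subset.antisymm
    · rintro z ⟨h1, h2 | h2⟩
      · exact h2
      · rw [D.union] at h1
        rcases h1 with h1 | h1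
        · have := hA h1; rw [mem_ball] at this; rw [mem_sphere] at h2; linarith
        · exact h1
    · exact fun z hz => ⟨D.subB hz, Or.inl hz⟩
  have l3 := hasLog_union hJ.isCompact.isClosed hY.isClosed
    (by rw [hI]; exact D.arcB.isPreconnected) l1 l2
  have hK : IsCompact (J ∪ (B ∪ sphere a r)) := hJ.isCompact.union hY
  have hpK : p ∉ J ∪ (B ∪ sphere a r) := fun h => h.elim hp.1 (fun h => hdis.ne_of_mem hpb h rfl)
  have hqK : q ∉ J ∪ (B ∪ sphere a r) := fun h => h.elim hq.1 (fun h => hdis.ne_of_mem hqb h rfl)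
  have hj := joined_of_log hK hpK hqK l3
  refine ⟨connectedComponentIn (J ∪ (B ∪ sphere a r))ᶜ p, hK.isClosed.isOpen_compl.connectedComponentIn,
    isPreconnected_connectedComponentIn, subset_inter ?_ ?_, mem_connectedComponentIn hpK,
    hj ▸ mem_connectedComponentIn hqK⟩
  · exact in_of_conn isPreconnected_connectedComponentIn hJ.isCompact
      ((comp_disjoint _ p).mono_right subset_union_left) (mem_connectedComponentIn hpK) hp
  · apply isPreconnected_connectedComponentIn.subset_of_closure_inter_subset isOpen_ball
      ⟨p, mem_connectedComponentIn hpK, ball_subset_ball (min_le_left _ _) hpb⟩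
    rintro z ⟨h1, h2⟩
    have h3 := closure_ball_subset_closedBall h1
    rw [mem_closedBall] at h3
    rcases h3.lt_or_eq with h | h
    · exact h
    · exact absurd (Or.inr (Or.inr h)) (connectedComponentIn_subset _ _ h2)
end
end Schoen

set_option linter.unusedVariables false
namespace Schoen
open Set Filter Topology Metric

section
variable {J : Set ℂ} {a : ℂ}

/-- assembling a sequence of arcs converging to a point -/
lemma arc_of_seq {D : Set ℂ} (haD : a ∉ D) {β : ℕ → Set ℂ} {y : ℕ → ℂ} {ρ : ℕ → ℝ}
    (hβ : ∀ n, IsArc (β n) (y n) (y (n + 1))) (hD : ∀ n, β n ⊆ D)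
    (h1 : ∀ n, β n ∩ β (n + 1) ⊆ {y (n + 1)}) (h2 : ∀ n m, n + 2 ≤ m → Disjoint (β n) (β m))
    (hρ : Tendsto ρ atTop (𝓝 0)) (hb : ∀ n, β n ⊆ ball a (ρ n)) :
    ∃ A, IsArc A (y 0) a ∧ A \ {a} ⊆ D := by
  classical
  choose g hc hi g0 g1 hg using hβ
  set γ : ℝ → ℂ := fun t => g ⌊t⌋₊ (t - ⌊t⌋₊) with hγ
  have fr : ∀ t : ℝ, 0 ≤ t → t - ⌊t⌋₊ ∈ Icc (0:ℝ) 1 := by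
    intro t ht
    have e1 := Nat.floor_le ht
    have e2 := Nat.lt_floor_add_one t
    exact ⟨by linarith, by linarith⟩
  have γmem : ∀ t : ℝ, 0 ≤ t → γ t ∈ β ⌊t⌋₊ := by
    intro t ht
    rw [← hg]; exact mem_image_of_mem _ (fr t ht)
  have γeq : ∀ n : ℕ, ∀ t ∈ Icc (n:ℝ) (n + 1), γ t = g n (t - n) := by
    intro n t ht
    rcases ht.2.lt_or_eq with h | h
    · have : ⌊t⌋₊ = n := (Nat.floor_eq_iff ((Nat.cast_nonneg n).trans ht.1)).mpr ⟨ht.1, h⟩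
      simp only [hγ, this]
    · have : ⌊t⌋₊ = n + 1 := by
        rw [h]; exact_mod_cast Nat.floor_natCast (R := ℝ) (n + 1)
      simp only [hγ, this]
      rw [h]
      push_cast
      rw [sub_self, g0, add_sub_cancel_left, g1]
  have γc : ∀ n : ℕ, ContinuousOn γ (Icc (n:ℝ) (n + 1)) := by
    intro n
    refine ((hc n).comp (f := fun t : ℝ => t - n) (by fun_prop) ?_).congr (γeq n)
    intro t ht
    exact ⟨by simp only; linarith [ht.1], by simp only; linarith [ht.2]⟩
  have γcc : ∀ n : ℕ, ContinuousOn γ (Icc (0:ℝ) n) := by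
    intro n
    induction n with
    | zero => simp
    | succ n ih =>
      have : Icc (0:ℝ) ((n + 1 : ℕ) : ℝ) = Icc 0 (n:ℝ) ∪ Icc (n:ℝ) (n + 1) := by
        push_cast
        rw [Icc_union_Icc_eq_Icc (by positivity) (by linarith)]
      rw [this]
      exact ih.union_of_isClosed (γc n) isClosed_Icc isClosed_Icc
  have γC : ContinuousOn γ (Ici 0) := by
    intro t ht
    obtain ⟨n, hn⟩ := exists_nat_gt t
    refine (γcc n t ⟨ht, hn.le⟩).mono_of_mem_nhdsWithin ?_
    rw [← Ici_inter_Iic]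
    exact inter_mem self_mem_nhdsWithin (mem_nhdsWithin_of_mem_nhds (Iic_mem_nhds hn))
  have γlt : ∀ s t : ℝ, 0 ≤ s → s < t → γ s ≠ γ t := by
    intro s t hs hst h
    have ht : 0 ≤ t := hs.trans hst.le
    have hms := γmem s hs
    have hmt := γmem t ht
    have hle : ⌊s⌋₊ ≤ ⌊t⌋₊ := Nat.floor_le_floor hst.le
    rcases hle.eq_or_lt with he | hlt
    · have h' := h
      simp only [hγ] at h'
      rw [← he] at h'
      have := hi _ (fr s hs) (by have := fr t ht; rwa [← he] at this) h'
      linarith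
    · rcases (Nat.succ_le_of_lt hlt).eq_or_lt with he | hlt
      · have hm : γ s ∈ β ⌊s⌋₊ ∩ β (⌊s⌋₊ + 1) := by
          refine ⟨hms, ?_⟩
          rw [h]; rw [← Nat.succ_eq_add_one, he]; exact hmt
        have e := h1 _ hm
        rw [mem_singleton_iff, ← g1] at e
        have := hi _ (fr s hs) (by simp) e
        have := Nat.lt_floor_add_one s
        linarith
      · exact (h2 _ _ hlt).ne_of_mem hms (h ▸ hmt) rfl
  set τ : ℝ → ℝ := fun s => s / (1 - s) with hτ
  have τ0 : ∀ s ∈ Ico (0:ℝ) 1, 0 ≤ τ s := fun s hs =>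
    div_nonneg hs.1 (by linarith [hs.2])
  have τinj : ∀ s ∈ Ico (0:ℝ) 1, ∀ t ∈ Ico (0:ℝ) 1, s < t → τ s < τ t := by
    intro s hs t ht hst
    simp only [hτ]
    rw [div_lt_div_iff₀ (by linarith [hs.2]) (by linarith [ht.2])]
    nlinarith
  set σ : ℝ → ℂ := fun s => if s < 1 then γ (τ s) else a with hσ
  have σ1 : ∀ s, s < 1 → σ s = γ (τ s) := fun s hs => by simp [hσ, hs]
  have σ1' : σ 1 = a := by simp [hσ]
  have σD : ∀ s ∈ Ico (0:ℝ) 1, σ s ∈ D := fun s hs => by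
    rw [σ1 s hs.2]; exact hD _ (γmem _ (τ0 s hs))
  have σC : ContinuousOn σ (Icc 0 1) := by
    intro s hs
    rcases hs.2.lt_or_eq with h | h
    · have hc1 : ContinuousOn (fun s => γ (τ s)) (Ico 0 1) := by
        refine γC.comp (f := τ) ?_ (fun s hs => τ0 s hs)
        apply ContinuousOn.div (by fun_prop) (by fun_prop)
        intro s hs; linarith [hs.2]
      have : ContinuousWithinAt σ (Ico 0 1) s := (hc1 s ⟨hs.1, h⟩).congr (fun t ht => σ1 t ht.2) (σ1 s h)
      refine this.mono_of_mem_nhdsWithin ?_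
      have : Ico (0:ℝ) 1 = Icc 0 1 ∩ Iio 1 := by
        ext t; simp only [mem_Ico, mem_inter_iff, mem_Icc, mem_Iio]
        constructor
        · rintro ⟨h1, h2⟩; exact ⟨⟨h1, h2.le⟩, h2⟩
        · rintro ⟨⟨h1, _⟩, h2⟩; exact ⟨h1, h2⟩
      rw [this]
      exact inter_mem self_mem_nhdsWithin (mem_nhdsWithin_of_mem_nhds (Iio_mem_nhds h))
    · subst h
      rw [Metric.continuousWithinAt_iff]
      intro ε hε
      obtain ⟨N, hN⟩ := (Metric.tendsto_atTop.mp hρ) ε hε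
      refine ⟨1 / (N + 1), by positivity, fun {s} hs hd => ?_⟩
      rw [σ1']
      rcases hs.2.lt_or_eq with h | h
      · rw [σ1 s h]
        have h0 := τ0 s ⟨hs.1, h⟩
        rw [Real.dist_eq, abs_sub_comm, abs_of_nonneg (by linarith), lt_div_iff₀ (by positivity)] at hd
        have hN' : (N : ℝ) ≤ τ s := by
          simp only [hτ]
          rw [le_div_iff₀ (by linarith)]
          nlinarith
        have h3 := hb _ (γmem _ h0)
        rw [mem_ball] at h3
        have h4 := hN _ ((Nat.le_floor_iff h0).mpr hN')
        rw [Real.dist_eq, sub_zero] at h4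
        exact h3.trans_le ((le_abs_self _).trans h4.le)
      · rw [h, σ1', dist_self]; exact hε
  refine ⟨σ '' Icc 0 1, ⟨σ, σC, ?_, ?_, σ1', rfl⟩, ?_⟩
  · have key : ∀ s ∈ Icc (0:ℝ) 1, ∀ t ∈ Icc (0:ℝ) 1, s < t → σ s ≠ σ t := by
      intro s hs t ht hst
      have hs1 : s < 1 := hst.trans_le ht.2
      rcases ht.2.lt_or_eq with h | h
      · rw [σ1 s hs1, σ1 t h]
        exact γlt _ _ (τ0 s ⟨hs.1, hs1⟩) (τinj s ⟨hs.1, hs1⟩ t ⟨ht.1, h⟩ hst)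
      · rw [h, σ1']; intro h'
        exact haD (h' ▸ σD s ⟨hs.1, hs1⟩)
    intro s hs t ht h
    rcases lt_trichotomy s t with h' | h' | h'
    · exact absurd h (key s hs t ht h')
    · exact h'
    · exact absurd h.symm (key t ht s hs h')
  · rw [σ1 0 (by norm_num)]; simp [hτ, hγ, g0]
  · rintro _ ⟨⟨s, hs, rfl⟩, h⟩
    rcases hs.2.lt_or_eq with h' | h'
    · exact σD s ⟨hs.1, h'⟩
    · subst h'; exact absurd σ1' h

lemma endcut (hJ : IsLoop J) (hn : (In J).Nonempty) (ha : a ∈ J) :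
    ∃ z ∈ In J, ∃ A, IsArc A z a ∧ A \ {a} ⊆ In J := by
  classical
  set D := In J with hDdef
  have hDo : IsOpen D := in_open hJ.isCompact
  have hDc : IsPreconnected D := in_preconnected hJ
  have haD : a ∉ D := fun h => h.1 ha
  have hcl : a ∈ closure D := subset_closure_in hJ hn ha
  have hu : ∀ r : ℝ, ∃ δ, 0 < r → 0 < δ ∧ δ ≤ r ∧
      ∀ p ∈ D ∩ ball a δ, ∀ q ∈ D ∩ ball a δ, ∃ U, IsOpen U ∧ IsPreconnected U ∧
      U ⊆ D ∩ ball a r ∧ p ∈ U ∧ q ∈ U := by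
    intro r
    by_cases hr : 0 < r
    · obtain ⟨δ, h1, h2, h3⟩ := ulc hJ ha hr
      exact ⟨δ, fun _ => ⟨h1, h2, h3⟩⟩
    · exact ⟨0, fun h => absurd h hr⟩
  choose δ hδ using hu
  let Inv : (Set ℂ × ℂ × ℂ × ℝ) → Prop := fun s =>
    IsArc s.1 s.2.1 s.2.2.1 ∧ s.1 ⊆ D ∧ 0 < s.2.2.2 ∧ s.2.2.1 ∈ ball a (δ s.2.2.2) ∧
      s.2.2.2 ≤ dist s.2.1 a
  have step : ∀ s : {s // Inv s}, ∃ s' : {s // Inv s}, ∃ β : Set ℂ,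
      IsArc β s.1.2.1 s'.1.2.1 ∧ β ⊆ s.1.1 ∧ β ∩ s'.1.1 ⊆ {s'.1.2.1} ∧
      s'.1.2.2.2 ≤ s.1.2.2.2 / 2 ∧ s'.1.1 ⊆ ball a s.1.2.2.2 ∧
      Disjoint s.1.1 (ball a s'.1.2.2.2) := by
    rintro ⟨⟨α, y, z, ρ⟩, hα, hαD, hρ, hz, hy⟩
    simp only at hα hαD hρ hz hy
    have hpos : 0 < infDist a α :=
      (hα.isClosed.notMem_iff_infDist_pos ⟨y, hα.left_mem⟩).mp (fun h => haD (hαD h))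
    set ρ' := min (ρ / 2) (infDist a α) with hρ'
    have hρ'0 : 0 < ρ' := by positivity
    obtain ⟨δ1, δ2, δ3⟩ := hδ ρ hρ
    obtain ⟨δ1', δ2', δ3'⟩ := hδ ρ' hρ'0
    obtain ⟨z', hz'1, hz'2⟩ := _root_.mem_closure_iff.mp hcl (ball a (min (δ ρ) (δ ρ'))) isOpen_ball
      (mem_ball_self (lt_min δ1 δ1'))
    have hdisj : Disjoint α (ball a ρ') := by
      rw [Set.disjoint_left]
      intro w hw hw'
      have := infDist_le_dist_of_mem (x := a) hw
      rw [mem_ball, dist_comm] at hw'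
      have := hw'.trans_le (min_le_right _ _)
      linarith
    have hz'b : z' ∈ ball a (δ ρ') := ball_subset_ball (min_le_right _ _) hz'1
    have hz'α : z' ∉ α := fun h => hdisj.ne_of_mem h (ball_subset_ball δ2' hz'b) rfl
    have hzz' : z ≠ z' := fun h => hz'α (h ▸ hα.right_mem)
    obtain ⟨U, hU1, hU2, hU3, hU4, hU5⟩ := δ3 z ⟨hαD hα.right_mem, hz⟩ z'
      ⟨hz'2, ball_subset_ball (min_le_left _ _) hz'1⟩
    obtain ⟨α2, hαUU, hα2⟩ := exists_arc_of_open hU1 hU2 hU4 hU5 hzz'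
    have hyα2 : y ∉ α2 := fun h => by
      have := (hU3 (hαUU h)).2
      rw [mem_ball] at this; linarith
    obtain ⟨y', hy', β, hβα, hβ, hβ2⟩ := hα.first_hit hα2.isClosed hyα2
      ⟨z, hα.right_mem, hα2.left_mem⟩
    have hy'α : y' ∈ α := hβα hβ.right_mem
    have hy'z' : y' ≠ z' := fun h => hz'α (h ▸ hy'α)
    obtain ⟨α', hα'sub, hα'⟩ := hα2.sub hy' hα2.right_mem hy'z'
    refine ⟨⟨⟨α', y', z', ρ'⟩, hα', ?_, hρ'0, hz'b, ?_⟩, β, hβ, hβα, ?_, min_le_left _ _, ?_, hdisj⟩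
    · exact fun w hw => (hU3 (hαUU (hα'sub hw))).1
    · have := infDist_le_dist_of_mem (x := a) hy'α
      rw [dist_comm]
      exact (min_le_right _ _).trans this
    · rintro w ⟨h1, h2⟩
      exact hβ2 ▸ ⟨h1, hα'sub h2⟩
    · exact fun w hw => (hU3 (hαUU (hα'sub hw))).2
  obtain ⟨y0, hy0⟩ := hn
  have hd0 : 0 < dist y0 a := dist_pos.mpr (fun h => haD (h ▸ hy0))
  obtain ⟨e1, e2, -⟩ := hδ _ hd0
  obtain ⟨z0, hz01, hz02⟩ := _root_.mem_closure_iff.mp hcl (ball a (δ (dist y0 a))) isOpen_ball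
      (mem_ball_self e1)
  have hne : y0 ≠ z0 := by
    rintro rfl; rw [mem_ball] at hz01; linarith
  obtain ⟨α0, hα0, hα0'⟩ := exists_arc_of_open hDo hDc hy0 hz02 hne
  let s0 : {s // Inv s} := ⟨⟨α0, y0, z0, dist y0 a⟩, hα0', hα0, hd0, hz01, le_rfl⟩
  choose nx bt r1 r2 r3 r4 r5 r6 using step
  let S : ℕ → {s // Inv s} := fun n => nx^[n] s0
  have hS : ∀ n, S (n + 1) = nx (S n) := fun n => Function.iterate_succ_apply' _ _ _
  have hρmono : ∀ n, (S (n+1)).1.2.2.2 ≤ (S n).1.2.2.2 / 2 := fun n => by rw [hS]; exact r4 _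
  have hρpos : ∀ n, 0 < (S n).1.2.2.2 := fun n => (S n).2.2.2.1
  have hρanti : Antitone (fun n => (S n).1.2.2.2) := antitone_nat_of_succ_le fun n => by
    have := hρmono n; have := hρpos n; linarith
  have hρgeo : ∀ n, (S n).1.2.2.2 ≤ dist y0 a * (1/2) ^ n := by
    intro n
    induction n with
    | zero => simp [S, s0]
    | succ n ih => have := hρmono n; rw [pow_succ]; linarith
  have hρt : Tendsto (fun n => (S n).1.2.2.2) atTop (𝓝 0) := by
    refine squeeze_zero (fun n => (hρpos n).le) hρgeo ?_
    have := (tendsto_pow_atTop_nhds_zero_of_lt_one (r := (1/2:ℝ)) (by norm_num) (by norm_num)).const_mul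
      (dist y0 a)
    simpa using this
  have hball : ∀ n, bt (S (n+1)) ⊆ ball a (S n).1.2.2.2 := fun n => by
    refine (r2 _).trans ?_
    rw [hS]; exact r5 _
  have key := arc_of_seq (a := a) (D := D) haD (β := fun n => bt (S (n+1)))
    (y := fun n => (S (n+1)).1.2.1) (ρ := fun n => (S n).1.2.2.2)
    (fun n => by rw [hS (n+1)]; exact r1 _)
    (fun n => (r2 _).trans (S (n+1)).2.2.1) ?_ ?_ hρt hball
  · obtain ⟨A, hA, hA2⟩ := key
    refine ⟨_, ?_, A, hA, hA2⟩
    exact (S 1).2.2.1 (S 1).2.1.left_mem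
  · rintro n w ⟨h1, h2⟩
    rw [hS (n+1)] at h2 ⊢
    exact r3 _ ⟨h1, r2 _ h2⟩
  · intro n m hnm
    obtain ⟨k, rfl⟩ : ∃ k, m = n + 2 + k := ⟨m - (n + 2), by omega⟩
    have h1 : bt (S (n + 2 + k + 1)) ⊆ ball a (S (n + 2)).1.2.2.2 :=
      (hball _).trans (ball_subset_ball (hρanti (by omega)))
    have h2 := r6 (S (n+1))
    rw [← hS] at h2
    exact h2.mono (r2 _) h1

lemma crosscut (hJ : IsLoop J) (hn : (In J).Nonempty) {x y : ℂ} (hx : x ∈ J) (hy : y ∈ J)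
    (hxy : x ≠ y) : ∃ c, IsArc c x y ∧ c \ {x, y} ⊆ In J := by
  obtain ⟨zx, hzx, A, hA, hA2⟩ := endcut hJ hn hx
  obtain ⟨zy, hzy, B, hB, hB2⟩ := endcut hJ hn hy
  have hxzy : x ≠ zy := fun h => hzy.1 (h ▸ hx)
  have hAs : A ⊆ insert x (In J) := fun w hw => by
    by_cases h : w = x
    · exact Or.inl h
    · exact Or.inr (hA2 ⟨hw, h⟩)
  have : ∃ C ⊆ insert x (In J), IsArc C x zy := by
    by_cases h : zx = zy
    · subst h; exact ⟨A, hAs, hA.symm⟩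
    · obtain ⟨M, hM, hM2⟩ := exists_arc_of_open (in_open hJ.isCompact) (in_preconnected hJ) hzx hzy h
      obtain ⟨C, hC, hC2⟩ := hA.symm.splice hM2 hxzy
      exact ⟨C, hC.trans (union_subset hAs (hM.trans (subset_insert _ _))), hC2⟩
  obtain ⟨C, hC, hC2⟩ := this
  obtain ⟨c, hc, hc2⟩ := hC2.splice hB hxy
  refine ⟨c, hc2, ?_⟩
  rintro w ⟨hw, hw2⟩
  simp only [mem_insert_iff, mem_singleton_iff, not_or] at hw2
  rcases hc hw with h | h
  · exact (hC h).resolve_left hw2.1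
  · exact hB2 ⟨h, hw2.2⟩
end
end Schoen

set_option linter.unusedVariables false
namespace Schoen
open Set Filter Topology Metric

structure Line (P : ℝ → ℂ) (L : ℂ → ℝ) (s : ℝ) : Prop where
  iso : Isometry P
  lip : ∀ z w, |L z - L w| ≤ dist z w
  mem : ∀ z, L z = s ↔ z ∈ range P

lemma Line.re (s : ℝ) : Line (fun r => ⟨s, r⟩) Complex.re s where
  iso := by
    apply Isometry.of_dist_eq
    intro a b
    rw [Complex.dist_eq_re_im, Real.dist_eq]
    simp only [sub_self, ne_eq, OfNat.ofNat_ne_zero, not_false_eq_true, zero_pow, zero_add]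
    exact Real.sqrt_sq_eq_abs _
  lip z w := by
    rw [dist_eq_norm, ← Complex.sub_re]; exact Complex.abs_re_le_norm _
  mem z := by
    constructor
    · intro h; exact ⟨z.im, by rw [← h]⟩
    · rintro ⟨r, rfl⟩; rfl

lemma Line.im (s : ℝ) : Line (fun r => ⟨r, s⟩) Complex.im s where
  iso := by
    apply Isometry.of_dist_eq
    intro a b
    rw [Complex.dist_eq_re_im, Real.dist_eq]
    simp only [sub_self, ne_eq, OfNat.ofNat_ne_zero, not_false_eq_true, zero_pow, add_zero]
    exact Real.sqrt_sq_eq_abs _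
  lip z w := by
    rw [dist_eq_norm, ← Complex.sub_im]; exact Complex.abs_im_le_norm _
  mem z := by
    constructor
    · intro h; exact ⟨z.re, by rw [← h]⟩
    · rintro ⟨r, rfl⟩; rfl

lemma Line.cont {P : ℝ → ℂ} {L : ℂ → ℝ} {s : ℝ} (h : Line P L s) : Continuous L := by
  rw [Metric.continuous_iff]
  intro z ε hε
  exact ⟨ε, hε, fun w hw => by rw [Real.dist_eq]; exact (h.lip _ _).trans_lt hw⟩

structure Chord (D : Set ℂ) (P : ℝ → ℂ) (a b : ℝ) : Prop where
  lt : a < b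
  left : P a ∉ D
  right : P b ∉ D
  inner : ∀ r ∈ Ioo a b, P r ∈ D

lemma Chord.eq {D : Set ℂ} {P : ℝ → ℂ} {a b a' b' r : ℝ} (h : Chord D P a b) (h' : Chord D P a' b')
    (hr : r ∈ Ioo a b) (hr' : r ∈ Ioo a' b') : a = a' ∧ b = b' := by
  have h1 : a ≤ a' := by
    by_contra! hlt; exact h.left (h'.inner a ⟨hlt, hr.1.trans hr'.2⟩)
  have h2 : a' ≤ a := by
    by_contra! hlt; exact h'.left (h.inner a' ⟨hlt, hr'.1.trans hr.2⟩)
  have h3 : b ≤ b' := by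
    by_contra! hlt; exact h'.right (h.inner b' ⟨hr.1.trans hr'.2, hlt⟩)
  have h4 : b' ≤ b := by
    by_contra! hlt; exact h.right (h'.inner b ⟨hr'.1.trans hr.2, hlt⟩)
  exact ⟨le_antisymm h1 h2, le_antisymm h3 h4⟩

lemma exists_chord {D : Set ℂ} {P : ℝ → ℂ} (hP : Isometry P) (hD : IsOpen D)
    (hb : Bornology.IsBounded D) {r : ℝ} (hr : P r ∈ D) : ∃ a b, Chord D P a b ∧ r ∈ Ioo a b := by
  set T := P ⁻¹' D with hT
  have hTo : IsOpen T := hD.preimage hP.continuous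
  obtain ⟨M, hM⟩ := hb.subset_closedBall (P r)
  have hTb : ∀ t ∈ T, |t - r| ≤ M := fun t ht => by
    have := hM ht
    rwa [mem_closedBall, hP.dist_eq, Real.dist_eq] at this
  have hM0 : 0 ≤ M := by simpa using hTb r hr
  have out : ∀ t, M < |t - r| → t ∈ Tᶜ := fun t ht h => absurd (hTb t h) (not_le.mpr ht)
  have c1 : IsClosed (Tᶜ ∩ Iic r) := hTo.isClosed_compl.inter isClosed_Iic
  have c2 : IsClosed (Tᶜ ∩ Ici r) := hTo.isClosed_compl.inter isClosed_Ici
  have n1 : (Tᶜ ∩ Iic r).Nonempty := ⟨r - (M + 1), out _ (by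
    rw [show r - (M+1) - r = -(M+1) by ring, abs_neg, abs_of_pos] <;> linarith), by simp; linarith⟩
  have n2 : (Tᶜ ∩ Ici r).Nonempty := ⟨r + (M + 1), out _ (by
    rw [show r + (M+1) - r = (M+1) by ring, abs_of_pos] <;> linarith), by simp; linarith⟩
  have b1 : BddAbove (Tᶜ ∩ Iic r) := ⟨r, fun t ht => ht.2⟩
  have b2 : BddBelow (Tᶜ ∩ Ici r) := ⟨r, fun t ht => ht.2⟩
  have m1 := c1.csSup_mem n1 b1
  have m2 := c2.csInf_mem n2 b2
  have l1 : sSup (Tᶜ ∩ Iic r) < r := lt_of_le_of_ne m1.2 (fun h => m1.1 (by rw [h]; exact hr))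
  have l2 : r < sInf (Tᶜ ∩ Ici r) := lt_of_le_of_ne m2.2 (fun h => m2.1 (by rw [← h]; exact hr))
  refine ⟨_, _, ⟨l1.trans l2, m1.1, m2.1, ?_⟩, l1, l2⟩
  intro t ht
  by_contra hc
  rcases le_total t r with h | h
  · exact absurd (le_csSup b1 ⟨hc, h⟩) (not_le.mpr ht.1)
  · exact absurd (csInf_le b2 ⟨hc, h⟩) (not_le.mpr ht.2)

lemma IsLoop.isPreconnected {E : Type*} [MetricSpace E] {J : Set E} (h : IsLoop J) :
    IsPreconnected J := by
  obtain ⟨x, y, A, B, h⟩ := h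
  rw [h.union]
  exact h.arcA.isPreconnected.union x h.arcA.left_mem h.arcB.left_mem h.arcB.isPreconnected

lemma log_eq_of_near {u v : ℂ} (h : Complex.exp u = Complex.exp v) (hn : ‖u - v‖ < 1) : u = v := by
  obtain ⟨n, hn'⟩ := Complex.exp_eq_exp_iff_exists_int.mp h
  have : n = 0 := by
    by_contra hne
    rw [hn', add_sub_cancel_left, norm_mul] at hn
    have h1 : (1:ℝ) ≤ ‖(n:ℂ)‖ := by
      rw [Complex.norm_intCast]; exact_mod_cast Int.one_le_abs hne
    have h2 : ‖(2 * Real.pi * Complex.I : ℂ)‖ = 2 * Real.pi := by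
      simp [abs_of_pos Real.pi_pos]
    rw [h2] at hn
    nlinarith [Real.pi_gt_three]
  rw [hn', this]; simp

/-- gluing logarithms on the chords of a domain -/
lemma glue_chords {J D : Set ℂ} {P : ℝ → ℂ} {L : ℂ → ℝ} {s : ℝ} (hL : Line P L s)
    (hJc : IsClosed J) (hJ : IsPreconnected J) (hJn : J.Nonempty) (hD : IsOpen D)
    (hb : Bornology.IsBounded D) (hDJ : Disjoint D J)
    (hfr : closure D ⊆ J ∪ D) {f : ℂ → ℂ} (hf : ContinuousOn f (J ∪ {z ∈ D | L z = s}))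
    (hfo : ∀ z ∈ J, ContinuousAt f z)
    (h0 : HasLog J f)
    (hch : ∀ a b, Chord D P a b → HasLog (J ∪ P '' Icc a b) f) :
    HasLog (J ∪ {z ∈ D | L z = s}) f := by
  classical
  obtain ⟨u0, hu0, hu0f⟩ := h0
  have key : ∀ a b, Chord D P a b → ∃ u : ℂ → ℂ, ContinuousOn u (J ∪ P '' Icc a b) ∧
      (∀ z ∈ J ∪ P '' Icc a b, f z = Complex.exp (u z)) ∧ ∀ z ∈ J, u z = u0 z := by
    intro a b hab
    obtain ⟨u, hu, huf⟩ := hch a b hab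
    obtain ⟨n, hn⟩ := log_unique hJ (hu.mono subset_union_left) hu0
      (fun z hz => by rw [← huf z (Or.inl hz), ← hu0f z hz])
    refine ⟨fun z => u z - n * (2 * Real.pi * Complex.I), hu.sub continuousOn_const, ?_, ?_⟩
    · intro z hz
      rw [Complex.exp_sub, ← huf z hz, Complex.exp_int_mul_two_pi_mul_I, div_one]
    · intro z hz; simp only [hn z hz]; ring
  choose! v hv hvf hvJ using key
  have ex : ∀ r, P r ∈ D → ∃ a b, Chord D P a b ∧ r ∈ Ioo a b := fun r hr =>
    exists_chord hL.iso hD hb hr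
  choose! a b hab hr using ex
  have hinj := hL.iso.injective
  set R : ℂ → ℝ := Function.invFun P with hR
  have hRP : ∀ r, R (P r) = r := fun r => Function.leftInverse_invFun hinj r
  set u : ℂ → ℂ := fun z => if z ∈ J then u0 z else v (a (R z)) (b (R z)) z with hu
  have uJ : ∀ z ∈ J, u z = u0 z := fun z hz => by simp [hu, hz]
  have uD : ∀ r, P r ∈ D → u (P r) = v (a r) (b r) (P r) := fun r h => by
    have : P r ∉ J := Set.disjoint_left.mp hDJ h
    simp [hu, this, hRP]
  refine ⟨u, ?_, ?_⟩
  swap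
  · rintro z (hz | ⟨hz, hs⟩)
    · rw [uJ z hz]; exact hu0f z hz
    · obtain ⟨r, rfl⟩ := (hL.mem z).mp hs
      rw [uD r hz]
      exact hvf _ _ (hab r hz) _ (Or.inr ⟨r, Ioo_subset_Icc_self (hr r hz), rfl⟩)
  rintro z0 (hz0 | ⟨hz0, hs⟩)
  · -- boundary point
    have hf0 : f z0 ≠ 0 := by rw [hu0f z0 hz0]; exact Complex.exp_ne_zero _
    have hcz := hfo z0 hz0
    set w : ℂ → ℂ := fun z => Complex.log (f z / f z0) + u0 z0 with hw
    -- local branch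
    have hw0 : w z0 = u0 z0 := by simp [hw, div_self hf0]
    have e1 : ∀ᶠ z in 𝓝 z0, f z / f z0 ∈ Complex.slitPlane := by
      have : ContinuousAt (fun z => f z / f z0) z0 := hcz.div_const _
      apply this.eventually_mem
      rw [div_self hf0]
      exact Complex.isOpen_slitPlane.mem_nhds Complex.one_mem_slitPlane
    have hwf : ∀ z, f z / f z0 ∈ Complex.slitPlane → f z = Complex.exp (w z) := by
      intro z hz
      rw [hw]; simp only
      rw [Complex.exp_add, Complex.exp_log (Complex.slitPlane_ne_zero hz), ← hu0f z0 hz0,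
        div_mul_cancel₀ _ hf0]
    have hwc : ContinuousAt w z0 := by
      refine ContinuousAt.add (ContinuousAt.clog (hcz.div_const _) ?_) continuousAt_const
      rw [div_self hf0]; exact Complex.one_mem_slitPlane
    have e2 : ∀ᶠ z in 𝓝[J] z0, ‖u0 z - w z‖ < 1 := by
      have h1 : Tendsto (fun z => ‖u0 z - w z‖) (𝓝[J] z0) (𝓝 ‖u0 z0 - w z0‖) :=
        ((hu0 z0 hz0).sub hwc.continuousWithinAt).norm
      rw [hw0, sub_self, norm_zero] at h1
      exact h1.eventually (gt_mem_nhds one_pos)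
    obtain ⟨r1, hr1, hr1'⟩ := Metric.eventually_nhds_iff_ball.mp e1
    obtain ⟨r2, hr2, hr2'⟩ := Metric.eventually_nhds_iff_ball.mp (eventually_nhdsWithin_iff.mp e2)
    have e3 : ∃ r3 > 0, ∀ z ∈ ball z0 r3, L z = s → L z0 = s := by
      by_cases h : L z0 = s
      · exact ⟨1, one_pos, fun _ _ _ => h⟩
      · have : ∀ᶠ z in 𝓝 z0, L z ≠ s := hL.cont.continuousAt.eventually_ne h
        obtain ⟨r, hr, hr'⟩ := Metric.eventually_nhds_iff_ball.mp this
        exact ⟨r, hr, fun z hz hs => absurd hs (hr' z hz)⟩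
    obtain ⟨r3, hr3, hr3'⟩ := e3
    set ρ := min r1 (min r2 r3) with hρ
    have hρ0 : 0 < ρ := lt_min hr1 (lt_min hr2 hr3)
    have uwJ : ∀ z ∈ J, z ∈ ball z0 ρ → u0 z = w z := by
      intro z hz hzb
      apply log_eq_of_near
      · rw [← hu0f z hz, ← hwf z (hr1' z (ball_subset_ball (min_le_left _ _) hzb))]
      · exact hr2' z (ball_subset_ball ((min_le_right _ _).trans (min_le_left _ _)) hzb) hz
    have main : ∀ z ∈ J ∪ {z ∈ D | L z = s}, z ∈ ball z0 ρ → u z = w z := by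
      rintro z (hz | ⟨hz, hs⟩) hzb
      · rw [uJ z hz]; exact uwJ z hz hzb
      · have hs0 := hr3' z (ball_subset_ball ((min_le_right _ _).trans (min_le_right _ _)) hzb) hs
        obtain ⟨r, rfl⟩ := (hL.mem z).mp hs
        obtain ⟨r0, rfl⟩ := (hL.mem z0).mp hs0
        have hc := hab r hz
        have hrr := hr r hz
        rw [uD r hz]
        have hn : r0 ∉ Ioo (a r) (b r) := fun h =>
          Set.disjoint_left.mp hDJ (hc.inner r0 h) hz0
        rw [mem_ball, hL.iso.dist_eq, Real.dist_eq] at hzb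
        have endp : ∀ e, e ∈ Icc (a r) (b r) → P e ∈ J → (∀ t ∈ uIcc e r, |t - r0| < ρ) →
            v (a r) (b r) (P r) = w (P r) := by
          intro e he heJ het
          have hsub : uIcc e r ⊆ Icc (a r) (b r) := uIcc_subset_Icc he (Ioo_subset_Icc_self hrr)
          have hS : IsPreconnected (P '' uIcc e r) :=
            isPreconnected_uIcc.image _ hL.iso.continuous.continuousOn
          have hin : ∀ z ∈ P '' uIcc e r, z ∈ ball (P r0) ρ := by
            rintro _ ⟨t, ht, rfl⟩
            rw [mem_ball, hL.iso.dist_eq, Real.dist_eq]; exact het t ht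
          have hsl : ∀ z ∈ P '' uIcc e r, f z / f (P r0) ∈ Complex.slitPlane := fun z hz =>
            hr1' z (ball_subset_ball (min_le_left _ _) (hin z hz))
          have hsub2 : P '' uIcc e r ⊆ J ∪ P '' Icc (a r) (b r) :=
            (image_mono hsub).trans subset_union_right
          have hfc : ContinuousOn f (P '' uIcc e r) := by
            refine hf.mono ?_
            rintro _ ⟨t, ht, rfl⟩
            rcases eq_or_ne t e with rfl | hte
            · exact Or.inl heJ
            · right
              refine ⟨?_, (hL.mem _).mpr ⟨t, rfl⟩⟩
              apply hc.inner
              rcases le_total e r with h | h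
              · rw [uIcc_of_le h] at ht
                exact ⟨lt_of_le_of_lt he.1 (lt_of_le_of_ne ht.1 hte.symm), lt_of_le_of_lt ht.2 hrr.2⟩
              · rw [uIcc_of_ge h] at ht
                exact ⟨lt_of_lt_of_le hrr.1 ht.1, lt_of_lt_of_le (lt_of_le_of_ne ht.2 hte) he.2⟩
          have hwc' : ContinuousOn w (P '' uIcc e r) :=
            (ContinuousOn.clog (hfc.div_const _) hsl).add continuousOn_const
          obtain ⟨n, hn⟩ := log_unique hS ((hv _ _ hc).mono hsub2) hwc'
            (fun z hz => by rw [← hvf _ _ hc z (hsub2 hz), ← hwf z (hsl z hz)])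
          have h1 := hn (P e) ⟨e, left_mem_uIcc, rfl⟩
          rw [hvJ _ _ hc _ heJ, uwJ _ heJ (hin _ ⟨e, left_mem_uIcc, rfl⟩)] at h1
          have h2 := hn (P r) ⟨r, right_mem_uIcc, rfl⟩
          have h3 : (n : ℂ) * (2 * Real.pi * Complex.I) = 0 := by
            linear_combination -h1
          rw [h2, h3, add_zero]
        have eJ : ∀ e ∈ Icc (a r) (b r), P e ∉ D → P e ∈ J := by
          intro e he heD
          have : P e ∈ closure D := by
            have h1 : e ∈ closure (Ioo (a r) (b r)) := by
              rw [closure_Ioo hc.lt.ne]; exact he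
            have h2 := image_closure_subset_closure_image hL.iso.continuous ⟨e, h1, rfl⟩
            exact closure_mono (by rintro _ ⟨t, ht, rfl⟩; exact hc.inner t ht) h2
          exact (hfr this).resolve_right heD
        rw [abs_lt] at hzb
        by_cases hlt : r0 ≤ a r
        · refine endp (a r) ⟨le_rfl, hc.lt.le⟩ (eJ _ ⟨le_rfl, hc.lt.le⟩ hc.left) ?_
          intro t ht
          rw [uIcc_of_le hrr.1.le] at ht
          rw [abs_lt]; constructor <;> linarith [ht.1, ht.2]
        · have hge : b r ≤ r0 := by
            by_contra! h; push Not at hlt; exact hn ⟨hlt, h⟩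
          refine endp (b r) ⟨hc.lt.le, le_rfl⟩ (eJ _ ⟨hc.lt.le, le_rfl⟩ hc.right) ?_
          intro t ht
          rw [uIcc_of_ge hrr.2.le] at ht
          rw [abs_lt]; constructor <;> linarith [ht.1, ht.2]
    have : ContinuousWithinAt w (J ∪ {z ∈ D | L z = s}) z0 := hwc.continuousWithinAt
    refine this.congr_of_eventuallyEq ?_ (main z0 (Or.inl hz0) (mem_ball_self hρ0))
    filter_upwards [self_mem_nhdsWithin, mem_nhdsWithin_of_mem_nhds (ball_mem_nhds z0 hρ0)] with z h1 h2
    exact main z h1 h2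
  · obtain ⟨r0, rfl⟩ := (hL.mem z0).mp hs
    have hc := hab r0 hz0
    have hrr := hr r0 hz0
    have h1 : ContinuousWithinAt (v (a r0) (b r0)) (P '' Ioo (a r0) (b r0)) (P r0) :=
      (hv _ _ hc).mono ((image_mono Ioo_subset_Icc_self).trans subset_union_right) _ ⟨r0, hrr, rfl⟩
    have h2 : ContinuousWithinAt u (P '' Ioo (a r0) (b r0)) (P r0) := by
      have : ∀ r ∈ Ioo (a r0) (b r0), u (P r) = v (a r0) (b r0) (P r) := by
        intro r hr'
        have hrD := hc.inner r hr'
        rw [uD r hrD]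
        obtain ⟨e1, e2⟩ := (hab r hrD).eq hc (hr r hrD) hr'
        rw [e1, e2]
      refine h1.congr ?_ (this _ hrr)
      rintro _ ⟨r, hr', rfl⟩; exact this r hr'
    refine h2.mono_of_mem_nhdsWithin ?_
    obtain ⟨ε, hε, hε'⟩ := Metric.mem_nhds_iff.mp (Ioo_mem_nhds hrr.1 hrr.2)
    filter_upwards [self_mem_nhdsWithin, mem_nhdsWithin_of_mem_nhds (ball_mem_nhds _ hε),
      mem_nhdsWithin_of_mem_nhds (hD.mem_nhds hz0)] with z g1 g2 g3
    have hs' : L z = s := by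
      rcases g1 with g | g
      · exact absurd g (Set.disjoint_left.mp hDJ g3)
      · exact g.2
    obtain ⟨r, rfl⟩ := (hL.mem z).mp hs'
    exact ⟨r, hε' (by rwa [mem_ball, hL.iso.dist_eq] at g2), rfl⟩

end Schoen

set_option linter.unusedVariables false
namespace Schoen
open Set Filter Topology Metric

def Compat (D V : Set ℂ) (P : ℝ → ℂ) : Prop :=
  ∀ a b, Chord D P a b → P '' Ioo a b ⊆ V ∨ Disjoint (P '' Ioo a b) V

lemma chord_end {J : Set ℂ} {P : ℝ → ℂ} (hP : Continuous P) (hJ : IsCompact J) {a b : ℝ}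
    {V : Set ℂ} (hab : a < b) (hV : P '' Ioo a b ⊆ V) {e : ℝ} (he : e ∈ Icc a b) :
    P e ∈ closure V := by
  have h1 : e ∈ closure (Ioo a b) := by rw [closure_Ioo hab.ne]; exact he
  exact closure_mono hV (image_closure_subset_closure_image hP ⟨e, h1, rfl⟩)

lemma chord_endJ {J : Set ℂ} {P : ℝ → ℂ} (hP : Continuous P) (hJ : IsCompact J) {a b : ℝ}
    (h : Chord (In J) P a b) : P a ∈ J ∧ P b ∈ J := by
  have hV : P '' Ioo a b ⊆ In J := by rintro _ ⟨t, ht, rfl⟩; exact h.inner t ht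
  exact ⟨(closure_in hJ (chord_end hP hJ h.lt hV ⟨le_rfl, h.lt.le⟩)).resolve_right h.left,
    (closure_in hJ (chord_end hP hJ h.lt hV ⟨h.lt.le, le_rfl⟩)).resolve_right h.right⟩

lemma chord_arc {P : ℝ → ℂ} (hP : Isometry P) {a b : ℝ} (h : a < b) :
    IsArc (P '' Icc a b) (P a) (P b) :=
  isArc_of_param h hP.continuous.continuousOn hP.injective.injOn

lemma chord_diff {P : ℝ → ℂ} (hP : Isometry P) {a b : ℝ} (h : a < b) :
    P '' Icc a b \ {P a, P b} = P '' Ioo a b := by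
  ext z; constructor
  · rintro ⟨⟨t, ht, rfl⟩, h2⟩
    simp only [mem_insert_iff, mem_singleton_iff, not_or] at h2
    exact ⟨t, ⟨lt_of_le_of_ne ht.1 (fun e => h2.1 (by rw [e])),
      lt_of_le_of_ne ht.2 (fun e => h2.2 (by rw [e]))⟩, rfl⟩
  · rintro ⟨t, ht, rfl⟩
    refine ⟨⟨t, Ioo_subset_Icc_self ht, rfl⟩, ?_⟩
    simp only [mem_insert_iff, mem_singleton_iff, not_or, hP.injective.eq_iff]
    exact ⟨ht.1.ne', ht.2.ne⟩

/-- a compatible open connected subset of `In J` meeting no long chord stays near one side -/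
lemma line_sep {J V : Set ℂ} (hJ : IsLoop J) {P : ℝ → ℂ} {L : ℂ → ℝ} {s : ℝ} (hL : Line P L s)
    {ε δ : ℝ} (hε : 0 < ε) (hδ : ∀ x ∈ J, ∀ y ∈ J, x ≠ y →
      dist x y < δ → ∃ A B, Dec J x y A B ∧ A ⊆ closedBall x ε) (hδε : δ ≤ ε)
    (hVc : IsPreconnected V) (hVD : V ⊆ In J) (hcomp : Compat (In J) V P)
    (hlong : ∀ a b, Chord (In J) P a b → P '' Ioo a b ⊆ V → b - a < δ)
    {p q : ℂ} (hp : p ∈ V) (hq : q ∈ V) (hps : L p < s - ε) (hqs : s + ε < L q) : False := by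
  have hJc := hJ.isCompact
  have hn : (In J).Nonempty := ⟨p, hVD hp⟩
  have hD := in_open hJc
  have hDJ := disjoint_in J
  have pJ : p ∉ J := Set.disjoint_left.mp hDJ (hVD hp)
  have qJ : q ∉ J := Set.disjoint_left.mp hDJ (hVD hq)
  set f : ℂ → ℂ := fun z => (z - p) / (z - q) with hf
  have hfc : ∀ z, z ≠ q → ContinuousAt f z := fun z hz =>
    ContinuousAt.div (by fun_prop) (by fun_prop) (sub_ne_zero.mpr hz)
  have hsne : ∀ z, L z = s → z ≠ p ∧ z ≠ q := by
    rintro z hz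
    constructor
    · rintro rfl; linarith
    · rintro rfl; linarith
  have logs : ∀ a b, Chord (In J) P a b → HasLog (J ∪ P '' Icc a b) f := by
    intro a b hab
    obtain ⟨ha, hb⟩ := chord_endJ hL.iso.continuous hJc hab
    have harc := chord_arc hL.iso hab.lt
    have hdiff := chord_diff hL.iso hab.lt
    have hcpt : IsCompact (J ∪ P '' Icc a b) := hJc.union harc.isCompact
    have hsub : P '' Ioo a b ⊆ In J := by rintro _ ⟨t, ht, rfl⟩; exact hab.inner t ht
    have hun : J ∪ P '' Icc a b ⊆ J ∪ P '' Ioo a b := by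
      rintro z (h | h)
      · exact Or.inl h
      · by_cases hz : z ∈ ({P a, P b} : Set ℂ)
        · rcases hz with rfl | rfl
          · exact Or.inl ha
          · exact Or.inl hb
        · right; rw [← hdiff]; exact ⟨h, hz⟩
    rcases hcomp a b hab with h | h
    · -- short chord
      have hlt := hlong a b hab h
      have hne : P a ≠ P b := hL.iso.injective.ne hab.lt.ne
      have hdist : dist (P a) (P b) = b - a := by
        rw [hL.iso.dist_eq, Real.dist_eq, abs_sub_comm, abs_of_pos (sub_pos.mpr hab.lt)]
      obtain ⟨A, B, hdec, hA⟩ := hδ _ ha _ hb hne (by rw [hdist]; exact hlt)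
      have th : Theta J (P a) (P b) A B (P '' Icc a b) := ⟨hdec, hn, harc, by rw [hdiff]; exact hsub⟩
      have hball : A ∪ P '' Icc a b ⊆ closedBall (P a) ε := by
        apply union_subset hA
        rintro _ ⟨t, ht, rfl⟩
        rw [mem_closedBall, hL.iso.dist_eq, Real.dist_eq, abs_of_nonneg (by linarith [ht.1])]
        linarith [ht.2]
      have hin := in_subset_closedBall hball
      have hLa : L (P a) = s := (hL.mem _).mpr ⟨a, rfl⟩
      have np : p ∉ closedBall (P a) ε := by
        rw [mem_closedBall, not_le]
        refine lt_of_lt_of_le ?_ (hL.lip _ _)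
        rw [hLa, lt_abs]; right; linarith
      have nq : q ∉ closedBall (P a) ε := by
        rw [mem_closedBall, not_le]
        refine lt_of_lt_of_le ?_ (hL.lip _ _)
        rw [hLa, lt_abs]; left; linarith
      have pB := (th.cover (hVD hp) (fun h => np (hball (Or.inr h)))).resolve_left (fun h => np (hin h))
      have qB := (th.cover (hVD hq) (fun h => nq (hball (Or.inr h)))).resolve_left (fun h => nq (hin h))
      refine hasLog_ratio (in_preconnected th.decB.isLoop) hcpt ?_ pB qB
      rw [disjoint_union_right]
      exact ⟨hDJ.mono_left th.inB_sub, (disjoint_in _).mono_right subset_union_right⟩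
    · refine hasLog_ratio hVc hcpt ?_ hp hq
      refine Disjoint.mono_right hun ?_
      rw [disjoint_union_right]
      exact ⟨hDJ.mono_left hVD, h.symm⟩
  have hX : HasLog (J ∪ {z ∈ In J | L z = s}) f := by
    refine glue_chords hL hJc.isClosed hJ.isPreconnected ?_ hD (in_bounded hJc) hDJ (closure_in hJc)
      ?_ ?_ ?_ logs
    · obtain ⟨x, y, A, B, h⟩ := hJ; exact ⟨x, h.subA h.arcA.left_mem⟩
    · rintro z (hz | hz)
      · exact (hfc z (fun h => qJ (h ▸ hz))).continuousWithinAt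
      · exact (hfc z (hsne z hz.2).2).continuousWithinAt
    · intro z hz; exact hfc z (fun h => qJ (h ▸ hz))
    · exact hasLog_ratio hVc hJc (hDJ.mono_left hVD) hp hq
  have hXeq : J ∪ {z ∈ In J | L z = s} = J ∪ ((J ∪ In J) ∩ L ⁻¹' {s}) := by
    ext z; simp only [mem_union, mem_inter_iff, mem_preimage, mem_singleton_iff]
    constructor
    · rintro (h | ⟨h1, h2⟩)
      · exact Or.inl h
      · exact Or.inr ⟨Or.inr h1, h2⟩
    · rintro (h | ⟨h1 | h1, h2⟩)
      · exact Or.inl h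
      · exact Or.inl h1
      · exact Or.inr ⟨h1, h2⟩
  have hXc : IsCompact (J ∪ {z ∈ In J | L z = s}) := by
    rw [hXeq]
    exact hJc.union ((isCompact_union_in hJc).inter_right (isClosed_singleton.preimage hL.cont))
  have hpX : p ∉ J ∪ {z ∈ In J | L z = s} := by
    rintro (h | h)
    · exact pJ h
    · exact (hsne p h.2).1 rfl
  have hqX : q ∉ J ∪ {z ∈ In J | L z = s} := by
    rintro (h | h)
    · exact qJ h
    · exact (hsne q h.2).2 rfl
  have hj := joined_of_log hXc hpX hqX hX
  set S := connectedComponentIn (J ∪ {z ∈ In J | L z = s})ᶜ p with hS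
  have hSc : IsPreconnected S := isPreconnected_connectedComponentIn
  have pS : p ∈ S := mem_connectedComponentIn hpX
  have qS : q ∈ S := by rw [hj]; exact mem_connectedComponentIn hqX
  have hSd : Disjoint S (J ∪ {z ∈ In J | L z = s}) := comp_disjoint _ p
  have hSI : S ⊆ In J := in_of_conn hSc hJc (hSd.mono_right subset_union_left) pS (hVD hp)
  obtain ⟨z, hz, hzs⟩ := hSc.intermediate_value pS qS hL.cont.continuousOn
    (show s ∈ Icc (L p) (L q) from ⟨by linarith, by linarith⟩)
  exact Set.disjoint_left.mp hSd hz (Or.inr ⟨hSI hz, hzs⟩)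

abbrev E2 := Bool → ℂ

def ev (b : Bool) : E2 → ℂ := fun w => w b

lemma ev_cont (b : Bool) : Continuous (ev b) := continuous_apply b

def KK (b : Bool) (C : Set E2) : Set ℂ := ev b '' C ∪ In (ev b '' C)

structure PCell (C : Set E2) : Prop where
  loop : IsLoop C
  inj : ∀ b, InjOn (ev b) C
  ne : ∀ b, (In (ev b '' C)).Nonempty

lemma PCell.lp {C : Set E2} (h : PCell C) (b : Bool) : IsLoop (ev b '' C) :=
  h.loop.image (ev_cont b).continuousOn (h.inj b)

lemma PCell.KK_eq {C : Set E2} (h : PCell C) (b : Bool) : KK b C = closure (In (ev b '' C)) :=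
  (closure_in_eq (h.lp b) (h.ne b)).symm

lemma PCell.KK_compact {C : Set E2} (h : PCell C) (b : Bool) : IsCompact (KK b C) :=
  isCompact_union_in (h.lp b).isCompact

lemma PCell.nonempty {C : Set E2} (h : PCell C) : C.Nonempty := by
  obtain ⟨x, y, A, B, h⟩ := h.loop; exact ⟨x, h.subA h.arcA.left_mem⟩

lemma pair_arc {c : Bool → Set ℂ} {x y : E2} (h : ∀ b, IsArc (c b) (x b) (y b)) :
    ∃ c' : Set E2, IsArc c' x y ∧ ∀ b, InjOn (ev b) c' ∧ ev b '' c' = c b := by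
  choose γ hc hi h0 h1 him using h
  refine ⟨(fun t b => γ b t) '' Icc (0:ℝ) 1, ⟨fun t b => γ b t, ?_, ?_, funext h0, funext h1, rfl⟩, ?_⟩
  · exact continuousOn_pi.mpr hc
  · intro s hs t ht hst
    exact hi true hs ht (congrFun hst true)
  · intro b
    constructor
    · rintro _ ⟨s, hs, rfl⟩ _ ⟨t, ht, rfl⟩ hst
      have : s = t := hi b hs ht hst
      rw [this]
    · rw [image_image]; exact him b

structure Cut (C : Set E2) (x y : E2) (A B c : Set E2) : Prop where
  dec : Dec C x y A B
  arc : IsArc c x y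
  inj : ∀ b, InjOn (ev b) c
  sub : ∀ b, ev b '' (c \ {x, y}) ⊆ In (ev b '' C)

section
variable {C A B c : Set E2} {x y : E2}

lemma Cut.swap (h : Cut C x y A B c) : Cut C x y B A c := ⟨h.dec.swap, h.arc, h.inj, h.sub⟩

lemma Cut.theta (hC : PCell C) (h : Cut C x y A B c) (b : Bool) :
    Theta (ev b '' C) (x b) (y b) (ev b '' A) (ev b '' B) (ev b '' c) := by
  refine ⟨h.dec.image (ev_cont b).continuousOn (hC.inj b), hC.ne b,
    h.arc.image (ev_cont b).continuousOn (h.inj b), ?_⟩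
  rintro _ ⟨⟨w, hw, rfl⟩, h2⟩
  refine h.sub b ⟨w, ⟨hw, fun h3 => h2 ?_⟩, rfl⟩
  rcases h3 with rfl | rfl
  · exact Or.inl rfl
  · exact Or.inr rfl

lemma Cut.cellA (hC : PCell C) (h : Cut C x y A B c) : PCell (A ∪ c) := by
  have hAC := h.dec.subA
  have key : ∀ b, ∀ w ∈ c, ∀ a ∈ C, ev b a = ev b w → a = w ∧ w ∈ ({x, y} : Set E2) := by
    intro b w hw a ha he
    by_cases hwx : w ∈ ({x, y} : Set E2)
    · refine ⟨hC.inj b ha ?_ he, hwx⟩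
      rcases hwx with rfl | rfl
      · exact hAC h.dec.arcA.left_mem
      · exact hAC h.dec.arcA.right_mem
    · exfalso
      have := h.sub b ⟨w, ⟨hw, hwx⟩, rfl⟩
      exact Set.disjoint_left.mp (disjoint_in _) this ⟨a, ha, he⟩
  refine ⟨⟨x, y, A, c, h.dec.arcA, h.arc, ?_, rfl⟩, ?_, ?_⟩
  · ext w; constructor
    · rintro ⟨h1, h2⟩; exact (key true w h2 w (hAC h1) rfl).2
    · rintro (rfl | rfl)
      · exact ⟨h.dec.arcA.left_mem, h.arc.left_mem⟩
      · exact ⟨h.dec.arcA.right_mem, h.arc.right_mem⟩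
  · rintro b u (hu | hu) v (hv | hv) huv
    · exact hC.inj b (hAC hu) (hAC hv) huv
    · exact (key b v hv u (hAC hu) huv).1
    · exact (key b u hu v (hAC hv) huv.symm).1.symm
    · exact h.inj b hu hv huv
  · intro b; rw [image_union]; exact (h.theta hC b).neA

lemma Cut.cellB (hC : PCell C) (h : Cut C x y A B c) : PCell (B ∪ c) := h.swap.cellA hC

end

structure Part (C : Set E2) (S : Set (Set E2)) : Prop where
  fin : S.Finite
  cell : ∀ i ∈ S, PCell i
  inn : ∀ i ∈ S, ∀ b, In (ev b '' i) ⊆ In (ev b '' C)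
  cover : ∀ b, KK b C ⊆ ⋃ i ∈ S, KK b i
  bd : ∀ i ∈ S, ∀ w ∈ C, ∀ b, w b ∈ KK b i → w ∈ i
  star : ∀ i ∈ S, ∀ j ∈ S, i ≠ j → ∀ b, KK b i ∩ KK b j ⊆ ev b '' (i ∩ j)

lemma Part.nil {C : Set E2} (hC : PCell C) : Part C {C} where
  fin := finite_singleton _
  cell := by rintro i rfl; exact hC
  inn := by rintro i rfl b; exact Subset.rfl
  cover b := by simp
  bd := by rintro i rfl w hw b _; exact hw
  star := by rintro i rfl j rfl h; exact absurd rfl h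

lemma Part.KK_sub {C : Set E2} {S : Set (Set E2)} (hC : PCell C) (h : Part C S) {i : Set E2}
    (hi : i ∈ S) (b : Bool) : KK b i ⊆ KK b C := by
  rw [(h.cell i hi).KK_eq, hC.KK_eq]; exact closure_mono (h.inn i hi b)

lemma Part.bind {C : Set E2} (hC : PCell C) {S : Set (Set E2)} (h : Part C S)
    {f : Set E2 → Set (Set E2)} (hf : ∀ i ∈ S, Part i (f i)) : Part C (⋃ i ∈ S, f i) where
  fin := h.fin.biUnion (fun i hi => (hf i hi).fin)
  cell := by
    intro j hj; simp only [mem_iUnion] at hj; obtain ⟨i, hi, hj⟩ := hj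
    exact (hf i hi).cell j hj
  inn := by
    intro j hj b; simp only [mem_iUnion] at hj; obtain ⟨i, hi, hj⟩ := hj
    exact ((hf i hi).inn j hj b).trans (h.inn i hi b)
  cover b := by
    intro z hz
    have := h.cover b hz
    simp only [mem_iUnion] at this; obtain ⟨i, hi, hz⟩ := this
    have := (hf i hi).cover b hz
    simp only [mem_iUnion] at this; obtain ⟨j, hj, hz⟩ := this
    simp only [mem_iUnion]
    exact ⟨j, ⟨i, hi, hj⟩, hz⟩
  bd := by
    intro j hj w hw b hwb; simp only [mem_iUnion] at hj; obtain ⟨i, hi, hj⟩ := hj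
    exact (hf i hi).bd j hj w (h.bd i hi w hw b ((hf i hi).KK_sub (h.cell i hi) hj b hwb)) b hwb
  star := by
    intro j hj j' hj' hne b z hz
    simp only [mem_iUnion] at hj hj'
    obtain ⟨i, hi, hj⟩ := hj
    obtain ⟨i', hi', hj'⟩ := hj'
    by_cases hii : i = i'
    · subst hii; exact (hf i hi).star j hj j' hj' hne b hz
    · obtain ⟨w, ⟨hw1, hw2⟩, rfl⟩ := h.star i hi i' hi' hii b
        ⟨(hf i hi).KK_sub (h.cell i hi) hj b hz.1, (hf i' hi').KK_sub (h.cell i' hi') hj' b hz.2⟩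
      exact ⟨w, ⟨(hf i hi).bd j hj w hw1 b hz.1, (hf i' hi').bd j' hj' w hw2 b hz.2⟩, rfl⟩

section
variable {C A B c : Set E2} {x y : E2}

lemma Cut.bdA (hC : PCell C) (h : Cut C x y A B c) {w : E2} (hw : w ∈ C) {b : Bool}
    (hb : w b ∈ KK b (A ∪ c)) : w ∈ A ∪ c := by
  have hwJ : w b ∈ ev b '' C := ⟨w, hw, rfl⟩
  rcases hb with ⟨v, hv, he⟩ | hb
  · rcases hv with hv | hv
    · left
      have := hC.inj b (h.dec.subA hv) hw he
      rwa [← this]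
    · by_cases hvx : v ∈ ({x, y} : Set E2)
      · have hvA : v ∈ A := by
          rcases hvx with rfl | rfl
          · exact h.dec.arcA.left_mem
          · exact h.dec.arcA.right_mem
        have := hC.inj b (h.dec.subA hvA) hw he
        left; rwa [← this]
      · have := h.sub b ⟨v, ⟨hv, hvx⟩, rfl⟩
        rw [he] at this
        exact absurd hwJ (Set.disjoint_left.mp (disjoint_in _) this)
  · rw [image_union] at hb
    exact absurd hwJ (Set.disjoint_left.mp (disjoint_in _) ((h.theta hC b).inA_sub hb))

lemma Cut.inter (hC : PCell C) (h : Cut C x y A B c) (b : Bool) :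
    KK b (A ∪ c) ∩ KK b (B ∪ c) ⊆ ev b '' c := by
  have th := h.theta hC b
  rintro z ⟨h1, h2⟩
  unfold KK at h1 h2
  rw [image_union] at h1 h2
  have dj := disjoint_in (ev b '' C)
  rcases h1 with h1 | h1
  · rcases h2 with h2 | h2
    · rcases h1 with h1 | h1
      · rcases h2 with h2 | h2
        · have : z ∈ ({x b, y b} : Set ℂ) := by rw [← th.dec.inter]; exact ⟨h1, h2⟩
          rcases this with rfl | rfl
          · exact th.arc.left_mem
          · exact th.arc.right_mem
        · exact h2
      · exact h1
    · rcases h1 with h1 | h1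
      · exact absurd (th.dec.subA h1) (Set.disjoint_left.mp dj (th.inB_sub h2))
      · exact h1
  · rcases h2 with h2 | h2
    · rcases h2 with h2 | h2
      · exact absurd (th.dec.subB h2) (Set.disjoint_left.mp dj (th.inA_sub h1))
      · exact h2
    · exact absurd h2 (Set.disjoint_left.mp th.disj h1)

lemma Cut.part (hC : PCell C) (h : Cut C x y A B c) : Part C {A ∪ c, B ∪ c} where
  fin := by simp
  cell := by
    rintro i (rfl | rfl)
    · exact h.cellA hC
    · exact h.cellB hC
  inn := by
    rintro i (rfl | rfl) b
    · rw [image_union]; exact (h.theta hC b).inA_sub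
    · rw [image_union]; exact (h.theta hC b).inB_sub
  cover b := by
    intro z hz
    simp only [mem_insert_iff, mem_singleton_iff, iUnion_iUnion_eq_or_left, iUnion_iUnion_eq_left]
    unfold KK
    rw [image_union, image_union]
    rcases hz with ⟨w, hw, rfl⟩ | hz
    · rw [h.dec.union] at hw
      rcases hw with hw | hw
      · exact Or.inl (Or.inl (Or.inl ⟨w, hw, rfl⟩))
      · exact Or.inr (Or.inl (Or.inl ⟨w, hw, rfl⟩))
    · by_cases hzc : z ∈ ev b '' c
      · exact Or.inl (Or.inl (Or.inr hzc))
      · rcases (h.theta hC b).cover hz hzc with h | h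
        · exact Or.inl (Or.inr h)
        · exact Or.inr (Or.inr h)
  bd := by
    rintro i (rfl | rfl) w hw b hb
    · exact h.bdA hC hw hb
    · exact h.swap.bdA hC hw hb
  star := by
    have hc : c ⊆ (A ∪ c) ∩ (B ∪ c) := subset_inter subset_union_right subset_union_right
    rintro i (rfl | rfl) j (rfl | rfl) hne b
    · exact absurd rfl hne
    · exact (h.inter hC b).trans (image_mono hc)
    · rw [inter_comm, inter_comm (B ∪ c)]; exact (h.inter hC b).trans (image_mono hc)
    · exact absurd rfl hne

end

end Schoen

set_option linter.unusedVariables false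
namespace Schoen
open Set Filter Topology Metric

lemma cut_side {J A B c D : Set ℂ} {x y : ℂ} (th : Theta J x y A B c) (hJc : IsCompact J) {P : ℝ → ℂ}
    (hP : Isometry P) {a b : ℝ} (hab : Chord D P a b) (hc : c = P '' Icc a b)
    (hJD : In J ⊆ D) (hcomp : Compat D (In J) P) :
    Compat D (In (A ∪ c)) P := by
  intro a' b' h'
  rcases hcomp a' b' h' with h | h
  · by_cases hm : ∃ r, r ∈ Ioo a b ∧ r ∈ Ioo a' b'
    · obtain ⟨r, h1, h2⟩ := hm
      obtain ⟨rfl, rfl⟩ := hab.eq h' h1 h2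
      right
      refine ((disjoint_in (A ∪ c)).mono_right ?_).symm
      rw [hc]; exact (image_mono Ioo_subset_Icc_self).trans subset_union_right
    · have hd : Disjoint (P '' Ioo a' b') (A ∪ c) := by
        rw [disjoint_union_right]
        constructor
        · exact (disjoint_in J).mono h th.dec.subA
        · rw [Set.disjoint_left]
          rintro _ ⟨r, hr, rfl⟩ hrc
          rw [hc] at hrc
          obtain ⟨r', hr', he⟩ := hrc
          have := hP.injective he
          subst this
          apply hm
          refine ⟨r', ⟨lt_of_le_of_ne hr'.1 ?_, lt_of_le_of_ne hr'.2 ?_⟩, hr⟩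
          · rintro rfl; exact hab.left (h'.inner _ hr)
          · rintro rfl; exact hab.right (h'.inner _ hr)
      by_cases hn : (P '' Ioo a' b' ∩ In (A ∪ c)).Nonempty
      · obtain ⟨z, hz, hz2⟩ := hn
        left
        exact in_of_conn (isPreconnected_Ioo.image _ hP.continuous.continuousOn)
          (th.decA.isLoop.isCompact) hd hz hz2
      · right; rwa [disjoint_iff_inter_eq_empty, ← not_nonempty_iff_eq_empty]
  · right; exact h.mono_right th.inA_sub

lemma cut_at {E : Set E2} (hE : PCell E) {b : Bool} {D : Set ℂ} {P : ℝ → ℂ} (hP : Isometry P)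
    (hED : In (ev b '' E) ⊆ D) (hcomp : Compat D (In (ev b '' E)) P) {s t : ℝ}
    (hst : Chord D P s t) (hV : P '' Ioo s t ⊆ In (ev b '' E)) :
    ∃ S, Part E S ∧ ∀ i ∈ S, Compat D (In (ev b '' i)) P ∧ Disjoint (P '' Ioo s t) (In (ev b '' i)) := by
  have hJc := (hE.lp b).isCompact
  have m1 : P s ∈ ev b '' E :=
    (closure_in hJc (chord_end hP.continuous hJc hst.lt hV ⟨le_rfl, hst.lt.le⟩)).resolve_right
      (fun h => hst.left (hED h))
  have m2 : P t ∈ ev b '' E :=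
    (closure_in hJc (chord_end hP.continuous hJc hst.lt hV ⟨hst.lt.le, le_rfl⟩)).resolve_right
      (fun h => hst.right (hED h))
  obtain ⟨x, hx, hxs⟩ := m1
  obtain ⟨y, hy, hyt⟩ := m2
  have hxy : x ≠ y := by
    rintro rfl
    exact hst.lt.ne (hP.injective (hxs.symm.trans hyt))
  have ex : ∀ b', ∃ c, IsArc c (x b') (y b') ∧ c \ {x b', y b'} ⊆ In (ev b' '' E) ∧
      (b' = b → c = P '' Icc s t) := by
    intro b'
    by_cases hb : b' = b
    · subst hb
      refine ⟨P '' Icc s t, ?_, ?_, fun _ => rfl⟩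
      · have := chord_arc hP hst.lt
        rwa [← hxs, ← hyt] at this
      · have := chord_diff hP hst.lt
        rw [← hxs, ← hyt] at this
        exact (this.le).trans hV
    · obtain ⟨c, h1, h2⟩ := crosscut (hE.lp b') (hE.ne b') (mem_image_of_mem (ev b') hx)
        (mem_image_of_mem (ev b') hy) (fun h => hxy (hE.inj b' hx hy h))
      exact ⟨c, h1, h2, fun h => absurd h hb⟩
  choose c hc1 hc2 hc3 using ex
  obtain ⟨c', hc', hc'2⟩ := pair_arc hc1
  obtain ⟨A, B, hdec⟩ := hE.loop.dec hx hy hxy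
  have cut : Cut E x y A B c' := by
    refine ⟨hdec, hc', fun b => (hc'2 b).1, ?_⟩
    rintro b' _ ⟨w, ⟨hw, hw2⟩, rfl⟩
    apply hc2 b'
    rw [← (hc'2 b').2]
    refine ⟨⟨w, hw, rfl⟩, fun h => hw2 ?_⟩
    rcases h with h | h
    · exact Or.inl ((hc'2 b').1 hw hc'.left_mem h)
    · exact Or.inr ((hc'2 b').1 hw hc'.right_mem h)
  have hcb : ev b '' c' = P '' Icc s t := by rw [(hc'2 b).2, hc3 b rfl]
  refine ⟨_, cut.part hE, ?_⟩
  have sub : P '' Ioo s t ⊆ ev b '' c' := by rw [hcb]; exact image_mono Ioo_subset_Icc_self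
  rintro i (rfl | rfl)
  · rw [image_union]
    exact ⟨cut_side (cut.theta hE b) hJc hP hst hcb hED hcomp,
      ((disjoint_in _).mono_right (sub.trans subset_union_right)).symm⟩
  · rw [image_union]
    exact ⟨cut_side (cut.swap.theta hE b) hJc hP hst hcb hED hcomp,
      ((disjoint_in _).mono_right (sub.trans subset_union_right)).symm⟩

lemma cut_pts {C : Set E2} (hC : PCell C) {b : Bool} {P : ℝ → ℂ} (hP : Isometry P) {Z : Set ℝ}
    (hZ : Z.Finite) : ∃ S, Part C S ∧ ∀ i ∈ S, Compat (In (ev b '' C)) (In (ev b '' i)) P ∧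
      ∀ r ∈ Z, P r ∉ In (ev b '' i) := by
  induction Z, hZ using Set.Finite.induction_on with
  | empty =>
    refine ⟨_, Part.nil hC, ?_⟩
    rintro i rfl
    refine ⟨?_, by simp⟩
    intro s t hst
    left; rintro _ ⟨r, hr, rfl⟩; exact hst.inner r hr
  | @insert r Z hr hZ ih =>
    obtain ⟨S, hS, hS2⟩ := ih
    have key : ∀ i ∈ S, ∃ T, Part i T ∧ ∀ j ∈ T, Compat (In (ev b '' C)) (In (ev b '' j)) P ∧
        P r ∉ In (ev b '' j) := by
      intro i hi
      by_cases hri : P r ∈ In (ev b '' i)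
      · obtain ⟨s, t, hst, hrst⟩ := exists_chord hP (in_open (hC.lp b).isCompact)
          (in_bounded (hC.lp b).isCompact) (hS.inn i hi b hri)
        have hV : P '' Ioo s t ⊆ In (ev b '' i) := by
          rcases (hS2 i hi).1 s t hst with h | h
          · exact h
          · exact absurd hri (Set.disjoint_left.mp h ⟨r, hrst, rfl⟩)
        obtain ⟨T, hT, hT2⟩ := cut_at (hS.cell i hi) hP (hS.inn i hi b) (hS2 i hi).1 hst hV
        exact ⟨T, hT, fun j hj => ⟨(hT2 j hj).1, Set.disjoint_left.mp (hT2 j hj).2 ⟨r, hrst, rfl⟩⟩⟩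
      · refine ⟨{i}, Part.nil (hS.cell i hi), ?_⟩
        rintro j rfl
        exact ⟨(hS2 _ hi).1, hri⟩
    choose! f hf hf2 using key
    refine ⟨_, hS.bind hC hf, ?_⟩
    intro j hj
    simp only [mem_iUnion] at hj
    obtain ⟨i, hi, hj⟩ := hj
    refine ⟨(hf2 i hi j hj).1, ?_⟩
    rintro r' (rfl | hr')
    · exact (hf2 i hi j hj).2
    · exact fun h => (hS2 i hi).2 r' hr' ((hf i hi).inn j hj b h)

/-- one line mesh -/
lemma mesh_line {C : Set E2} (hC : PCell C) (b : Bool) {P : ℝ → ℂ} {L : ℂ → ℝ} {s : ℝ}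
    (hL : Line P L s) {ε : ℝ} (hε : 0 < ε) : ∃ S, Part C S ∧ ∀ i ∈ S, ∀ p ∈ In (ev b '' i),
      ∀ q ∈ In (ev b '' i), ¬ (L p < s - ε ∧ s + ε < L q) := by
  have hJ := hC.lp b
  have hJc := hJ.isCompact
  obtain ⟨δ0, hδ0, hδ⟩ := hJ.small_arc hε
  set δ := min δ0 ε with hδd
  have hδp : 0 < δ := lt_min hδ0 hε
  -- net
  have hK : IsCompact (P ⁻¹' (KK b C)) := by
    have : IsCompact (P ⁻¹' (KK b C)) := hL.iso.isClosedEmbedding.isCompact_preimage (hC.KK_compact b)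
    exact this
  obtain ⟨Z, hZK, hZ, hcov⟩ := hK.finite_cover_balls (e := δ / 4) (by linarith)
  obtain ⟨S, hS, hS2⟩ := cut_pts hC (b := b) hL.iso hZ
  refine ⟨S, hS, ?_⟩
  rintro i hi p hp q hq ⟨h1, h2⟩
  refine line_sep hJ hL hε (δ := δ) (fun x hx y hy hxy hd => hδ x hx y hy hxy
    (hd.trans_le (min_le_left _ _))) (min_le_right _ _) (in_preconnected ((hS.cell i hi).lp b))
    (hS.inn i hi b) (hS2 i hi).1 ?_ hp hq h1 h2
  intro s' t' hst hV
  by_contra! hge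
  have hm : (s' + t') / 2 ∈ P ⁻¹' (KK b C) := by
    right; apply hst.inner; constructor <;> linarith
  have := hcov hm
  simp only [mem_iUnion] at this
  obtain ⟨r, hr, hb⟩ := this
  rw [mem_ball, Real.dist_eq, abs_lt] at hb
  apply (hS2 i hi).2 r hr
  exact hV ⟨r, ⟨by linarith, by linarith⟩, rfl⟩

/-- hereditary properties can be achieved simultaneously -/
lemma mesh_all {ι : Type*} {Q : ι → Set E2 → Prop}
    (hher : ∀ k i j, (∀ b, In (ev b '' j) ⊆ In (ev b '' i)) → Q k i → Q k j)
    (hex : ∀ k, ∀ C, PCell C → ∃ S, Part C S ∧ ∀ i ∈ S, Q k i) {T : Set ι} (hT : T.Finite)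
    {C : Set E2} (hC : PCell C) : ∃ S, Part C S ∧ ∀ i ∈ S, ∀ k ∈ T, Q k i := by
  induction T, hT using Set.Finite.induction_on with
  | empty => exact ⟨_, Part.nil hC, by simp⟩
  | @insert k T hk hT ih =>
    obtain ⟨S, hS, hS2⟩ := ih
    have key : ∀ i ∈ S, ∃ T, Part i T ∧ ∀ j ∈ T, Q k j := fun i hi => hex k i (hS.cell i hi)
    choose! f hf hf2 using key
    refine ⟨_, hS.bind hC hf, ?_⟩
    intro j hj
    simp only [mem_iUnion] at hj
    obtain ⟨i, hi, hj⟩ := hj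
    rintro k' (rfl | hk')
    · exact hf2 i hi j hj
    · exact hher k' i j ((hf i hi).inn j hj) (hS2 i hi k' hk')

lemma mesh {C : Set E2} (hC : PCell C) {ε : ℝ} (hε : 0 < ε) : ∃ S, Part C S ∧ ∀ i ∈ S, ∀ b,
    ∀ p ∈ KK b i, ∀ q ∈ KK b i, dist p q ≤ ε := by
  -- bound
  obtain ⟨M, hM⟩ : ∃ M : ℝ, ∀ b, ∀ z ∈ KK b C, ‖z‖ ≤ M := by
    obtain ⟨M1, h1⟩ := (hC.KK_compact true).isBounded.exists_norm_le
    obtain ⟨M2, h2⟩ := (hC.KK_compact false).isBounded.exists_norm_le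
    refine ⟨max M1 M2, fun b z hz => ?_⟩
    cases b
    · exact (h2 z hz).trans (le_max_right _ _)
    · exact (h1 z hz).trans (le_max_left _ _)
  set η := ε / 8 with hη
  have hη0 : 0 < η := by positivity
  obtain ⟨N, hN⟩ := exists_nat_gt (M / η + 2)
  let Lf : Bool → ℂ → ℝ := fun d => cond d Complex.re Complex.im
  let Q : Bool × Bool × ℤ → Set E2 → Prop := fun k i => ∀ p ∈ In (ev k.1 '' i),
      ∀ q ∈ In (ev k.1 '' i), ¬ (Lf k.2.1 p < k.2.2 * η - η ∧ k.2.2 * η + η < Lf k.2.1 q)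
  obtain ⟨S, hS, hS2⟩ := mesh_all (Q := Q) (fun k i j hij h p hp q hq => h p (hij _ hp) q (hij _ hq))
    (by
      rintro ⟨b, d, n⟩ C hC
      cases d
      · exact mesh_line hC b (Line.im (n * η)) hη0
      · exact mesh_line hC b (Line.re (n * η)) hη0)
    (T := univ ×ˢ univ ×ˢ Icc (-N : ℤ) N)
    (finite_univ.prod (finite_univ.prod (finite_Icc _ _))) hC
  refine ⟨S, hS, ?_⟩
  intro i hi b
  have one : ∀ d, ∀ p ∈ In (ev b '' i), ∀ q ∈ In (ev b '' i), Lf d q - Lf d p ≤ 4 * η := by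
    intro d p hp q hq
    by_contra! hgt
    have hLM : |Lf d p| ≤ M := by
      refine le_trans ?_ (hM b p (Or.inr (hS.inn i hi b hp)))
      cases d
      · exact Complex.abs_im_le_norm _
      · exact Complex.abs_re_le_norm _
    rw [abs_le] at hLM
    set n : ℤ := ⌊Lf d p / η⌋ + 2 with hn
    have f1 := Int.floor_le (Lf d p / η)
    have f2 := Int.lt_floor_add_one (Lf d p / η)
    have g1 : (n:ℝ) = ⌊Lf d p / η⌋ + 2 := by rw [hn]; push_cast; ring
    have e1 : Lf d p / η * η = Lf d p := div_mul_cancel₀ _ hη0.ne'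
    have e3 : M / η * η = M := div_mul_cancel₀ _ hη0.ne'
    have h1 : Lf d p < n * η - η := by
      rw [g1]; nlinarith
    have h2 : n * η + η < Lf d q := by
      rw [g1]; nlinarith
    refine hS2 i hi (b, d, n) ⟨trivial, trivial, ?_⟩ p hp q hq ⟨h1, h2⟩
    have b1 : Lf d p / η ≤ M / η := div_le_div_of_nonneg_right hLM.2 hη0.le
    have b2 : -(M / η) ≤ Lf d p / η := by
      rw [← neg_div]; exact div_le_div_of_nonneg_right hLM.1 hη0.le
    constructor
    · have : (-N : ℝ) ≤ n := by rw [g1]; linarith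
      exact_mod_cast this
    · have : (n : ℝ) ≤ N := by
        rw [g1]
        have : (⌊Lf d p / η⌋ : ℝ) ≤ M / η := f1.trans b1
        linarith
      exact_mod_cast this
  have two : ∀ p ∈ In (ev b '' i), ∀ q ∈ In (ev b '' i), dist p q ≤ ε := by
    intro p hp q hq
    rw [dist_eq_norm]
    refine (Complex.norm_le_abs_re_add_abs_im _).trans ?_
    have a1 := one true p hp q hq
    have a2 := one true q hq p hp
    have a3 := one false p hp q hq
    have a4 := one false q hq p hp
    simp only [Lf, cond_true, cond_false] at a1 a2 a3 a4
    have r1 : |(p - q).re| ≤ 4 * η := by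
      rw [Complex.sub_re, abs_le]; constructor <;> linarith
    have r2 : |(p - q).im| ≤ 4 * η := by
      rw [Complex.sub_im, abs_le]; constructor <;> linarith
    have : ε = 4 * η + 4 * η := by rw [hη]; ring
    linarith
  intro p hp q hq
  rw [(hS.cell i hi).KK_eq] at hp hq
  have hcl : IsClosed {x : ℂ × ℂ | dist x.1 x.2 ≤ ε} :=
    isClosed_le (by fun_prop) continuous_const
  have : (p, q) ∈ closure (In (ev b '' i) ×ˢ In (ev b '' i)) := by
    rw [closure_prod_eq]; exact ⟨hp, hq⟩
  exact (closure_minimal (fun x hx => two _ hx.1 _ hx.2) hcl) this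

end Schoen

set_option linter.unusedVariables false
namespace Schoen
open Set Filter Topology Metric

def RR (S : Set (Set E2)) : Set E2 := ⋃ i ∈ S, {w | ∀ b, w b ∈ KK b i}

lemma mem_RR {S : Set (Set E2)} {w : E2} : w ∈ RR S ↔ ∃ i ∈ S, ∀ b, w b ∈ KK b i := by
  simp only [RR, mem_iUnion, mem_ofPred_eq, exists_prop]

lemma RR_compact {C : Set E2} {S : Set (Set E2)} (h : Part C S) : IsCompact (RR S) := by
  refine h.fin.isCompact_biUnion (fun i hi => ?_)
  have : IsCompact (Set.pi univ (fun b => KK b i)) :=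
    isCompact_univ_pi (fun b => (h.cell i hi).KK_compact b)
  convert this using 1
  ext w; simp

lemma refine_part {C : Set E2} (hC : PCell C) {S : Set (Set E2)} (h : Part C S) {ε : ℝ} (hε : 0 < ε) :
    ∃ T, Part C T ∧ (∀ i ∈ T, ∀ b, ∀ p ∈ KK b i, ∀ q ∈ KK b i, dist p q ≤ ε) ∧ RR T ⊆ RR S := by
  have key : ∀ i ∈ S, ∃ T, Part i T ∧ ∀ i ∈ T, ∀ b, ∀ p ∈ KK b i, ∀ q ∈ KK b i, dist p q ≤ ε :=
    fun i hi => mesh (h.cell i hi) hε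
  choose! f hf hf2 using key
  refine ⟨_, h.bind hC hf, ?_, ?_⟩
  · intro j hj
    simp only [mem_iUnion] at hj
    obtain ⟨i, hi, hj⟩ := hj
    exact hf2 i hi j hj
  · intro w hw
    rw [mem_RR] at hw ⊢
    obtain ⟨j, hj, hw⟩ := hw
    simp only [mem_iUnion] at hj
    obtain ⟨i, hi, hj⟩ := hj
    exact ⟨i, hi, fun b => (hf i hi).KK_sub (h.cell i hi) hj b (hw b)⟩

theorem exists_rel {C : Set E2} (hC : PCell C) : ∃ R : Set E2, IsCompact R ∧ C ⊆ R ∧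
    (∀ b, InjOn (ev b) R) ∧ ∀ b, ev b '' R = KK b C := by
  have step : ∀ (n : ℕ) (S : {S // Part C S}), ∃ T : {S // Part C S},
      (∀ i ∈ T.1, ∀ b, ∀ p ∈ KK b i, ∀ q ∈ KK b i, dist p q ≤ 1 / ((n:ℝ) + 1)) ∧ RR T.1 ⊆ RR S.1 := by
    rintro n ⟨S, hS⟩
    obtain ⟨T, hT, h1, h2⟩ := refine_part hC hS (ε := 1 / ((n:ℝ) + 1)) (by positivity)
    exact ⟨⟨T, hT⟩, h1, h2⟩
  choose nx hnx1 hnx2 using step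
  let S : ℕ → {S // Part C S} := fun n => Nat.rec ⟨_, Part.nil hC⟩ nx n
  have hSs : ∀ n, S (n+1) = nx n (S n) := fun n => rfl
  let T : ℕ → Set (Set E2) := fun n => (S (n+1)).1
  have hT : ∀ n, Part C (T n) := fun n => (S (n+1)).2
  have hmesh : ∀ n, ∀ i ∈ T n, ∀ b, ∀ p ∈ KK b i, ∀ q ∈ KK b i, dist p q ≤ 1 / ((n:ℝ) + 1) :=
    fun n => hnx1 n (S n)
  have hdec : ∀ n, RR (T (n+1)) ⊆ RR (T n) := fun n => hnx2 (n+1) (S (n+1))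
  have hcomp : ∀ n, IsCompact (RR (T n)) := fun n => RR_compact (hT n)
  have hclosed : IsClosed (⋂ n, RR (T n)) := isClosed_iInter (fun n => (hcomp n).isClosed)
  refine ⟨⋂ n, RR (T n), (hcomp 0).of_isClosed_subset hclosed (iInter_subset _ 0), ?_, ?_, ?_⟩
  · intro w hw
    rw [mem_iInter]; intro n
    rw [mem_RR]
    have := (hT n).cover true (show w true ∈ KK true C from Or.inl ⟨w, hw, rfl⟩)
    simp only [mem_iUnion] at this
    obtain ⟨i, hi, h⟩ := this
    have hwi := (hT n).bd i hi w hw true h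
    exact ⟨i, hi, fun b => Or.inl ⟨w, hwi, rfl⟩⟩
  · intro b u hu v hv huv
    rw [mem_iInter] at hu hv
    funext b'
    apply eq_of_dist_eq_zero
    apply le_antisymm _ dist_nonneg
    have key : ∀ n : ℕ, dist (u b') (v b') ≤ 2 * (1 / ((n:ℝ) + 1)) := by
      intro n
      obtain ⟨i, hi, hui⟩ := mem_RR.mp (hu n)
      obtain ⟨j, hj, hvj⟩ := mem_RR.mp (hv n)
      have hpos : 0 ≤ 1 / ((n:ℝ) + 1) := by positivity
      by_cases hij : i = j
      · subst hij
        have := hmesh n i hi b' _ (hui b') _ (hvj b')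
        linarith
      · have huv' : u b = v b := huv
        obtain ⟨w, ⟨hw1, hw2⟩, _⟩ := (hT n).star i hi j hj hij b ⟨hui b, huv' ▸ hvj b⟩
        have h1 := hmesh n i hi b' _ (hui b') _ (Or.inl ⟨w, hw1, rfl⟩)
        have h2 := hmesh n j hj b' _ (Or.inl ⟨w, hw2, rfl⟩) _ (hvj b')
        linarith [dist_triangle (u b') (ev b' w) (v b')]
    have lim := (tendsto_one_div_add_atTop_nhds_zero_nat (𝕜 := ℝ)).const_mul 2
    rw [mul_zero] at lim
    exact ge_of_tendsto' lim key
  · intro b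
    apply Subset.antisymm
    · rintro _ ⟨w, hw, rfl⟩
      rw [mem_iInter] at hw
      obtain ⟨i, hi, h⟩ := mem_RR.mp (hw 0)
      exact (hT 0).KK_sub hC hi b (h b)
    · intro z hz
      have hne : ∀ n, (RR (T n) ∩ ev b ⁻¹' {z}).Nonempty := by
        intro n
        have := (hT n).cover b hz
        simp only [mem_iUnion] at this
        obtain ⟨i, hi, h⟩ := this
        obtain ⟨w, hw⟩ := ((hT n).cell i hi).nonempty
        refine ⟨Function.update w b z, mem_RR.mpr ⟨i, hi, fun b' => ?_⟩, ?_⟩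
        · by_cases hb : b' = b
          · subst hb; simpa using h
          · rw [Function.update_of_ne hb]; exact Or.inl ⟨w, hw, rfl⟩
        · simp [ev]
      have hcl : IsClosed (ev b ⁻¹' {z}) := isClosed_singleton.preimage (ev_cont b)
      obtain ⟨w, hw⟩ := IsCompact.nonempty_iInter_of_sequence_nonempty_isCompact_isClosed
        (fun n => RR (T n) ∩ ev b ⁻¹' {z}) (fun n => inter_subset_inter_left _ (hdec n)) hne
        ((hcomp 0).inter_right hcl) (fun n => (hcomp n).isClosed.inter hcl)
      rw [mem_iInter] at hw
      exact ⟨w, mem_iInter.mpr (fun n => (hw n).1), (hw 0).2⟩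

lemma rel_homeo {J : Set ℂ} (hJ : IsCompact J) {R : Set E2} (hR : IsCompact R)
    (hi : ∀ b, InjOn (ev b) R) (him : ∀ b, ev b '' R = J ∪ In J) (hd : ∀ z ∈ J, (fun _ => z) ∈ R) :
    ∃ k : ℂ ≃ₜ ℂ, (∀ z, z ∉ In J → k z = z) ∧ ∀ w ∈ R, k (w false) = w true := by
  classical
  let F : Bool → ℂ → ℂ := fun b z => if z ∈ J ∪ In J then (Function.invFunOn (ev b) R z) (!b) else z
  have Fw : ∀ b, ∀ w ∈ R, F b (w b) = w (!b) := by
    intro b w hw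
    have h1 : w b ∈ J ∪ In J := by rw [← him b]; exact ⟨w, hw, rfl⟩
    have h2 : Function.invFunOn (ev b) R (w b) = w := by
      have hmem : w b ∈ ev b '' R := ⟨w, hw, rfl⟩
      exact hi b (Function.invFunOn_mem hmem) hw (Function.invFunOn_eq hmem)
    simp only [F, if_pos h1, h2]
  have Fo : ∀ b z, z ∉ In J → F b z = z := by
    intro b z hz
    by_cases hzJ : z ∈ J
    · exact Fw b _ (hd z hzJ)
    · have : z ∉ J ∪ In J := by simp [hz, hzJ]
      simp only [F, if_neg this]
  have Finv : ∀ b z, F (!b) (F b z) = z := by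
    intro b z
    by_cases hz : z ∈ J ∪ In J
    · have hz' := hz
      rw [← him b] at hz'
      obtain ⟨w, hw, rfl⟩ := hz'
      have e1 : F b (ev b w) = w (!b) := Fw b w hw
      rw [e1, Fw (!b) w hw, Bool.not_not]; rfl
    · have h2 : z ∉ In J := fun h => hz (Or.inr h)
      rw [Fo b z h2, Fo (!b) z h2]
  have Fc : ∀ b, Continuous (F b) := by
    intro b
    have hK := isClosed_union_in hJ
    have c1 : ContinuousOn (F b) (J ∪ In J) := by
      have h1 : ContinuousOn (Function.invFunOn (ev b) R) (J ∪ In J) := by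
        rw [← him b]; exact continuousOn_invFunOn hR (ev_cont b).continuousOn (hi b)
      have h2 : ContinuousOn (fun z => (Function.invFunOn (ev b) R z) (!b)) (J ∪ In J) :=
        (continuous_apply (!b)).comp_continuousOn h1
      exact h2.congr (fun z hz => by simp only [F, if_pos hz])
    have c2 : ContinuousOn (F b) (In J)ᶜ := continuousOn_id.congr (fun z hz => Fo b z hz)
    have := c1.union_of_isClosed c2 hK (in_open hJ).isClosed_compl
    rw [← continuousOn_univ]
    convert this using 1
    ext z; simp only [mem_univ, mem_union, mem_compl_iff, true_iff]; tauto
  refine ⟨⟨⟨F false, F true, Finv false, Finv true⟩, Fc false, Fc true⟩, Fo false, Fw false⟩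

/-- Moving one crosscut to another one inside a Jordan domain. -/
theorem move_crosscut {J : Set ℂ} (hJ : IsLoop J) (hn : (In J).Nonempty) {γ : Bool → ℝ → ℂ} {x y : ℂ}
    (hx : x ∈ J) (hy : y ∈ J) (hc : ∀ b, ContinuousOn (γ b) (Icc 0 1))
    (hi : ∀ b, InjOn (γ b) (Icc 0 1)) (h0 : ∀ b, γ b 0 = x) (h1 : ∀ b, γ b 1 = y)
    (hin : ∀ b, ∀ t ∈ Ioo (0:ℝ) 1, γ b t ∈ In J) :
    ∃ k : ℂ ≃ₜ ℂ, (∀ z, z ∉ In J → k z = z) ∧ ∀ t ∈ Icc (0:ℝ) 1, k (γ false t) = γ true t := by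
  have hxy : x ≠ y := by
    rw [← h0 true, ← h1 true]
    intro h
    have := hi true ⟨le_rfl, zero_le_one⟩ ⟨zero_le_one, le_rfl⟩ h
    norm_num at this
  let Δ : ℂ → E2 := fun z _ => z
  have Δc : Continuous Δ := continuous_pi (fun _ => continuous_id)
  have Δi : Function.Injective Δ := fun a b h => congrFun h true
  have evΔ : ∀ (b : Bool) (A : Set ℂ), ev b '' (Δ '' A) = A := fun b A => by
    rw [image_image]; simp [ev, Δ]
  have hC : PCell (Δ '' J) := by
    refine ⟨hJ.image Δc.continuousOn Δi.injOn, ?_, ?_⟩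
    · rintro b _ ⟨u, hu, rfl⟩ _ ⟨v, hv, rfl⟩ h
      have : u = v := h
      rw [this]
    · intro b; rw [evΔ]; exact hn
  obtain ⟨A, B, hdec⟩ := hJ.dec hx hy hxy
  let Γ : ℝ → E2 := fun t b => γ b t
  let c : Set E2 := Γ '' Icc 0 1
  have Γi : InjOn Γ (Icc 0 1) := fun s hs t ht h => hi true hs ht (congrFun h true)
  have Γ0 : Γ 0 = Δ x := funext h0
  have Γ1 : Γ 1 = Δ y := funext h1
  have cut : Cut (Δ '' J) (Δ x) (Δ y) (Δ '' A) (Δ '' B) c := by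
    refine ⟨hdec.image Δc.continuousOn Δi.injOn, ⟨Γ, continuousOn_pi.mpr hc, Γi, Γ0, Γ1, rfl⟩, ?_, ?_⟩
    · rintro b _ ⟨s, hs, rfl⟩ _ ⟨t, ht, rfl⟩ h
      have : s = t := hi b hs ht h
      rw [this]
    · rintro b _ ⟨w, ⟨⟨t, ht, rfl⟩, hw⟩, rfl⟩
      rw [evΔ]
      apply hin b t
      refine ⟨lt_of_le_of_ne ht.1 ?_, lt_of_le_of_ne ht.2 ?_⟩
      · rintro rfl; exact hw (Or.inl Γ0)
      · rintro rfl; exact hw (Or.inr Γ1)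
  have pt := cut.part hC
  obtain ⟨RA, cA, sA, iA, mA⟩ := exists_rel (cut.cellA hC)
  obtain ⟨RB, cB, sB, iB, mB⟩ := exists_rel (cut.cellB hC)
  have hmix : ∀ b, ∀ u ∈ RA, ∀ v ∈ RB, ev b u = ev b v → u = v := by
    intro b u hu v hv huv
    have h1 : ev b u ∈ KK b (Δ '' A ∪ c) := by rw [← mA b]; exact ⟨u, hu, rfl⟩
    have h2 : ev b u ∈ KK b (Δ '' B ∪ c) := by rw [← mB b]; exact ⟨v, hv, huv.symm⟩
    obtain ⟨w, hw, he⟩ := cut.inter hC b ⟨h1, h2⟩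
    have e1 := iA b hu (sA (Or.inr hw)) he.symm
    have e2 := iB b hv (sB (Or.inr hw)) (huv.symm.trans he.symm)
    rw [e1, e2]
  suffices h : ∃ k : ℂ ≃ₜ ℂ, (∀ z, z ∉ In J → k z = z) ∧ ∀ w ∈ RA ∪ RB, k (w false) = w true by
    obtain ⟨k, hk1, hk2⟩ := h
    exact ⟨k, hk1, fun t ht => hk2 (Γ t) (Or.inl (sA (Or.inr ⟨t, ht, rfl⟩)))⟩
  refine rel_homeo (J := J) (R := RA ∪ RB) hJ.isCompact (cA.union cB) ?_ ?_ ?_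
  · rintro b u (hu | hu) v (hv | hv) huv
    · exact iA b hu hv huv
    · exact hmix b u hu v hv huv
    · exact (hmix b v hv u hu huv.symm).symm
    · exact iB b hu hv huv
  · intro b
    rw [image_union, mA, mB]
    have hKC : KK b (Δ '' J) = J ∪ In J := by unfold KK; rw [evΔ]
    rw [← hKC]
    apply Subset.antisymm
    · exact union_subset (pt.KK_sub hC (Or.inl rfl) b) (pt.KK_sub hC (Or.inr rfl) b)
    · have := pt.cover b
      simpa only [mem_insert_iff, mem_singleton_iff, iUnion_iUnion_eq_or_left, iUnion_iUnion_eq_left] using this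
  · intro z hz
    rw [hdec.union] at hz
    rcases hz with hz | hz
    · exact Or.inl (sA (Or.inl ⟨z, hz, rfl⟩))
    · exact Or.inr (sB (Or.inl ⟨z, hz, rfl⟩))

end Schoen

set_option linter.unusedVariables false
namespace Schoen
open Set Filter Topology Metric

def hseg (y p q : ℝ) : Set ℂ := (fun r : ℝ => (⟨r, y⟩ : ℂ)) '' Icc p q
def vseg (x p q : ℝ) : Set ℂ := (fun r : ℝ => (⟨x, r⟩ : ℂ)) '' Icc p q

lemma mem_hseg {y p q : ℝ} {z : ℂ} : z ∈ hseg y p q ↔ z.im = y ∧ p ≤ z.re ∧ z.re ≤ q := by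
  constructor
  · rintro ⟨r, hr, rfl⟩; exact ⟨rfl, hr.1, hr.2⟩
  · rintro ⟨h1, h2, h3⟩; exact ⟨z.re, ⟨h2, h3⟩, Complex.ext rfl h1.symm⟩

lemma mem_vseg {y p q : ℝ} {z : ℂ} : z ∈ vseg y p q ↔ z.re = y ∧ p ≤ z.im ∧ z.im ≤ q := by
  constructor
  · rintro ⟨r, hr, rfl⟩; exact ⟨rfl, hr.1, hr.2⟩
  · rintro ⟨h1, h2, h3⟩; exact ⟨z.im, ⟨h2, h3⟩, Complex.ext h1.symm rfl⟩

lemma hseg_arc {y p q : ℝ} (h : p < q) : IsArc (hseg y p q) ⟨p, y⟩ ⟨q, y⟩ := chord_arc (Line.im y).iso h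
lemma vseg_arc {y p q : ℝ} (h : p < q) : IsArc (vseg y p q) ⟨y, p⟩ ⟨y, q⟩ := chord_arc (Line.re y).iso h

lemma half_arc1 {x0 c a b : ℝ} (h1 : x0 < c) (hab : a < b) :
    IsArc (hseg a x0 c ∪ vseg x0 a b ∪ hseg b x0 c) ⟨c, a⟩ ⟨c, b⟩ := by
  refine ((hseg_arc h1).symm.concat (vseg_arc hab) ?_).concat (hseg_arc h1) ?_
  · ext z
    simp only [mem_inter_iff, mem_hseg, mem_vseg, mem_singleton_iff, Complex.ext_iff]
    constructor
    · rintro ⟨⟨e1, e2, e3⟩, e4, e5, e6⟩; exact ⟨e4, e1⟩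
    · rintro ⟨e1, e2⟩; rw [e1, e2]; simp [h1.le, hab.le]
  · ext z
    simp only [mem_inter_iff, mem_union, mem_hseg, mem_vseg, mem_singleton_iff, Complex.ext_iff]
    constructor
    · rintro ⟨⟨e1, e2, e3⟩ | ⟨e4, e5, e6⟩, e7, e8, e9⟩
      · linarith
      · exact ⟨e4, e7⟩
    · rintro ⟨e1, e2⟩; rw [e1, e2]; simp [h1.le, hab.le]

lemma half_arc2 {x1 c a b : ℝ} (h1 : c < x1) (hab : a < b) :
    IsArc (hseg a c x1 ∪ vseg x1 a b ∪ hseg b c x1) ⟨c, a⟩ ⟨c, b⟩ := by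
  refine ((hseg_arc h1).concat (vseg_arc hab) ?_).concat (hseg_arc h1).symm ?_
  · ext z
    simp only [mem_inter_iff, mem_hseg, mem_vseg, mem_singleton_iff, Complex.ext_iff]
    constructor
    · rintro ⟨⟨e1, e2, e3⟩, e4, e5, e6⟩; exact ⟨e4, e1⟩
    · rintro ⟨e1, e2⟩; rw [e1, e2]; simp [h1.le, hab.le]
  · ext z
    simp only [mem_inter_iff, mem_union, mem_hseg, mem_vseg, mem_singleton_iff, Complex.ext_iff]
    constructor
    · rintro ⟨⟨e1, e2, e3⟩ | ⟨e4, e5, e6⟩, e7, e8, e9⟩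
      · linarith
      · exact ⟨e4, e7⟩
    · rintro ⟨e1, e2⟩; rw [e1, e2]; simp [h1.le, hab.le]

def rbd (x0 x1 c a b : ℝ) : Set ℂ := (hseg a x0 c ∪ vseg x0 a b ∪ hseg b x0 c) ∪
  (hseg a c x1 ∪ vseg x1 a b ∪ hseg b c x1)

lemma rbd_dec {x0 x1 c a b : ℝ} (h0 : x0 < c) (h1 : c < x1) (hab : a < b) :
    Dec (rbd x0 x1 c a b) ⟨c, a⟩ ⟨c, b⟩ (hseg a x0 c ∪ vseg x0 a b ∪ hseg b x0 c)
      (hseg a c x1 ∪ vseg x1 a b ∪ hseg b c x1) := by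
  refine ⟨half_arc1 h0 hab, half_arc2 h1 hab, ?_, rfl⟩
  ext z
  simp only [mem_inter_iff, mem_union, mem_hseg, mem_vseg, mem_singleton_iff, Complex.ext_iff,
    mem_insert_iff]
  constructor
  · rintro ⟨(⟨e1, e2, e3⟩ | ⟨e1, e2, e3⟩) | ⟨e1, e2, e3⟩, (⟨f1, f2, f3⟩ | ⟨f1, f2, f3⟩) | ⟨f1, f2, f3⟩⟩
    · exact Or.inl ⟨by linarith, e1⟩
    · linarith
    · linarith
    · linarith
    · linarith
    · linarith
    · linarith
    · linarith
    · exact Or.inr ⟨by linarith, e1⟩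
  · rintro (⟨e1, e2⟩ | ⟨e1, e2⟩)
    · rw [e1, e2]; simp [h0.le, h1.le]
    · rw [e1, e2]; simp [h0.le, h1.le]

lemma mem_rbd {x0 x1 c a b : ℝ} (h0 : x0 < c) (h1 : c < x1) {z : ℂ} : z ∈ rbd x0 x1 c a b ↔
    (x0 ≤ z.re ∧ z.re ≤ x1 ∧ (z.im = a ∨ z.im = b)) ∨ ((z.re = x0 ∨ z.re = x1) ∧ a ≤ z.im ∧ z.im ≤ b) := by
  simp only [rbd, mem_union, mem_hseg, mem_vseg]
  constructor
  · rintro (((⟨e1, e2, e3⟩ | ⟨e1, e2, e3⟩) | ⟨e1, e2, e3⟩) | ((⟨e1, e2, e3⟩ | ⟨e1, e2, e3⟩) | ⟨e1, e2, e3⟩))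
    · exact Or.inl ⟨by linarith, by linarith, Or.inl e1⟩
    · exact Or.inr ⟨Or.inl e1, e2, e3⟩
    · exact Or.inl ⟨by linarith, by linarith, Or.inr e1⟩
    · exact Or.inl ⟨by linarith, by linarith, Or.inl e1⟩
    · exact Or.inr ⟨Or.inr e1, e2, e3⟩
    · exact Or.inl ⟨by linarith, by linarith, Or.inr e1⟩
  · rintro (⟨e1, e2, e3⟩ | ⟨e1, e2, e3⟩)
    · rcases le_total z.re c with h | h <;> rcases e3 with e3 | e3
      · exact Or.inl (Or.inl (Or.inl ⟨e3, e1, h⟩))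
      · exact Or.inl (Or.inr ⟨e3, e1, h⟩)
      · exact Or.inr (Or.inl (Or.inl ⟨e3, h, e2⟩))
      · exact Or.inr (Or.inr ⟨e3, h, e2⟩)
    · rcases e1 with e1 | e1
      · exact Or.inl (Or.inl (Or.inr ⟨e1, e2, e3⟩))
      · exact Or.inr (Or.inl (Or.inr ⟨e1, e2, e3⟩))

lemma not_in_of_ray {J : Set ℂ} (hJ : IsCompact J) {p d : ℂ} (hd : ‖d‖ = 1)
    (h : ∀ t : ℝ, 0 ≤ t → p + t * d ∉ J) : p ∉ In J := by
  intro hp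
  have hS : IsPreconnected ((fun t : ℝ => p + t * d) '' Ici 0) :=
    isPreconnected_Ici.image _ (by fun_prop)
  have hsub := in_of_conn hS hJ (by
    rw [Set.disjoint_left]; rintro _ ⟨t, ht, rfl⟩; exact h t ht) ⟨0, by simp, by simp⟩ hp
  obtain ⟨M, hM⟩ := (in_bounded hJ).subset_closedBall p
  have h0 : 0 ≤ M := by simpa using hM hp
  have := hM (hsub ⟨M + 1, by simp; linarith, rfl⟩)
  simp only [mem_closedBall, dist_eq_norm, add_sub_cancel_left, norm_mul, hd, mul_one] at this
  rw [Complex.norm_real, Real.norm_of_nonneg (by linarith)] at this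
  linarith

lemma rbd_in {x0 x1 c a b : ℝ} (h0 : x0 < c) (h1 : c < x1) (hab : a < b) :
    In (rbd x0 x1 c a b) = Ioo x0 x1 ×ℂ Ioo a b := by
  have hJ := (rbd_dec h0 h1 hab).isLoop.isCompact
  apply Subset.antisymm
  · intro p hp
    have hpJ : p ∉ rbd x0 x1 c a b := hp.1
    rw [Complex.mem_reProdIm]
    have c1 : x0 ≤ p.re := by
      by_contra! hlt
      refine not_in_of_ray hJ (d := -1) (by simp) (fun t ht hm => ?_) hp
      rw [mem_rbd h0 h1] at hm
      simp at hm
      rcases hm with h | ⟨h | h, _⟩ <;> linarith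
    have c2 : p.re ≤ x1 := by
      by_contra! hlt
      refine not_in_of_ray hJ (d := 1) (by simp) (fun t ht hm => ?_) hp
      rw [mem_rbd h0 h1] at hm
      simp at hm
      rcases hm with h | ⟨h | h, _⟩ <;> linarith
    have c3 : a ≤ p.im := by
      by_contra! hlt
      refine not_in_of_ray hJ (d := -Complex.I) (by simp) (fun t ht hm => ?_) hp
      rw [mem_rbd h0 h1] at hm
      simp at hm
      rcases hm with ⟨_, _, h | h⟩ | h <;> linarith
    have c4 : p.im ≤ b := by
      by_contra! hlt
      refine not_in_of_ray hJ (d := Complex.I) (by simp) (fun t ht hm => ?_) hp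
      rw [mem_rbd h0 h1] at hm
      simp at hm
      rcases hm with ⟨_, _, h | h⟩ | h <;> linarith
    rw [mem_rbd h0 h1] at hpJ
    push Not at hpJ
    refine ⟨⟨lt_of_le_of_ne c1 ?_, lt_of_le_of_ne c2 ?_⟩, lt_of_le_of_ne c3 ?_, lt_of_le_of_ne c4 ?_⟩
    · intro h; exact absurd c4 (not_le.mpr (hpJ.2 (Or.inl h.symm) c3))
    · intro h; exact absurd c4 (not_le.mpr (hpJ.2 (Or.inr h) c3))
    · intro h; exact (hpJ.1 c1 c2).1 h.symm
    · intro h; exact (hpJ.1 c1 c2).2 h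
  · apply subset_in_of_bounded
    · exact (isBounded_Ioo _ _).reProdIm (isBounded_Ioo _ _)
    · intro z hz
      rw [Complex.frontier_reProdIm, frontier_Ioo (h0.trans h1), frontier_Ioo hab,
        closure_Ioo (h0.trans h1).ne, closure_Ioo hab.ne] at hz
      rw [mem_rbd h0 h1]
      rcases hz with hz | hz
      · rw [Complex.mem_reProdIm] at hz; exact Or.inl ⟨hz.1.1, hz.1.2, hz.2⟩
      · rw [Complex.mem_reProdIm] at hz; exact Or.inr ⟨hz.1, hz.2.1, hz.2.2⟩
    · exact hJ.isClosed
    · rw [Set.disjoint_left]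
      intro z hz hm
      rw [Complex.mem_reProdIm] at hz
      rw [mem_rbd h0 h1] at hm
      obtain ⟨⟨e1, e2⟩, e3, e4⟩ := hz
      rcases hm with ⟨_, _, h | h⟩ | ⟨h | h, _⟩ <;> linarith

lemma rect_move {x0 x1 c a b : ℝ} (h0 : x0 < c) (h1 : c < x1) (hab : a < b) {e : ℝ → ℝ × ℝ}
    (hc : ContinuousOn e (Icc a b)) (hi : InjOn e (Icc a b)) (ea : e a = (c, a)) (eb : e b = (c, b))
    (hin : ∀ t ∈ Ioo a b, e t ∈ Ioo x0 x1 ×ˢ Ioo a b) :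
    ∃ k : ℝ × ℝ ≃ₜ ℝ × ℝ, (∀ z, z ∉ Ioo x0 x1 ×ˢ Ioo a b → k z = z) ∧ ∀ t ∈ Icc a b, k (c, t) = e t := by
  let Θ : ℂ ≃ₜ ℝ × ℝ := Complex.equivRealProdCLM.toHomeomorph
  have hΘ : ∀ z, Θ z = (z.re, z.im) := fun z => rfl
  have hΘs : ∀ p, Θ.symm p = ⟨p.1, p.2⟩ := fun p => by
    rw [Homeomorph.symm_apply_eq, hΘ]
  let τ : ℝ → ℝ := fun t => a + t * (b - a)
  have τc : Continuous τ := by fun_prop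
  have τI : ∀ t ∈ Icc (0:ℝ) 1, τ t ∈ Icc a b := fun t ht => by
    have := ht.1; have := ht.2
    constructor <;> simp only [τ] <;> nlinarith
  have τI' : ∀ t ∈ Ioo (0:ℝ) 1, τ t ∈ Ioo a b := fun t ht => by
    have := ht.1; have := ht.2
    constructor <;> simp only [τ] <;> nlinarith
  have τi : Function.Injective τ := fun s t h => by
    have h' : a + s * (b - a) = a + t * (b - a) := h
    have : (s - t) * (b - a) = 0 := by linarith
    rcases mul_eq_zero.mp this with h | h <;> linarith
  let γ : Bool → ℝ → ℂ := fun d t => cond d (Θ.symm (e (τ t))) (Θ.symm (c, τ t))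
  have hd := rbd_dec h0 h1 hab
  have hI := rbd_in h0 h1 hab
  have hn : (In (rbd x0 x1 c a b)).Nonempty := by
    rw [hI]
    exact ⟨⟨c, (a+b)/2⟩, by rw [Complex.mem_reProdIm]; exact ⟨⟨h0, h1⟩, by simp; linarith, by simp; linarith⟩⟩
  have τ0 : τ 0 = a := by simp [τ]
  have τ1 : τ 1 = b := by simp [τ]
  obtain ⟨k, hk1, hk2⟩ := move_crosscut hd.isLoop hn (γ := γ) (x := ⟨c, a⟩) (y := ⟨c, b⟩)
    (hd.subA hd.arcA.left_mem) (hd.subA hd.arcA.right_mem)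
    (by
      intro d; cases d
      · exact (Θ.symm.continuous.comp (by fun_prop : Continuous fun t => (c, τ t))).continuousOn
      · exact Θ.symm.continuous.comp_continuousOn (hc.comp τc.continuousOn τI))
    (by
      intro d; cases d
      · intro s hs t ht h
        have := Θ.symm.injective h
        exact τi (Prod.ext_iff.mp this).2
      · intro s hs t ht h
        exact τi (hi (τI s hs) (τI t ht) (Θ.symm.injective h)))
    (by intro d; cases d <;> simp only [γ, cond_true, cond_false, τ0, ea, hΘs])
    (by intro d; cases d <;> simp only [γ, cond_true, cond_false, τ1, eb, hΘs])
    (by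
      intro d t ht
      rw [hI, Complex.mem_reProdIm]
      cases d
      · simp only [γ, cond_false, hΘs]; exact ⟨⟨h0, h1⟩, τI' t ht⟩
      · simp only [γ, cond_true, hΘs]; exact hin _ (τI' t ht))
  refine ⟨(Θ.symm.trans k).trans Θ, ?_, ?_⟩
  · intro z hz
    have : k (Θ.symm z) = Θ.symm z := by
      apply hk1; rw [hI, Complex.mem_reProdIm, hΘs]; exact hz
    simp [this]
  · intro t ht
    have hpos : 0 < b - a := sub_pos.mpr hab
    have hs : (t - a) / (b - a) ∈ Icc (0:ℝ) 1 :=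
      ⟨div_nonneg (by linarith [ht.1]) hpos.le, (div_le_one hpos).mpr (by linarith [ht.2])⟩
    have hτ : τ ((t - a) / (b - a)) = t := by
      simp only [τ]; rw [div_mul_cancel₀ _ hpos.ne']; ring
    have := hk2 _ hs
    simp only [γ, cond_true, cond_false, hτ] at this
    simp [this]

end Schoen

set_option linter.unusedVariables false
namespace Schoen
open Set Filter Topology Metric

/-- complementary interval of `C` -/
def IsGap (C : Set ℝ) (p : ℝ × ℝ) : Prop :=
  p.1 ∈ C ∧ p.2 ∈ C ∧ p.1 < p.2 ∧ ∀ t ∈ Ioo p.1 p.2, t ∉ C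

theorem IsGap.le_or {C : Set ℝ} {p : ℝ × ℝ} (h : IsGap C p) {t : ℝ} (ht : t ∈ C) :
    t ≤ p.1 ∨ p.2 ≤ t := by
  by_contra hh
  push Not at hh
  exact h.2.2.2 t hh ht

theorem gap_unique {C : Set ℝ} {p q : ℝ × ℝ} (hp : IsGap C p) (hq : IsGap C q) {t : ℝ}
    (h1 : t ∈ Ioo p.1 p.2) (h2 : t ∈ Ioo q.1 q.2) : p = q := by
  have a1 := hp.le_or hq.1
  have a2 := hp.le_or hq.2.1
  have a3 := hq.le_or hp.1
  have a4 := hq.le_or hp.2.1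
  obtain ⟨b1, b2⟩ := h1
  obtain ⟨b3, b4⟩ := h2
  apply Prod.ext
  · rcases a1 with a1 | a1 <;> rcases a3 with a3 | a3 <;> linarith
  · rcases a2 with a1 | a1 <;> rcases a4 with a3 | a3 <;> linarith

theorem exists_gap {C : Set ℝ} (hC : IsCompact C) (h0 : (0:ℝ) ∈ C) (h1 : (1:ℝ) ∈ C) {t : ℝ}
    (ht : t ∈ Icc (0:ℝ) 1) (htC : t ∉ C) : ∃ p, IsGap C p ∧ t ∈ Ioo p.1 p.2 := by
  have c1 : IsCompact (C ∩ Iic t) := hC.inter_right isClosed_Iic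
  have c2 : IsCompact (C ∩ Ici t) := hC.inter_right isClosed_Ici
  have m1 := c1.sSup_mem ⟨0, h0, ht.1⟩
  have m2 := c2.sInf_mem ⟨1, h1, ht.2⟩
  set a := sSup (C ∩ Iic t)
  set b := sInf (C ∩ Ici t)
  have la : a < t := lt_of_le_of_ne m1.2 (fun h => htC (h ▸ m1.1))
  have lb : t < b := lt_of_le_of_ne m2.2 (fun h => htC (h ▸ m2.1))
  refine ⟨(a, b), ⟨m1.1, m2.1, la.trans lb, ?_⟩, la, lb⟩
  intro s hs hsC
  rcases le_total s t with h | h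
  · exact absurd (le_csSup c1.bddAbove ⟨hsC, h⟩) (not_le.mpr hs.1)
  · exact absurd (csInf_le c2.bddBelow ⟨hsC, h⟩) (not_le.mpr hs.2)

open Classical in
/-- gluing of maps supported in the gaps -/
noncomputable def glue (C : Set ℝ) (K : ℝ × ℝ → (ℝ × ℝ ≃ₜ ℝ × ℝ)) (z : ℝ × ℝ) : ℝ × ℝ :=
  if h : ∃ p : ℝ × ℝ, IsGap C p ∧ z.2 ∈ Ioo p.1 p.2 then K h.choose z else z

theorem glue_in {C : Set ℝ} (K : ℝ × ℝ → (ℝ × ℝ ≃ₜ ℝ × ℝ)) {z p : ℝ × ℝ} (hp : IsGap C p)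
    (hz : z.2 ∈ Ioo p.1 p.2) : glue C K z = K p z := by
  have h : ∃ p : ℝ × ℝ, IsGap C p ∧ z.2 ∈ Ioo p.1 p.2 := ⟨p, hp, hz⟩
  rw [glue, dif_pos h, gap_unique h.choose_spec.1 hp h.choose_spec.2 hz]

theorem glue_out {C : Set ℝ} (K : ℝ × ℝ → (ℝ × ℝ ≃ₜ ℝ × ℝ)) {z : ℝ × ℝ}
    (h : ¬ ∃ p : ℝ × ℝ, IsGap C p ∧ z.2 ∈ Ioo p.1 p.2) : glue C K z = z := by
  rw [glue, dif_neg h]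

theorem small_gaps (C : Set ℝ) (t : ℝ) (hno : ¬ ∃ p : ℝ × ℝ, IsGap C p ∧ t ∈ Ioo p.1 p.2)
    {δ : ℝ} (hδ : 0 < δ) :
    ∃ ρ > 0, ∀ p s, IsGap C p → s ∈ Ioo p.1 p.2 → |s - t| < ρ →
      p.2 - p.1 < δ ∨ p.1 = t ∨ p.2 = t := by
  have R : ∃ ρ > 0, ∀ p s, IsGap C p → s ∈ Ioo p.1 p.2 → s < t + ρ → t < p.1 → p.2 - p.1 < δ := by
    by_cases h : ∃ q, IsGap C q ∧ t < q.1 ∧ q.1 < t + δ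
    · obtain ⟨q, hq, h1, h2⟩ := h
      refine ⟨q.1 - t, by linarith, ?_⟩
      intro p s hp hs hst htp
      have := hp.le_or hq.1
      rcases this with h | h <;> linarith [hs.1, hs.2]
    · refine ⟨δ, hδ, ?_⟩
      intro p s hp hs hst htp
      exact absurd ⟨p, hp, htp, by linarith [hs.1]⟩ h
  have L : ∃ ρ > 0, ∀ p s, IsGap C p → s ∈ Ioo p.1 p.2 → t - ρ < s → p.2 < t → p.2 - p.1 < δ := by
    by_cases h : ∃ q, IsGap C q ∧ q.2 < t ∧ t - δ < q.2
    · obtain ⟨q, hq, h1, h2⟩ := h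
      refine ⟨t - q.2, by linarith, ?_⟩
      intro p s hp hs hst htp
      have := hp.le_or hq.2.1
      rcases this with h | h <;> linarith [hs.1, hs.2]
    · refine ⟨δ, hδ, ?_⟩
      intro p s hp hs hst htp
      exact absurd ⟨p, hp, htp, by linarith [hs.2]⟩ h
  obtain ⟨r, hr, R⟩ := R
  obtain ⟨l, hl, L⟩ := L
  refine ⟨min r l, lt_min hr hl, ?_⟩
  intro p s hp hs hst
  rw [abs_lt] at hst
  have e1 := min_le_left r l
  have e2 := min_le_right r l
  rcases lt_trichotomy t p.1 with h | h | h
  · exact Or.inl (R p s hp hs (by linarith) h)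
  · exact Or.inr (Or.inl h.symm)
  · rcases lt_trichotomy t p.2 with h' | h' | h'
    · exact absurd ⟨p, hp, h, h'⟩ hno
    · exact Or.inr (Or.inr h'.symm)
    · exact Or.inl (L p s hp hs (by linarith) h')

theorem glue_continuous (C : Set ℝ) (K : ℝ × ℝ → (ℝ × ℝ ≃ₜ ℝ × ℝ))
    (hK : ∀ p, IsGap C p → ∀ z, z.2 ∉ Ioo p.1 p.2 → K p z = z)
    (hs : ∀ ε > 0, ∃ δ > 0, ∀ p, IsGap C p → p.2 - p.1 < δ → ∀ z, dist (K p z) z < ε) :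
    Continuous (glue C K) := by
  rw [continuous_iff_continuousAt]
  intro z0
  by_cases h0 : ∃ p : ℝ × ℝ, IsGap C p ∧ z0.2 ∈ Ioo p.1 p.2
  · obtain ⟨p, hp, hz⟩ := h0
    refine (K p).continuous.continuousAt.congr ?_
    have : ∀ᶠ z : ℝ × ℝ in 𝓝 z0, z.2 ∈ Ioo p.1 p.2 :=
      continuous_snd.continuousAt.eventually (isOpen_Ioo.mem_nhds hz)
    filter_upwards [this] with z hz
    exact (glue_in K hp hz).symm
  · rw [ContinuousAt, glue_out K h0, Metric.tendsto_nhds]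
    intro ε hε
    obtain ⟨δ, hδ, hsm⟩ := hs (ε/2) (half_pos hε)
    obtain ⟨ρ, hρ, hg⟩ := small_gaps C z0.2 h0 hδ
    have key : ∀ p, IsGap C p → (p.1 = z0.2 ∨ p.2 = z0.2) → ∀ᶠ z in 𝓝 z0, dist (K p z) z0 < ε := by
      intro p hp hpe
      have e : K p z0 = z0 := hK p hp z0 (fun h => h0 ⟨p, hp, h⟩)
      have := (K p).continuous.continuousAt (x := z0)
      rw [ContinuousAt, e, Metric.tendsto_nhds] at this
      exact this ε hε
    have E1 : ∀ᶠ z in 𝓝 z0, ∀ p, IsGap C p → p.1 = z0.2 → dist (K p z) z0 < ε := by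
      by_cases h : ∃ p, IsGap C p ∧ p.1 = z0.2
      · obtain ⟨p, hp, he⟩ := h
        filter_upwards [key p hp (Or.inl he)] with z hz q hq hqe
        have : q = p := by
          have h1 := hp.2.2.1
          have h2 := hq.2.2.1
          have : min p.2 q.2 > z0.2 := lt_min (by linarith) (by linarith)
          have m1 := min_le_left p.2 q.2
          have m2 := min_le_right p.2 q.2
          exact gap_unique (t := (z0.2 + min p.2 q.2)/2) hq hp ⟨by linarith, by linarith⟩
            ⟨by linarith, by linarith⟩
        rw [this]; exact hz
      · exact Eventually.of_forall (fun z p hp he => absurd ⟨p, hp, he⟩ h)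
    have E2 : ∀ᶠ z in 𝓝 z0, ∀ p, IsGap C p → p.2 = z0.2 → dist (K p z) z0 < ε := by
      by_cases h : ∃ p, IsGap C p ∧ p.2 = z0.2
      · obtain ⟨p, hp, he⟩ := h
        filter_upwards [key p hp (Or.inr he)] with z hz q hq hqe
        have : q = p := by
          have h1 := hp.2.2.1
          have h2 := hq.2.2.1
          have : max p.1 q.1 < z0.2 := max_lt (by linarith) (by linarith)
          have m1 := le_max_left p.1 q.1
          have m2 := le_max_right p.1 q.1
          exact gap_unique (t := (z0.2 + max p.1 q.1)/2) hq hp ⟨by linarith, by linarith⟩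
            ⟨by linarith, by linarith⟩
        rw [this]; exact hz
      · exact Eventually.of_forall (fun z p hp he => absurd ⟨p, hp, he⟩ h)
    have E3 : ∀ᶠ z in 𝓝 z0, dist z z0 < min ρ (ε/2) :=
      Metric.ball_mem_nhds z0 (lt_min hρ (half_pos hε))
    filter_upwards [E1, E2, E3] with z e1 e2 e3
    have e4 : dist z z0 < ε/2 := e3.trans_le (min_le_right _ _)
    by_cases h : ∃ p : ℝ × ℝ, IsGap C p ∧ z.2 ∈ Ioo p.1 p.2
    · obtain ⟨p, hp, hz⟩ := h
      rw [glue_in K hp hz]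
      have : |z.2 - z0.2| < ρ := by
        have : dist z.2 z0.2 ≤ dist z z0 := by rw [Prod.dist_eq]; exact le_max_right _ _
        rw [Real.dist_eq] at this
        exact this.trans_lt (e3.trans_le (min_le_left _ _))
      rcases hg p z.2 hp hz this with h | h | h
      · have := hsm p hp h z
        linarith [dist_triangle (K p z) z z0]
      · exact e1 p hp h
      · exact e2 p hp h
    · rw [glue_out K h]; linarith

theorem glue_leftInv (C : Set ℝ) (K K' : ℝ × ℝ → (ℝ × ℝ ≃ₜ ℝ × ℝ))
    (hKK : ∀ p z, K' p (K p z) = z)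
    (hK : ∀ p, IsGap C p → ∀ z, z.2 ∉ Ioo p.1 p.2 → K p z = z) (z : ℝ × ℝ) :
    glue C K' (glue C K z) = z := by
  by_cases h : ∃ p : ℝ × ℝ, IsGap C p ∧ z.2 ∈ Ioo p.1 p.2
  · obtain ⟨p, hp, hz⟩ := h
    have : (K p z).2 ∈ Ioo p.1 p.2 := by
      by_contra hh
      have := (K p).injective (hK p hp _ hh)
      rw [this] at hh
      exact hh hz
    rw [glue_in K hp hz, glue_in K' hp this, hKK]
  · rw [glue_out K h, glue_out K' h]

theorem glue_homeo (C : Set ℝ) (K : ℝ × ℝ → (ℝ × ℝ ≃ₜ ℝ × ℝ))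
    (hK : ∀ p, IsGap C p → ∀ z, z.2 ∉ Ioo p.1 p.2 → K p z = z)
    (hs : ∀ ε > 0, ∃ δ > 0, ∀ p, IsGap C p → p.2 - p.1 < δ → ∀ z, dist (K p z) z < ε) :
    ∃ H : ℝ × ℝ ≃ₜ ℝ × ℝ, ∀ z, H z = glue C K z := by
  have hK' : ∀ p, IsGap C p → ∀ z, z.2 ∉ Ioo p.1 p.2 → (K p).symm z = z := by
    intro p hp z hz
    rw [Homeomorph.symm_apply_eq, hK p hp z hz]
  refine ⟨⟨⟨glue C K, glue C (fun p => (K p).symm),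
    glue_leftInv C K _ (fun p z => (K p).symm_apply_apply z) hK,
    glue_leftInv C _ K (fun p z => (K p).apply_symm_apply z) hK'⟩,
    glue_continuous C K hK hs, glue_continuous C _ hK' ?_⟩, fun z => rfl⟩
  intro ε hε
  obtain ⟨δ, hδ, h⟩ := hs ε hε
  refine ⟨δ, hδ, fun p hp hd z => ?_⟩
  have := h p hp hd ((K p).symm z)
  rw [Homeomorph.apply_symm_apply, dist_comm] at this
  exact this

theorem gap_move {C : Set ℝ} {a b c lb : ℝ} (hab : a < b) {e : ℝ → ℝ × ℝ}
    (hc : ContinuousOn e (Icc a b)) (hi : InjOn e (Icc a b)) (ea : e a = (c, a))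
    (eb : e b = (c, b)) (h2 : ∀ t ∈ Ioo a b, (e t).2 ∈ Ioo a b)
    (hlb : lb < c) (hl : ∀ t ∈ Icc a b, lb < (e t).1) :
    ∃ k : ℝ × ℝ ≃ₜ ℝ × ℝ, (∀ z : ℝ × ℝ, z.2 ∉ Ioo a b → k z = z) ∧
      (∀ z : ℝ × ℝ, z.1 ≤ lb → k z = z) ∧ (∀ t ∈ Icc a b, k (c, t) = e t) ∧
      ∃ t ∈ Icc a b, ∀ z, dist (k z) z ≤ 2 * |(e t).1 - c| + 2 * (b - a) := by
  have hcW : ContinuousOn (fun t => |(e t).1 - c|) (Icc a b) := by fun_prop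
  obtain ⟨t0, ht0, hmax⟩ := isCompact_Icc.exists_isMaxOn (nonempty_Icc.mpr hab.le) hcW
  set W := |(e t0).1 - c| with hW
  have hW0 : 0 ≤ W := abs_nonneg _
  have hWm : ∀ t ∈ Icc a b, |(e t).1 - c| ≤ W := fun t ht => hmax ht
  set x0 := max (c - W - (b - a)) lb with hx0
  set x1 := c + W + (b - a) with hx1
  have hx0c : x0 < c := max_lt (by linarith) hlb
  obtain ⟨k, hk, hke⟩ := rect_move (x0 := x0) (x1 := x1) hx0c (by linarith) hab hc hi ea eb (by
    intro t ht
    have ht' := Ioo_subset_Icc_self ht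
    have := abs_le.mp (hWm t ht')
    exact ⟨⟨max_lt (by linarith) (hl t ht'), by linarith⟩, h2 t ht⟩)
  refine ⟨k, fun z hz => hk z (fun h => hz h.2), fun z hz => hk z (fun h => ?_), hke, t0, ht0, ?_⟩
  · have := h.1.1
    have := le_max_right (c - W - (b - a)) lb
    linarith
  · intro z
    by_cases hz : z ∈ Ioo x0 x1 ×ˢ Ioo a b
    · have hkz : k z ∈ Ioo x0 x1 ×ˢ Ioo a b := by
        by_contra hh
        have := k.injective (hk _ hh)
        rw [this] at hh
        exact hh hz
      have := le_max_left (c - W - (b - a)) lb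
      obtain ⟨⟨p1, p2⟩, p3, p4⟩ := hz
      obtain ⟨⟨q1, q2⟩, q3, q4⟩ := hkz
      rw [Prod.dist_eq, Real.dist_eq, Real.dist_eq]
      apply max_le <;> rw [abs_le] <;> constructor <;> linarith
    · rw [hk z hz, dist_self]; linarith

theorem stage {C : Set ℝ} (hC : IsCompact C) (hsub : C ⊆ Icc 0 1) (h0 : (0:ℝ) ∈ C)
    (h1 : (1:ℝ) ∈ C) {c lb : ℝ} {e : ℝ → ℝ × ℝ} (hc : ContinuousOn e (Icc 0 1))
    (hi : InjOn e (Icc 0 1)) (heC : ∀ t ∈ C, e t = (c, t))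
    (hE : ∀ t ∈ Icc (0:ℝ) 1, ∀ s ∈ C, (e t).2 = s ↔ t = s) (hlb : lb < c)
    (hl : ∀ t ∈ Icc (0:ℝ) 1, lb < (e t).1) :
    ∃ H : ℝ × ℝ ≃ₜ ℝ × ℝ, (∀ z : ℝ × ℝ, z.2 ∈ C → H z = z) ∧
      (∀ z : ℝ × ℝ, z.2 ∉ Icc (0:ℝ) 1 → H z = z) ∧ (∀ z : ℝ × ℝ, z.1 ≤ lb → H z = z) ∧
      ∀ t ∈ Icc (0:ℝ) 1, H (c, t) = e t := by
  have hgap : ∀ p, IsGap C p → Icc p.1 p.2 ⊆ Icc 0 1 := fun p hp =>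
    Icc_subset_Icc (hsub hp.1).1 (hsub hp.2.1).2
  have hex : ∀ p : ℝ × ℝ, ∃ k : ℝ × ℝ ≃ₜ ℝ × ℝ, IsGap C p →
      (∀ z : ℝ × ℝ, z.2 ∉ Ioo p.1 p.2 → k z = z) ∧
      (∀ z : ℝ × ℝ, z.1 ≤ lb → k z = z) ∧ (∀ t ∈ Icc p.1 p.2, k (c, t) = e t) ∧
      ∃ t ∈ Icc p.1 p.2, ∀ z, dist (k z) z ≤ 2 * |(e t).1 - c| + 2 * (p.2 - p.1) := by
    intro p
    by_cases hp : IsGap C p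
    · have hI := hgap p hp
      have hcI := hc.mono hI
      obtain ⟨k, hk⟩ := gap_move (C := C) (lb := lb) hp.2.2.1 hcI (hi.mono hI) (heC _ hp.1)
        (heC _ hp.2.1) (by
          intro t ht
          have hc2 : ContinuousOn (fun s => (e s).2) (Icc p.1 p.2) := by fun_prop
          have htI := hI (Ioo_subset_Icc_self ht)
          have ea : (e p.1).2 = p.1 := by rw [heC _ hp.1]
          have eb : (e p.2).2 = p.2 := by rw [heC _ hp.2.1]
          constructor
          · by_contra hh
            push Not at hh
            have hcs : ContinuousOn (fun s => (e s).2) (Icc t p.2) :=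
              hc2.mono (Icc_subset_Icc ht.1.le le_rfl)
            obtain ⟨s, hs, hse⟩ := intermediate_value_Icc ht.2.le hcs
              (show p.1 ∈ Icc (e t).2 (e p.2).2 from ⟨hh, by rw [eb]; exact hp.2.2.1.le⟩)
            have := (hE s (hI ⟨ht.1.le.trans hs.1, hs.2⟩) p.1 hp.1).mp hse
            linarith [hs.1, ht.1]
          · by_contra hh
            push Not at hh
            have hcs : ContinuousOn (fun s => (e s).2) (Icc p.1 t) :=
              hc2.mono (Icc_subset_Icc le_rfl ht.2.le)
            obtain ⟨s, hs, hse⟩ := intermediate_value_Icc ht.1.le hcs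
              (show p.2 ∈ Icc (e p.1).2 (e t).2 from ⟨by rw [ea]; exact hp.2.2.1.le, hh⟩)
            have := (hE s (hI ⟨hs.1, hs.2.trans ht.2.le⟩) p.2 hp.2.1).mp hse
            linarith [hs.2, ht.2]) hlb (fun t ht => hl t (hI ht))
      exact ⟨k, fun _ => hk⟩
    · exact ⟨Homeomorph.refl _, fun h => absurd h hp⟩
  choose K hK using hex
  obtain ⟨H, hH⟩ := glue_homeo C K (fun p hp => (hK p hp).1) (by
    intro ε hε
    have huc := isCompact_Icc.uniformContinuousOn_of_continuous hc
    rw [Metric.uniformContinuousOn_iff] at huc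
    obtain ⟨δ, hδ, hu⟩ := huc (ε/4) (by linarith)
    refine ⟨min δ (ε/4), lt_min hδ (by linarith), ?_⟩
    intro p hp hd z
    obtain ⟨t, ht, hz⟩ := (hK p hp).2.2.2
    have d1 := hd.trans_le (min_le_left _ _)
    have d2 := hd.trans_le (min_le_right _ _)
    have := hu t (hgap p hp ht) p.1 (hsub hp.1) (by
      rw [Real.dist_eq, abs_of_nonneg (by linarith [ht.1])]; linarith [ht.2])
    rw [heC _ hp.1, Prod.dist_eq, Real.dist_eq] at this
    have := (le_max_left _ _).trans_lt this
    have := hz z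
    linarith)
  refine ⟨H, ?_, ?_, ?_, ?_⟩
  · intro z hz
    rw [hH]
    apply glue_out
    rintro ⟨p, hp, h⟩
    exact hp.2.2.2 _ h hz
  · intro z hz
    rw [hH]
    apply glue_out
    rintro ⟨p, hp, h⟩
    exact hz (hgap p hp (Ioo_subset_Icc_self h))
  · intro z hz
    rw [hH]
    by_cases h : ∃ p : ℝ × ℝ, IsGap C p ∧ z.2 ∈ Ioo p.1 p.2
    · obtain ⟨p, hp, h⟩ := h
      rw [glue_in K hp h]
      exact (hK p hp).2.1 z hz
    · exact glue_out K h
  · intro t ht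
    rw [hH]
    by_cases htC : t ∈ C
    · rw [heC t htC]
      apply glue_out
      rintro ⟨p, hp, h⟩
      exact hp.2.2.2 _ h htC
    · obtain ⟨p, hp, h⟩ := exists_gap hC h0 h1 ht htC
      rw [glue_in K hp (show ((c, t) : ℝ × ℝ).2 ∈ _ from h)]
      exact (hK p hp).2.2.1 t (Ioo_subset_Icc_self h)

end Schoen

set_option linter.unusedVariables false
namespace Schoen
open Set Filter Topology Metric

/-- level preservation -/
def Lev (C : Set ℝ) (Ψ : ℝ × ℝ ≃ₜ ℝ × ℝ) : Prop :=
  (∀ z, ∀ t ∈ C, (Ψ z).2 = t ↔ z.2 = t) ∧ ∀ z, (Ψ z).2 ∈ Icc (0:ℝ) 1 ↔ z.2 ∈ Icc (0:ℝ) 1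

theorem Lev.trans {C : Set ℝ} {Φ Ψ : ℝ × ℝ ≃ₜ ℝ × ℝ} (h1 : Lev C Φ) (h2 : Lev C Ψ) :
    Lev C (Φ.trans Ψ) :=
  ⟨fun z t ht => by rw [Homeomorph.trans_apply, h2.1 _ t ht, h1.1 _ t ht],
   fun z => by rw [Homeomorph.trans_apply, h2.2, h1.2]⟩

theorem Lev.symm {C : Set ℝ} {Φ : ℝ × ℝ ≃ₜ ℝ × ℝ} (h1 : Lev C Φ) : Lev C Φ.symm :=
  ⟨fun z t ht => by rw [← h1.1 _ t ht, Homeomorph.apply_symm_apply],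
   fun z => by rw [← h1.2, Homeomorph.apply_symm_apply]⟩

theorem Lev.of_snd {C : Set ℝ} {Φ : ℝ × ℝ ≃ₜ ℝ × ℝ} (h : ∀ z, (Φ z).2 = z.2) : Lev C Φ :=
  ⟨fun z t ht => by rw [h], fun z => by rw [h]⟩

theorem Lev.of_fix {C : Set ℝ} {H : ℝ × ℝ ≃ₜ ℝ × ℝ} (h1 : ∀ z : ℝ × ℝ, z.2 ∈ C → H z = z)
    (h2 : ∀ z : ℝ × ℝ, z.2 ∉ Icc (0:ℝ) 1 → H z = z) : Lev C H := by
  have key : ∀ (S : Set ℝ), (∀ z : ℝ × ℝ, z.2 ∈ S → H z = z) → ∀ z, (H z).2 ∈ S → H z = z :=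
    fun S hS z hz => H.injective (hS _ hz)
  constructor
  · intro z t ht
    constructor
    · intro h
      rw [← h, key C h1 z (h ▸ ht)]
    · intro h
      rw [h1 z (h ▸ ht), h]
  · intro z
    constructor
    · intro h
      by_contra hh
      rw [h2 z hh] at h
      exact hh h
    · intro h
      by_contra hh
      rw [key (Icc (0:ℝ) 1)ᶜ h2 z hh] at hh
      exact hh h

/-- fibrewise affine homeomorphism -/
theorem exists_aff {u v : ℝ → ℝ} (hu : Continuous u) (hv : Continuous v) (h0 : ∀ y, u y ≠ 0) :
    ∃ Φ : ℝ × ℝ ≃ₜ ℝ × ℝ, (∀ z, Φ z = (u z.2 * z.1 + v z.2, z.2)) ∧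
      ∀ z, Φ.symm z = ((z.1 - v z.2) / u z.2, z.2) := by
  refine ⟨⟨⟨fun z => (u z.2 * z.1 + v z.2, z.2), fun z => ((z.1 - v z.2) / u z.2, z.2), ?_, ?_⟩,
    ?_, ?_⟩, fun z => rfl, fun z => rfl⟩
  · intro z
    have := h0 z.2
    ext <;> simp; field_simp
  · intro z
    have := h0 z.2
    ext <;> simp; field_simp; ring
  · show Continuous (fun z : ℝ × ℝ => (u z.2 * z.1 + v z.2, z.2))
    fun_prop
  · show Continuous (fun z : ℝ × ℝ => ((z.1 - v z.2) / u z.2, z.2))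
    have : ∀ z : ℝ × ℝ, u z.2 ≠ 0 := fun z => h0 _
    fun_prop (disch := assumption)

/-- fibrewise monotone homeomorphism -/
theorem exists_fiber {F : ℝ × ℝ → ℝ} (hF : Continuous F) (hm : ∀ y, StrictMono fun x => F (x, y))
    (hs : ∀ y, Function.Surjective fun x => F (x, y)) :
    ∃ Φ : ℝ × ℝ ≃ₜ ℝ × ℝ, ∀ z, Φ z = (F z, z.2) := by
  choose iv hiv using hs
  have hiv' : ∀ y x, iv y (F (x, y)) = x := fun y x => (hm y).injective (hiv y _)
  refine ⟨⟨⟨fun z => (F z, z.2), fun z => (iv z.2 z.1, z.2), ?_, ?_⟩, ?_, ?_⟩, fun z => rfl⟩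
  · intro z; exact Prod.ext (hiv' _ _) rfl
  · intro z; exact Prod.ext (hiv _ _) rfl
  · show Continuous (fun z : ℝ × ℝ => (F z, z.2))
    fun_prop
  · show Continuous (fun z : ℝ × ℝ => (iv z.2 z.1, z.2))
    refine Continuous.prodMk ?_ continuous_snd
    rw [continuous_iff_continuousAt]
    intro z0
    rw [ContinuousAt, Metric.tendsto_nhds]
    intro ε hε
    set x0 := iv z0.2 z0.1 with hx0
    have e0 : F (x0, z0.2) = z0.1 := hiv _ _
    have l1 : F (x0 - ε, z0.2) < z0.1 := by
      rw [← e0]; exact hm _ (by linarith)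
    have l2 : z0.1 < F (x0 + ε, z0.2) := by
      rw [← e0]; exact hm _ (by linarith)
    have c1 : Continuous (fun z : ℝ × ℝ => F (x0 - ε, z.2)) := by fun_prop
    have c2 : Continuous (fun z : ℝ × ℝ => F (x0 + ε, z.2)) := by fun_prop
    filter_upwards [c1.continuousAt.eventually_lt continuous_fst.continuousAt l1,
      continuous_fst.continuousAt.eventually_lt c2.continuousAt l2] with z h1 h2
    have e1 : F (iv z.2 z.1, z.2) = z.1 := hiv _ _
    rw [← e1] at h1 h2
    have h1' := (hm z.2).lt_iff_lt.mp h1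
    have h2' := (hm z.2).lt_iff_lt.mp h2
    rw [Real.dist_eq, abs_lt]
    constructor <;> linarith

theorem step1 {C : Set ℝ} (hC : IsCompact C) (hsub : C ⊆ Icc 0 1) (h0 : (0:ℝ) ∈ C)
    (h1 : (1:ℝ) ∈ C) {e : ℝ → ℝ × ℝ} (hc : ContinuousOn e (Icc 0 1))
    (hi : InjOn e (Icc 0 1))
    (hE : ∀ t ∈ Icc (0:ℝ) 1, ∀ s ∈ C, (e t).2 = s ↔ t = s) {σ : ℝ} (hσ : σ ≠ 0) :
    ∃ Ψ : ℝ × ℝ ≃ₜ ℝ × ℝ, Lev C Ψ ∧ (∀ t ∈ Icc (0:ℝ) 1, Ψ (0, t) = e t) ∧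
      ∀ x, Ψ (x, 0) = (σ * x + (e 0).1, 0) := by
  obtain ⟨v, hv, hve⟩ := tietzeR hC.isClosed (u := fun t => (e t).1)
    (by have := hc.mono hsub; fun_prop)
  obtain ⟨Φ, hΦ, hΦs⟩ := exists_aff (u := fun _ => σ) continuous_const hv (fun _ => hσ)
  have hΦL : Lev C Φ := Lev.of_snd (fun z => by rw [hΦ])
  have hc' : ContinuousOn (fun t => Φ.symm (e t)) (Icc 0 1) := Φ.symm.continuous.comp_continuousOn hc
  have hcc : ContinuousOn (fun t => (Φ.symm (e t)).1) (Icc 0 1) := by fun_prop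
  obtain ⟨m, hm⟩ := (isCompact_Icc.image_of_continuousOn hcc).bddBelow
  have hm' : ∀ t ∈ Icc (0:ℝ) 1, m ≤ (Φ.symm (e t)).1 := fun t ht => hm ⟨t, ht, rfl⟩
  obtain ⟨H, H1, H2, -, H4⟩ := stage hC hsub h0 h1 (c := 0) (lb := min m 0 - 1) hc'
    (fun s hs t ht h => hi hs ht (Φ.symm.injective h)) (by
      intro t ht
      have := (hE t (hsub ht) t ht).mpr rfl
      rw [hΦs, this, hve ht]; simp)
    (by intro t ht s hs; rw [hΦL.symm.1 _ s hs]; exact hE t ht s hs)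
    (by linarith [min_le_right m 0])
    (by intro t ht; linarith [min_le_left m 0, hm' t ht])
  refine ⟨H.trans Φ, (Lev.of_fix H1 H2).trans hΦL, ?_, ?_⟩
  · intro t ht
    rw [Homeomorph.trans_apply, H4 t ht, Homeomorph.apply_symm_apply]
  · intro x
    rw [Homeomorph.trans_apply, H1 _ h0, hΦ]
    simp only
    rw [hve h0]

theorem step2 {C : Set ℝ} (hC : IsCompact C) (hsub : C ⊆ Icc 0 1) (h0 : (0:ℝ) ∈ C)
    (h1 : (1:ℝ) ∈ C) {e : ℝ → ℝ × ℝ} (hc : ContinuousOn e (Icc 0 1))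
    (hi : InjOn e (Icc 0 1))
    (hE : ∀ t ∈ Icc (0:ℝ) 1, ∀ s ∈ C, (e t).2 = s ↔ t = s)
    (hpos : ∀ t ∈ Icc (0:ℝ) 1, 0 < (e t).1) :
    ∃ Ψ : ℝ × ℝ ≃ₜ ℝ × ℝ, Lev C Ψ ∧ (∀ t, Ψ (0, t) = (0, t)) ∧
      ∀ t ∈ Icc (0:ℝ) 1, Ψ (1, t) = e t := by
  obtain ⟨v, hv, hve⟩ := tietzeR hC.isClosed (u := fun t => Real.log (e t).1)
    (by
      have := hc.mono hsub
      have h1 : ContinuousOn (fun t => (e t).1) C := by fun_prop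
      exact h1.log (fun t ht => (hpos t (hsub ht)).ne'))
  obtain ⟨Φ, hΦ, hΦs⟩ := exists_aff (u := fun y => Real.exp (v y)) (v := fun _ => 0)
    (by fun_prop) continuous_const (fun _ => (Real.exp_pos _).ne')
  have hΦL : Lev C Φ := Lev.of_snd (fun z => by rw [hΦ])
  have hc' : ContinuousOn (fun t => Φ.symm (e t)) (Icc 0 1) := Φ.symm.continuous.comp_continuousOn hc
  obtain ⟨H, H1, H2, H3, H4⟩ := stage hC hsub h0 h1 (c := 1) (lb := 0) hc'
    (fun s hs t ht h => hi hs ht (Φ.symm.injective h)) (by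
      intro t ht
      have := (hE t (hsub ht) t ht).mpr rfl
      have hp := hpos t (hsub ht)
      rw [hΦs, this, hve ht, Real.exp_log hp, sub_zero, div_self hp.ne'])
    (by intro t ht s hs; rw [hΦL.symm.1 _ s hs]; exact hE t ht s hs)
    one_pos
    (by
      intro t ht
      rw [hΦs]
      simp only [sub_zero]
      exact div_pos (hpos t ht) (Real.exp_pos _))
  refine ⟨H.trans Φ, (Lev.of_fix H1 H2).trans hΦL, ?_, ?_⟩
  · intro t
    rw [Homeomorph.trans_apply, H3 _ le_rfl, hΦ]
    simp
  · intro t ht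
    rw [Homeomorph.trans_apply, H4 t ht, Homeomorph.apply_symm_apply]

/-- extension of an increasing function on `[-1,1]` -/
theorem ext_mono {q : ℝ → ℝ} (hc : ContinuousOn q (Icc (-1) 1)) (hi : InjOn q (Icc (-1) 1))
    (hm : q (-1) = 0) (hp : q 1 = 1) :
    ∃ Q : ℝ → ℝ, Continuous Q ∧ StrictMono Q ∧ EqOn Q q (Icc (-1) 1) ∧
      (∀ x, x ≤ -1 → Q x = x + 1) ∧ ∀ x, 1 ≤ x → Q x = x := by
  have hle : (-1:ℝ) ≤ 1 := by norm_num
  have hmono : StrictMonoOn q (Icc (-1) 1) :=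
    hc.strictMonoOn_of_injOn_Icc hle (by rw [hm, hp]; norm_num) hi
  set P : ℝ → ℝ := fun x => (projIcc (-1:ℝ) 1 hle x : ℝ) with hP
  have hPc : Continuous P := by fun_prop
  have hPI : ∀ x, P x ∈ Icc (-1:ℝ) 1 := fun x => (projIcc (-1:ℝ) 1 hle x).2
  have hPid : ∀ x ∈ Icc (-1:ℝ) 1, P x = x := fun x hx => by simp only [hP]; rw [projIcc_of_mem hle hx]
  have hPl : ∀ x, x ≤ -1 → P x = -1 := fun x hx => by simp only [hP]; rw [projIcc_of_le_left hle hx]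
  have hPr : ∀ x, 1 ≤ x → P x = 1 := fun x hx => by simp only [hP]; rw [projIcc_of_right_le hle hx]
  have hPm : Monotone P := fun x y h => monotone_projIcc hle h
  have hPd : ∀ x, P x = max (-1) (min 1 x) := fun x => by simp only [hP]; rw [coe_projIcc]
  have hQl : ∀ x y, x < y → x - P x ≤ y - P y := by
    intro x y h
    rw [hPd, hPd]
    rcases le_total 1 x with a | a <;> rcases le_total 1 y with b | b <;>
      simp only [min_eq_left, min_eq_right, a, b] <;>
    rcases le_total (-1) x with c | c <;> rcases le_total (-1) y with d | d <;>
      simp only [max_eq_left, max_eq_right, c, d, hle] <;> linarith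
  refine ⟨fun x => q (P x) + (x - P x), ?_, ?_, ?_, ?_, ?_⟩
  · have : Continuous (fun x => q (P x)) := hc.comp_continuous hPc hPI
    exact this.add (continuous_id.sub hPc)
  · intro x y hxy
    have h1 := hQl x y hxy
    rcases (hPm hxy.le).eq_or_lt with h | h
    · simp only; rw [h] at h1 ⊢; linarith
    · have := hmono (hPI x) (hPI y) h
      simp only; linarith
  · intro x hx
    simp only [hPid x hx]; ring
  · intro x hx
    simp only [hPl x hx, hm]; ring
  · intro x hx
    simp only [hPr x hx, hp]; ring

theorem exists_G {q0 q1 : ℝ → ℝ} (hc0 : ContinuousOn q0 (Icc (-1) 1)) (hi0 : InjOn q0 (Icc (-1) 1))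
    (hm0 : q0 (-1) = 0) (hp0 : q0 1 = 1) (hc1 : ContinuousOn q1 (Icc (-1) 1))
    (hi1 : InjOn q1 (Icc (-1) 1)) (hm1 : q1 (-1) = 0) (hp1 : q1 1 = 1) :
    ∃ G : ℝ × ℝ ≃ₜ ℝ × ℝ, (∀ z, (G z).2 = z.2) ∧ (∀ y, G (-1, y) = (0, y)) ∧
      (∀ y, G (1, y) = (1, y)) ∧ (∀ x ∈ Icc (-1:ℝ) 1, G (x, 0) = (q0 x, 0)) ∧
      ∀ x ∈ Icc (-1:ℝ) 1, G (x, 1) = (q1 x, 1) := by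
  obtain ⟨Q0, c0, m0, e0, l0, r0⟩ := ext_mono hc0 hi0 hm0 hp0
  obtain ⟨Q1, c1, m1, e1, l1, r1⟩ := ext_mono hc1 hi1 hm1 hp1
  set P : ℝ → ℝ := fun x => (projIcc (0:ℝ) 1 zero_le_one x : ℝ) with hP
  have hPc : Continuous P := by fun_prop
  have hPI : ∀ x, P x ∈ Icc (0:ℝ) 1 := fun x => (projIcc (0:ℝ) 1 zero_le_one x).2
  have hP0 : P 0 = 0 := by simp [hP]
  have hP1 : P 1 = 1 := by simp [hP]
  set F : ℝ × ℝ → ℝ := fun z => (1 - P z.2) * Q0 z.1 + P z.2 * Q1 z.1 with hF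
  have hFc : Continuous F := by fun_prop
  have hFl : ∀ x y, x ≤ -1 → F (x, y) = x + 1 := by
    intro x y h; simp only [hF, l0 x h, l1 x h]; ring
  have hFr : ∀ x y, 1 ≤ x → F (x, y) = x := by
    intro x y h; simp only [hF, r0 x h, r1 x h]; ring
  obtain ⟨G, hG⟩ := exists_fiber hFc (by
      intro y a b hab
      have h0 := m0 hab
      have h1 := m1 hab
      have hp := hPI y
      simp only [hF]
      rcases hp.1.eq_or_lt with h | h
      · rw [← h]; linarith
      · have : P y * Q1 a < P y * Q1 b := mul_lt_mul_of_pos_left h1 h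
        have : (1 - P y) * Q0 a ≤ (1 - P y) * Q0 b :=
          mul_le_mul_of_nonneg_left h0.le (by linarith [hp.2])
        linarith) (by
      intro y w
      have hcy : Continuous (fun x => F (x, y)) := by fun_prop
      refine mem_range_of_exists_le_of_exists_ge hcy ⟨min (w - 1) (-1), ?_⟩ ⟨max w 1, ?_⟩
      · rw [hFl _ _ (min_le_right _ _)]
        linarith [min_le_left (w - 1) (-1)]
      · rw [hFr _ _ (le_max_right _ _)]
        exact le_max_left _ _)
  refine ⟨G, fun z => by rw [hG], ?_, ?_, ?_, ?_⟩
  · intro y; rw [hG, hFl _ _ le_rfl]; simp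
  · intro y; rw [hG, hFr _ _ le_rfl]
  · intro x hx; rw [hG]; simp only [hF, hP0, e0 hx]; simp
  · intro x hx; rw [hG]; simp only [hF, hP1, e1 hx]; simp

theorem main_homeo {C : Set ℝ} (hC : IsCompact C) (hsub : C ⊆ Icc 0 1)
    (h0 : (0:ℝ) ∈ C) (h1 : (1:ℝ) ∈ C) {g : ℝ × ℝ → ℝ × ℝ} {S : Set (ℝ × ℝ)}
    (hS : S = (({-1, 1} : Set ℝ) ×ˢ Icc (0 : ℝ) 1) ∪ (Icc (-1 : ℝ) 1 ×ˢ ({0, 1} : Set ℝ)))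
    (hc : ContinuousOn g S) (hi : InjOn g S)
    (hE : ∀ z ∈ S, ∀ s ∈ C, (g z).2 = s ↔ z.2 = s)
    (hst : ∀ z ∈ S, (g z).2 ∈ Icc (0:ℝ) 1) :
    ∃ h : ℝ × ℝ ≃ₜ ℝ × ℝ, Lev C h ∧ ∀ z ∈ S, h z = g z := by
  have sl : ∀ t ∈ Icc (0:ℝ) 1, ((-1, t) : ℝ × ℝ) ∈ S := fun t ht => by
    rw [hS]; exact Or.inl ⟨by simp, ht⟩
  have sr : ∀ t ∈ Icc (0:ℝ) 1, ((1, t) : ℝ × ℝ) ∈ S := fun t ht => by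
    rw [hS]; exact Or.inl ⟨by simp, ht⟩
  have sb : ∀ s : ℝ, (s = 0 ∨ s = 1) → ∀ x ∈ Icc (-1:ℝ) 1, ((x, s) : ℝ × ℝ) ∈ S := fun s hs x hx => by
    rw [hS]; exact Or.inr ⟨hx, hs⟩
  have z0 : (0:ℝ) ∈ Icc (0:ℝ) 1 := ⟨le_rfl, zero_le_one⟩
  have z1 : (1:ℝ) ∈ Icc (0:ℝ) 1 := ⟨zero_le_one, le_rfl⟩
  have gl0 : (g (-1, 0)).2 = 0 := (hE _ (sl 0 z0) 0 h0).mpr rfl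
  have gr0 : (g (1, 0)).2 = 0 := (hE _ (sr 0 z0) 0 h0).mpr rfl
  have hσ : (g (1, 0)).1 - (g (-1, 0)).1 ≠ 0 := by
    intro h
    have : g (1, 0) = g (-1, 0) := Prod.ext (by linarith) (by rw [gl0, gr0])
    have := hi (sr 0 z0) (sl 0 z0) this
    have := (Prod.ext_iff.mp this).1
    norm_num at this
  have cl : ContinuousOn (fun t => g (-1, t)) (Icc 0 1) :=
    hc.comp (by fun_prop) (fun t ht => sl t ht)
  have cr : ContinuousOn (fun t => g (1, t)) (Icc 0 1) :=
    hc.comp (by fun_prop) (fun t ht => sr t ht)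
  obtain ⟨Ψ1, L1, E1, F1⟩ := step1 hC hsub h0 h1 cl
    (fun s hs t ht h => (Prod.ext_iff.mp (hi (sl s hs) (sl t ht) h)).2)
    (fun t ht s hs => hE _ (sl t ht) s hs) hσ
  have ce : ContinuousOn (fun t => Ψ1.symm (g (1, t))) (Icc 0 1) :=
    Ψ1.symm.continuous.comp_continuousOn cr
  have ce1 : ContinuousOn (fun t => (Ψ1.symm (g (1, t))).1) (Icc 0 1) := by fun_prop
  have e20 : Ψ1.symm (g (1, 0)) = (1, 0) := by
    rw [Homeomorph.symm_apply_eq, F1]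
    exact Prod.ext (by simp) gr0
  have hne : ∀ t ∈ Icc (0:ℝ) 1, (Ψ1.symm (g (1, t))).1 ≠ 0 := by
    intro t ht h
    set w := Ψ1.symm (g (1, t)) with hw
    have hw2 : w.2 ∈ Icc (0:ℝ) 1 := (L1.symm.2 _).mpr (hst _ (sr t ht))
    have e : w = (0, w.2) := Prod.ext h rfl
    have e' : Ψ1 w = g (1, t) := Homeomorph.apply_symm_apply _ _
    rw [e, E1 _ hw2] at e'
    have := (Prod.ext_iff.mp (hi (sl _ hw2) (sr t ht) e')).1
    norm_num at this
  have hpos : ∀ t ∈ Icc (0:ℝ) 1, 0 < (Ψ1.symm (g (1, t))).1 := by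
    intro t ht
    by_contra hh
    push Not at hh
    obtain ⟨s, hs, hse⟩ := intermediate_value_Icc' ht.1
      (ce1.mono (Icc_subset_Icc le_rfl ht.2)) (show (0:ℝ) ∈ _ from ⟨hh, by rw [e20]; norm_num⟩)
    exact hne s ⟨hs.1, hs.2.trans ht.2⟩ hse
  obtain ⟨Ψ', L2, A2, B2⟩ := step2 hC hsub h0 h1 ce
    (fun s hs t ht h => (Prod.ext_iff.mp (hi (sr s hs) (sr t ht) (Ψ1.symm.injective h))).2)
    (fun t ht s hs => by rw [L1.symm.1 _ s hs]; exact hE _ (sr t ht) s hs) hpos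
  set Ψ := Ψ'.trans Ψ1 with hΨ
  have LΨ : Lev C Ψ := L2.trans L1
  have Pl : ∀ t ∈ Icc (0:ℝ) 1, Ψ (0, t) = g (-1, t) := fun t ht => by
    rw [hΨ, Homeomorph.trans_apply, A2, E1 t ht]
  have Pr : ∀ t ∈ Icc (0:ℝ) 1, Ψ (1, t) = g (1, t) := fun t ht => by
    rw [hΨ, Homeomorph.trans_apply, B2 t ht, Homeomorph.apply_symm_apply]
  have hq : ∀ s : ℝ, (s = 0 ∨ s = 1) →
      ContinuousOn (fun x => (Ψ.symm (g (x, s))).1) (Icc (-1) 1) ∧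
      InjOn (fun x => (Ψ.symm (g (x, s))).1) (Icc (-1) 1) ∧
      (Ψ.symm (g (-1, s))).1 = 0 ∧ (Ψ.symm (g (1, s))).1 = 1 ∧
      ∀ x ∈ Icc (-1:ℝ) 1, (Ψ.symm (g (x, s))).2 = s := by
    intro s hs
    have hsC : s ∈ C := by rcases hs with rfl | rfl <;> assumption
    have hlev : ∀ x ∈ Icc (-1:ℝ) 1, (Ψ.symm (g (x, s))).2 = s := fun x hx =>
      (LΨ.symm.1 _ s hsC).mpr ((hE _ (sb s hs x hx) s hsC).mpr rfl)
    refine ⟨?_, ?_, ?_, ?_, hlev⟩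
    · have : ContinuousOn (fun x => g (x, s)) (Icc (-1) 1) :=
        hc.comp (by fun_prop) (fun x hx => sb s hs x hx)
      have : ContinuousOn (fun x => Ψ.symm (g (x, s))) (Icc (-1) 1) :=
        Ψ.symm.continuous.comp_continuousOn this
      fun_prop
    · intro x hx y hy h
      have : Ψ.symm (g (x, s)) = Ψ.symm (g (y, s)) :=
        Prod.ext h (by rw [hlev x hx, hlev y hy])
      exact (Prod.ext_iff.mp (hi (sb s hs x hx) (sb s hs y hy) (Ψ.symm.injective this))).1
    · rw [← Pl s (hsub hsC), Homeomorph.symm_apply_apply]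
    · rw [← Pr s (hsub hsC), Homeomorph.symm_apply_apply]
  obtain ⟨a1, a2, a3, a4, a5⟩ := hq 0 (Or.inl rfl)
  obtain ⟨b1, b2, b3, b4, b5⟩ := hq 1 (Or.inr rfl)
  obtain ⟨G, G2, Gl, Gr, Gb, Gt⟩ := exists_G a1 a2 a3 a4 b1 b2 b3 b4
  refine ⟨G.trans Ψ, (Lev.of_snd G2).trans LΨ, ?_⟩
  rintro ⟨x, y⟩ hz
  rw [Homeomorph.trans_apply]
  rw [hS] at hz
  rcases hz with ⟨hx, hy⟩ | ⟨hx, hy⟩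
  · rcases hx with hx | hx
    · obtain rfl : x = -1 := hx
      rw [Gl, Pl y hy]
    · obtain rfl : x = 1 := hx
      rw [Gr, Pr y hy]
  · rcases hy with hy | hy
    · obtain rfl : y = 0 := hy
      rw [Gb x hx, ← Homeomorph.eq_symm_apply]
      exact Prod.ext rfl (a5 x hx).symm
    · obtain rfl : y = 1 := hy
      rw [Gt x hx, ← Homeomorph.eq_symm_apply]
      exact Prod.ext rfl (b5 x hx).symm

end Schoen
/-- one-dimensional analogue of Proposition 5.2, cf. Remark 5.1.
Let `C ⊆ [0,1]` be compact with `0, 1 ∈ C` and let `g : Σ → ℝ × [0,1]` be a topological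
embedding of the boundary of the square `[−1,1] × [0,1]` such that for every `t ∈ C`,
`g(Σ ∩ L_t) ⊆ L_t` and `g(Σ) ∩ L_t ⊆ g(Σ ∩ L_t)`.  Then there is a homeomorphism `h` of
`ℝ × [0,1]` onto itself with `h(L_t) = L_t` for all `t ∈ C` and `h = g` on `Σ`. -/
theorem extension_of_embedding_of_square_boundary
    (C : Set ℝ) (hCcpt : IsCompact C) (hCsub : C ⊆ Set.Icc 0 1)
    (hC0 : (0 : ℝ) ∈ C) (hC1 : (1 : ℝ) ∈ C)
    (g : ℝ × ℝ → ℝ × ℝ)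
    (hemb : Topology.IsEmbedding (sqBoundary.restrict g))
    (hrange : g '' sqBoundary ⊆ strip2)
    (hlam : ∀ t ∈ C, g '' (sqBoundary ∩ hLine t) ⊆ hLine t ∧
      (g '' sqBoundary) ∩ hLine t ⊆ g '' (sqBoundary ∩ hLine t)) :
    ∃ h : ℝ × ℝ → ℝ × ℝ,
      Topology.IsEmbedding (strip2.restrict h) ∧ h '' strip2 = strip2 ∧
      (∀ t ∈ C, h '' hLine t = hLine t) ∧
      ∀ p ∈ sqBoundary, h p = g p := by
  have hc : ContinuousOn g sqBoundary := continuousOn_iff_continuous_domRestrict.mpr hemb.continuous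
  have hi : Set.InjOn g sqBoundary := Set.injOn_iff_injective.mpr hemb.injective
  obtain ⟨h, hL, hg⟩ := Schoen.main_homeo hCcpt hCsub hC0 hC1 (g := g) (S := sqBoundary) rfl hc hi
    (by
      intro z hz s hs
      constructor
      · intro e
        obtain ⟨w, hw, hwe⟩ := (hlam s hs).2 ⟨⟨z, hz, rfl⟩, ⟨Set.mem_univ _, e⟩⟩
        have := hi hw.1 hz hwe
        rw [← this]
        exact hw.2.2
      · intro e
        exact ((hlam s hs).1 ⟨z, ⟨hz, ⟨Set.mem_univ _, e⟩⟩, rfl⟩).2)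
    (fun z hz => (hrange ⟨z, hz, rfl⟩).2)
  refine ⟨h, h.isEmbedding.comp Topology.IsEmbedding.subtypeVal, ?_, ?_, hg⟩
  · ext z
    constructor
    · rintro ⟨w, hw, rfl⟩
      exact ⟨Set.mem_univ _, (hL.2 w).mpr hw.2⟩
    · intro hz
      exact ⟨h.symm z, ⟨Set.mem_univ _, (hL.symm.2 z).mpr hz.2⟩, h.apply_symm_apply z⟩
  · intro t ht
    ext z
    constructor
    · rintro ⟨w, hw, rfl⟩
      exact ⟨Set.mem_univ _, (hL.1 w t ht).mpr hw.2⟩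
    · intro hz
      exact ⟨h.symm z, ⟨Set.mem_univ _, (hL.symm.1 z t ht).mpr hz.2⟩, h.apply_symm_apply z⟩
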